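/- Let p ∈ (0,1) with p ≠ 1/2 and let (S_n, K_n)_{n≥0} be a random trie pair family with parameter p. Then the pair ((S_n − E(S_n))/√Var(S_n), (K_n − E(K_n))/√Var(K_n)) converges in distribution, as n → ∞, to a pair of two independent standard normal random variables (i.e., to a centered bivariate Gaussian with covariance matrix the 2×2 identity). -/

import Mathlib

open MeasureTheory ProbabilityTheory Filter Topology

noncomputable def binomialMeasure (n : ℕ) (p : ℝ) : Measure ℕ :=
  ∑ k ∈ Finset.range (n + 1),
    (ENNReal.ofReal ((n.choose k : ℝ) * p ^ k * (1 - p) ^ (n - k))) • Measure.dirac k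

/-- The combination map `(B, (S',K')_j, (S'',K'')_j) ↦ (S'_B + S''_{n-B} + 1, K'_B + K''_{n-B} + n)`. -/
def trieStep (n : ℕ) (ω : ℕ × ((ℕ → ℕ × ℕ) × (ℕ → ℕ × ℕ))) : ℕ × ℕ :=
  ((ω.2.1 ω.1).1 + (ω.2.2 (n - ω.1)).1 + 1,
   (ω.2.1 ω.1).2 + (ω.2.2 (n - ω.1)).2 + n)

/-- A random trie pair family with parameter `p`, given by the joint laws
`μ n` of `(S_n, K_n)` on `ℕ × ℕ`. -/
structure IsTriePairFamily (p : ℝ) (μ : ℕ → Measure (ℕ × ℕ)) : Prop where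
  prob : ∀ n, IsProbabilityMeasure (μ n)
  moments : ∀ n r : ℕ, Integrable (fun x : ℕ × ℕ => ((x.1 : ℝ) + (x.2 : ℝ)) ^ r) (μ n)
  init0 : μ 0 = Measure.dirac (0, 0)
  init1 : μ 1 = Measure.dirac (0, 0)
  recur : ∀ n, 2 ≤ n → ∃ P : Measure (ℕ × ((ℕ → ℕ × ℕ) × (ℕ → ℕ × ℕ))),
    IsProbabilityMeasure P ∧
    P.map Prod.fst = binomialMeasure n p ∧
    (∀ j, P.map (fun ω => ω.2.1 j) = μ j) ∧
    (∀ j, P.map (fun ω => ω.2.2 j) = μ j) ∧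
    P = (P.map Prod.fst).prod
          ((P.map (fun ω => ω.2.1)).prod (P.map (fun ω => ω.2.2))) ∧
    μ n = P.map (trieStep n)

noncomputable def eS (μ : ℕ → Measure (ℕ × ℕ)) (n : ℕ) : ℝ := ∫ x, (x.1 : ℝ) ∂ μ n

noncomputable def eK (μ : ℕ → Measure (ℕ × ℕ)) (n : ℕ) : ℝ := ∫ x, (x.2 : ℝ) ∂ μ n

noncomputable def varS (μ : ℕ → Measure (ℕ × ℕ)) (n : ℕ) : ℝ :=
  ∫ x, ((x.1 : ℝ) - eS μ n) ^ 2 ∂ μ n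

noncomputable def varK (μ : ℕ → Measure (ℕ × ℕ)) (n : ℕ) : ℝ :=
  ∫ x, ((x.2 : ℝ) - eK μ n) ^ 2 ∂ μ n

noncomputable def covSK (μ : ℕ → Measure (ℕ × ℕ)) (n : ℕ) : ℝ :=
  ∫ x, ((x.1 : ℝ) - eS μ n) * ((x.2 : ℝ) - eK μ n) ∂ μ n

namespace Trie

/-- The binomial probabilities, with the two bit probabilities as separate arguments. -/
noncomputable def bw (p q : ℝ) (n k : ℕ) : ℝ := (n.choose k : ℝ) * p ^ k * q ^ (n - k)

/-- Expectation of `F` under the binomial distribution. -/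
noncomputable def bE (p q : ℝ) (n : ℕ) (F : ℕ → ℝ) : ℝ :=
  ∑ k ∈ Finset.range (n + 1), bw p q n k * F k

section Basic

variable {p q : ℝ}

lemma bw_nonneg (hp : 0 < p) (hq : 0 < q) (n k : ℕ) : 0 ≤ bw p q n k := by
  unfold bw; positivity

lemma bw_pos (hp : 0 < p) (hq : 0 < q) {n k : ℕ} (h : k ≤ n) : 0 < bw p q n k := by
  unfold bw
  have := Nat.choose_pos h
  positivity

lemma bE_const (hpq : p + q = 1) (n : ℕ) (c : ℝ) : bE p q n (fun _ => c) = c := by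
  unfold bE bw
  rw [← Finset.sum_mul]
  have := add_pow p q n
  rw [hpq, one_pow] at this
  have h2 : ∑ k ∈ Finset.range (n + 1), (n.choose k : ℝ) * p ^ k * q ^ (n - k) = 1 := by
    rw [this]; exact Finset.sum_congr rfl fun k _ => by ring
  rw [h2, one_mul]

lemma bE_congr {n : ℕ} {F G : ℕ → ℝ} (h : ∀ k ≤ n, F k = G k) : bE p q n F = bE p q n G := by
  refine Finset.sum_congr rfl fun k hk => ?_
  rw [h k (by simpa [Nat.lt_succ_iff] using hk)]

lemma bE_mono (hp : 0 < p) (hq : 0 < q) {n : ℕ} {F G : ℕ → ℝ} (h : ∀ k ≤ n, F k ≤ G k) :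
    bE p q n F ≤ bE p q n G := by
  refine Finset.sum_le_sum fun k hk => ?_
  exact mul_le_mul_of_nonneg_left (h k (by simpa [Nat.lt_succ_iff] using hk)) (bw_nonneg hp hq n k)

lemma bE_nonneg (hp : 0 < p) (hq : 0 < q) {n : ℕ} {F : ℕ → ℝ} (h : ∀ k ≤ n, 0 ≤ F k) :
    0 ≤ bE p q n F :=
  Finset.sum_nonneg fun k hk =>
    mul_nonneg (bw_nonneg hp hq n k) (h k (by simpa [Nat.lt_succ_iff] using hk))

lemma bE_add (n : ℕ) (F G : ℕ → ℝ) :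
    bE p q n (fun k => F k + G k) = bE p q n F + bE p q n G := by
  unfold bE; rw [← Finset.sum_add_distrib]; exact Finset.sum_congr rfl fun k _ => by ring

lemma bE_sub (n : ℕ) (F G : ℕ → ℝ) :
    bE p q n (fun k => F k - G k) = bE p q n F - bE p q n G := by
  unfold bE; rw [← Finset.sum_sub_distrib]; exact Finset.sum_congr rfl fun k _ => by ring

lemma bE_mul (n : ℕ) (c : ℝ) (F : ℕ → ℝ) :
    bE p q n (fun k => c * F k) = c * bE p q n F := by
  unfold bE; rw [Finset.mul_sum]; exact Finset.sum_congr rfl fun k _ => by ring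

lemma bE_neg (n : ℕ) (F : ℕ → ℝ) : bE p q n (fun k => -F k) = -bE p q n F := by
  unfold bE; rw [← Finset.sum_neg_distrib]; exact Finset.sum_congr rfl fun k _ => by ring

lemma bE_abs_le (hp : 0 < p) (hq : 0 < q) (n : ℕ) (F : ℕ → ℝ) :
    |bE p q n F| ≤ bE p q n (fun k => |F k|) := by
  refine (Finset.abs_sum_le_sum_abs _ _).trans (le_of_eq ?_)
  refine Finset.sum_congr rfl fun k _ => ?_
  rw [abs_mul, abs_of_nonneg (bw_nonneg hp hq n k)]

lemma bE_zero (F : ℕ → ℝ) : bE p q 0 F = F 0 := by simp [bE, bw]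

/-- Replacing each number of ones by the number of zeros exchanges the bit probabilities. -/
lemma bE_flip (n : ℕ) (F : ℕ → ℝ) : bE p q n (fun k => F (n - k)) = bE q p n F := by
  unfold bE
  rw [← Finset.sum_range_reflect]
  refine Finset.sum_congr rfl fun k hk => ?_
  have hk' : k ≤ n := by simpa [Nat.lt_succ_iff] using hk
  have e1 : n + 1 - 1 - k = n - k := by omega
  have e2 : n - (n - k) = k := by omega
  simp only [e1, e2]
  unfold bw
  rw [Nat.choose_symm hk', e2]; ring

/-- Conditioning on the last of `n + 1` bits. -/
lemma bE_succ (n : ℕ) (F : ℕ → ℝ) :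
    bE p q (n + 1) F = p * bE p q n (fun k => F (k + 1)) + q * bE p q n F := by
  unfold bE
  rw [Finset.sum_range_succ']
  have h1 : ∀ k ∈ Finset.range (n + 1), bw p q (n + 1) (k + 1) * F (k + 1) =
      p * (bw p q n k * F (k + 1)) +
        (n.choose (k + 1) : ℝ) * p ^ (k + 1) * q ^ (n - k) * F (k + 1) := by
    intro k _
    unfold bw
    rw [Nat.choose_succ_succ, Nat.succ_sub_succ]
    push_cast; ring
  rw [Finset.sum_congr rfl h1, Finset.sum_add_distrib, ← Finset.mul_sum, add_assoc]
  congr 1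
  rw [Finset.sum_range_succ]
  simp only [Nat.choose_succ_self, Nat.cast_zero, zero_mul, add_zero]
  rw [Finset.sum_range_succ', mul_add, Finset.mul_sum]
  congr 1
  · refine Finset.sum_congr rfl fun k hk => ?_
    have hk' : k < n := by simpa using hk
    unfold bw
    have : n - k = (n - (k + 1)) + 1 := by omega
    rw [this]; ring
  · unfold bw; simp; ring

/-- Size-biasing of the binomial distribution. -/
lemma bE_size_bias (n : ℕ) (F : ℕ → ℝ) :
    bE p q (n + 1) (fun k => k * F k) = (n + 1) * p * bE p q n (fun k => F (k + 1)) := by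
  unfold bE
  rw [Finset.sum_range_succ']
  simp only [Nat.cast_zero, zero_mul, mul_zero, add_zero]
  rw [Finset.mul_sum]
  refine Finset.sum_congr rfl fun k _ => ?_
  unfold bw
  have h : ((n + 1).choose (k + 1) : ℝ) * (k + 1) = (n + 1) * n.choose k := by
    have := Nat.add_one_mul_choose_eq n k
    exact_mod_cast this.symm
  rw [Nat.succ_sub_succ]
  push_cast
  calc ((n + 1).choose (k + 1) : ℝ) * p ^ (k + 1) * q ^ (n - k) * ((k + 1) * F (k + 1))
      = (((n + 1).choose (k + 1) : ℝ) * (k + 1)) * p ^ (k + 1) * q ^ (n - k) * F (k + 1) := by ring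
    _ = _ := by rw [h]; ring

lemma bE_id (hpq : p + q = 1) (n : ℕ) : bE p q n (fun k => (k : ℝ)) = n * p := by
  cases n with
  | zero => simp [bE_zero]
  | succ n =>
    have := bE_size_bias (p := p) (q := q) n (fun _ => 1)
    simp only [mul_one] at this
    rw [this, bE_const hpq]; push_cast; ring

/-- Stein's identity for the binomial distribution. -/
lemma bE_stein (hpq : p + q = 1) (n : ℕ) (F : ℕ → ℝ) :
    bE p q (n + 1) (fun k => ((k : ℝ) - (n + 1) * p) * F k) =
      (n + 1) * p * q * bE p q n (fun k => F (k + 1) - F k) := by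
  have h1 := bE_size_bias (p := p) (q := q) n F
  have h2 := bE_succ (p := p) (q := q) n F
  have h3 : bE p q (n + 1) (fun k => ((k : ℝ) - (n + 1) * p) * F k) =
      bE p q (n + 1) (fun k => k * F k) - (n + 1) * p * bE p q (n + 1) F := by
    rw [← bE_mul, ← bE_sub]; exact bE_congr fun k _ => by ring
  rw [h3, h1, h2, bE_sub]
  have : q = 1 - p := by linarith
  rw [this]; ring

lemma bE_dev (hpq : p + q = 1) (n : ℕ) : bE p q n (fun k => (k : ℝ) - n * p) = 0 := by
  rw [bE_sub, bE_id hpq, bE_const hpq]; ring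

lemma bE_var (hpq : p + q = 1) (n : ℕ) :
    bE p q n (fun k => ((k : ℝ) - n * p) ^ 2) = n * p * q := by
  cases n with
  | zero => simp [bE_zero]
  | succ n =>
    have := bE_stein hpq n (fun k => (k : ℝ) - (n + 1) * p)
    have e : bE p q n (fun k => ((k + 1 : ℕ) : ℝ) - (n + 1) * p - ((k : ℝ) - (n + 1) * p)) = 1 := by
      rw [← bE_const hpq n 1]; exact bE_congr fun k _ => by push_cast; ring
    rw [e, mul_one] at this
    push_cast
    rw [← this]; exact bE_congr fun k _ => by ring

lemma bE_mul_compl (hpq : p + q = 1) (n : ℕ) :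
    bE p q n (fun k => (k : ℝ) * ((n : ℝ) - k)) = n * (n - 1) * p * q := by
  have h1 := bE_var hpq n
  have e : bE p q n (fun k => (k : ℝ) * ((n : ℝ) - k)) =
      (n - 2 * n * p) * bE p q n (fun k => (k : ℝ)) + n ^ 2 * p ^ 2 -
        bE p q n (fun k => ((k : ℝ) - n * p) ^ 2) := by
    rw [← bE_const hpq n (n ^ 2 * p ^ 2 : ℝ), ← bE_mul, ← bE_add, ← bE_sub]
    refine bE_congr fun k _ => ?_
    ring
  rw [e, h1, bE_id hpq]
  have : q = 1 - p := by linarith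
  rw [this]; ring

lemma bE_inv_succ_le (hp : 0 < p) (hq : 0 < q) (hpq : p + q = 1) (n : ℕ) :
    bE p q n (fun k => 1 / ((k : ℝ) + 1)) ≤ 1 / ((n + 1) * p) := by
  have h1 := bE_size_bias (p := p) (q := q) n (fun k => 1 / (k : ℝ))
  have h2 : bE p q (n + 1) (fun k => (k : ℝ) * (1 / (k : ℝ))) ≤ 1 := by
    refine (bE_mono hp hq fun k _ => ?_).trans (bE_const hpq (n + 1) 1).le
    rcases eq_or_ne (k : ℝ) 0 with h | h
    · simp [h]
    · rw [mul_one_div_cancel h]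
  rw [h1] at h2
  push_cast at h2
  rw [le_div_iff₀ (by positivity), mul_comm]
  exact h2

lemma bE_exp (hpq : p + q = 1) (x : ℝ) (n : ℕ) :
    bE p q n (fun k => Real.exp (x * (k - n * p))) =
      (p * Real.exp (q * x) + q * Real.exp (-(p * x))) ^ n := by
  induction n with
  | zero => simp [bE_zero]
  | succ n ih =>
    have hq : q = 1 - p := by linarith
    have h1 : bE p q n (fun k => Real.exp (x * (((k + 1 : ℕ) : ℝ) - ((n + 1 : ℕ) : ℝ) * p))) =
        Real.exp (q * x) * bE p q n (fun k => Real.exp (x * (k - n * p))) := by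
      rw [← bE_mul]
      refine bE_congr fun k _ => ?_
      rw [← Real.exp_add]; congr 1; push_cast; rw [hq]; ring
    have h2 : bE p q n (fun k => Real.exp (x * ((k : ℝ) - ((n + 1 : ℕ) : ℝ) * p))) =
        Real.exp (-(p * x)) * bE p q n (fun k => Real.exp (x * (k - n * p))) := by
      rw [← bE_mul]
      refine bE_congr fun k _ => ?_
      rw [← Real.exp_add]; congr 1; push_cast; ring
    rw [bE_succ, h1, h2, ih]; ring

lemma bE_exp_le (hp : 0 < p) (hq : 0 < q) (hpq : p + q = 1) {n : ℕ} {x : ℝ}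
    (hx : n * x ^ 2 ≤ 1) (hx1 : |x| ≤ 1) :
    bE p q n (fun k => Real.exp (x * (k - n * p))) ≤ Real.exp 1 := by
  rw [bE_exp hpq]
  have hp1 : p < 1 := by linarith
  have hq1 : q < 1 := by linarith
  have key : ∀ y : ℝ, |y| ≤ 1 → Real.exp y ≤ 1 + y + y ^ 2 := by
    intro y hy
    have := Real.abs_exp_sub_one_sub_id_le hy
    linarith [(abs_le.1 this).2]
  have hbd : ∀ r : ℝ, 0 < r → r < 1 → |r * x| ≤ 1 := by
    intro r h0 h1
    rw [abs_mul, abs_of_pos h0]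
    nlinarith [abs_nonneg x]
  have h1 := key (q * x) (hbd q hq hq1)
  have h2 := key (-(p * x)) (by rw [abs_neg]; exact hbd p hp hp1)
  have h3 : p * Real.exp (q * x) + q * Real.exp (-(p * x)) ≤ Real.exp (x ^ 2) := by
    have h4 := Real.add_one_le_exp (x ^ 2)
    have : p * (1 + q * x + (q * x) ^ 2) + q * (1 + -(p * x) + (-(p * x)) ^ 2) ≤ x ^ 2 + 1 := by
      have e : q = 1 - p := by linarith
      have : p * (1 + q * x + (q * x) ^ 2) + q * (1 + -(p * x) + (-(p * x)) ^ 2)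
          = 1 + (p * q) * x ^ 2 := by rw [e]; ring
      rw [this]
      nlinarith [mul_nonneg hp.le hq.le, sq_nonneg x, mul_le_mul hp1.le hq1.le hq.le zero_le_one]
    nlinarith [mul_le_mul_of_nonneg_left h1 hp.le, mul_le_mul_of_nonneg_left h2 hq.le]
  calc _ ≤ (Real.exp (x ^ 2)) ^ n := by
        apply pow_le_pow_left₀ (by positivity) h3
    _ = Real.exp (n * x ^ 2) := by rw [← Real.exp_nat_mul]
    _ ≤ _ := Real.exp_le_exp.2 hx

lemma bE_moment (hp : 0 < p) (hq : 0 < q) (hpq : p + q = 1) (j n : ℕ) :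
    bE p q n (fun k => |(k : ℝ) - n * p| ^ j) ≤ 2 * Real.exp 1 * j.factorial * √n ^ j := by
  rcases Nat.eq_zero_or_pos n with rfl | hn
  · rw [bE_zero]
    rcases Nat.eq_zero_or_pos j with rfl | hj
    · simp
      have := Real.add_one_le_exp (1 : ℝ)
      linarith
    · simp [hj.ne']
  have hs : 0 < √(n : ℝ) := by positivity
  have hs1 : (1 : ℝ) ≤ √n := by rw [Real.one_le_sqrt]; exact_mod_cast hn
  have hss : √(n : ℝ) ^ 2 = n := Real.sq_sqrt (by positivity)
  have hx : (n : ℝ) * (1 / √n) ^ 2 ≤ 1 := by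
    rw [div_pow, hss, one_pow, mul_one_div_cancel (by positivity)]
  have hx1 : |1 / √(n : ℝ)| ≤ 1 := by
    rw [abs_of_pos (by positivity), div_le_one hs]; exact hs1
  have h1 := bE_exp_le hp hq hpq hx hx1
  have h2 := bE_exp_le hp hq hpq (x := -(1 / √n)) (n := n) (by rwa [neg_sq]) (by rwa [abs_neg])
  have pt : ∀ k ≤ n, |(k : ℝ) - n * p| ^ j ≤ (j.factorial * √n ^ j) *
      (Real.exp (1 / √n * (k - n * p)) + Real.exp (-(1 / √n) * (k - n * p))) := by
    intro k _
    set y : ℝ := 1 / √n * (k - n * p) with hy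
    have e0 : (k : ℝ) - n * p = √n * y := by rw [hy]; field_simp
    have e1 : |(k : ℝ) - n * p| ^ j = √n ^ j * |y| ^ j := by
      rw [e0, abs_mul, abs_of_pos hs, mul_pow]
    have e2 := Real.pow_div_factorial_le_exp |y| (abs_nonneg y) j
    have e3 : Real.exp |y| ≤ Real.exp y + Real.exp (-y) := by
      rcases abs_cases y with h | h <;> rw [h.1] <;>
        linarith [Real.exp_pos y, Real.exp_pos (-y)]
    rw [e1, neg_mul, ← hy]
    rw [div_le_iff₀ (by positivity)] at e2
    calc √n ^ j * |y| ^ j ≤ √n ^ j * (Real.exp |y| * j.factorial) := by gcongr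
      _ = (j.factorial * √n ^ j) * Real.exp |y| := by ring
      _ ≤ _ := by gcongr
  calc _ ≤ _ := bE_mono hp hq pt
    _ = (j.factorial * √n ^ j) * (bE p q n (fun k => Real.exp (1 / √n * (k - n * p))) +
        bE p q n (fun k => Real.exp (-(1 / √n) * (k - n * p)))) := by
          rw [bE_mul, bE_add]
    _ ≤ (j.factorial * √n ^ j) * (Real.exp 1 + Real.exp 1) := by gcongr
    _ = _ := by ring

end Basic


section Comparison

variable {p q : ℝ}

lemma exists_bound_le (f : ℕ → ℝ) (N : ℕ) : ∃ C, 0 ≤ C ∧ ∀ n ≤ N, f n ≤ C := by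
  refine ⟨∑ n ∈ Finset.range (N + 1), |f n|, Finset.sum_nonneg fun _ _ => abs_nonneg _, ?_⟩
  intro n hn
  exact (le_abs_self _).trans
    (Finset.single_le_sum (f := fun n => |f n|) (fun _ _ => abs_nonneg _)
      (Finset.mem_range.2 (Nat.lt_succ_of_le hn)))

lemma bE_indicator_ends (n : ℕ) (A B : ℝ) :
    bE p q n (fun k => (if k = n then A else 0) + (if k = 0 then B else 0)) =
      p ^ n * A + q ^ n * B := by
  rw [bE_add]
  congr 1
  · unfold bE
    rw [Finset.sum_eq_single n]
    · simp [bw]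
    · intro k _ hk; simp [hk]
    · simp
  · unfold bE
    rw [Finset.sum_eq_single 0]
    · simp [bw]
    · intro k _ hk; simp [hk]
    · simp

lemma pow_add_pow_lt_one (hp : 0 < p) (hq : 0 < q) (hpq : p + q = 1) {n : ℕ} (hn : 2 ≤ n) :
    p ^ n + q ^ n < 1 := by
  have h1 : p ^ n ≤ p ^ 2 := pow_le_pow_of_le_one hp.le (by linarith) hn
  have h2 : q ^ n ≤ q ^ 2 := pow_le_pow_of_le_one hq.le (by linarith) hn
  nlinarith [mul_pos hp hq]

/-- Maximum principle for the (weighted) splitting operator. -/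
lemma comparison_zero (hp : 0 < p) (hq : 0 < q) (hpq : p + q = 1) {u v : ℝ} (hu : 0 ≤ u)
    (hu1 : u ≤ 1) (hv : 0 ≤ v) (hv1 : v ≤ 1) {N M : ℕ} (hN : 1 ≤ N) (a : ℕ → ℝ)
    (h0 : ∀ n ≤ N, n ≤ M → a n ≤ 0)
    (h : ∀ n, N < n → n ≤ M → a n ≤ bE p q n (fun k => u * a k + v * a (n - k))) :
    ∀ n ≤ M, a n ≤ 0 := by
  intro n
  induction n using Nat.strong_induction_on with
  | _ n ih =>
    intro hM
    rcases le_or_gt n N with hn | hn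
    · exact h0 n hn hM
    by_contra! hpos
    have hlt : ∀ k < n, a k ≤ 0 := fun k hk => ih k hk (by omega)
    have h1 := h n hn hM
    have h2 : bE p q n (fun k => u * a k + v * a (n - k)) ≤
        bE p q n (fun k => (if k = n then u * a n else 0) + (if k = 0 then v * a n else 0)) := by
      refine bE_mono hp hq fun k hk => ?_
      refine add_le_add ?_ ?_
      · split_ifs with e
        · rw [e]
        · exact mul_nonpos_of_nonneg_of_nonpos hu (hlt k (by omega))
      · split_ifs with e
        · rw [e, Nat.sub_zero]
        · exact mul_nonpos_of_nonneg_of_nonpos hv (hlt _ (by omega))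
    rw [bE_indicator_ends] at h2
    have h3 := pow_add_pow_lt_one hp hq hpq (n := n) (by omega)
    have h4 : p ^ n * (u * a n) ≤ p ^ n * a n :=
      mul_le_mul_of_nonneg_left (by nlinarith) (by positivity)
    have h5 : q ^ n * (v * a n) ≤ q ^ n * a n :=
      mul_le_mul_of_nonneg_left (by nlinarith) (by positivity)
    nlinarith

/-- A subsolution of the recursion with toll `r` lies below any supersolution. -/
lemma comparison (hp : 0 < p) (hq : 0 < q) (hpq : p + q = 1) {u v : ℝ} (hu : 0 ≤ u)
    (hu1 : u ≤ 1) (hv : 0 ≤ v) (hv1 : v ≤ 1) {N M : ℕ} (hN : 1 ≤ N) (a U r : ℕ → ℝ)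
    (h0 : ∀ n ≤ N, n ≤ M → a n ≤ U n)
    (ha : ∀ n, N < n → n ≤ M → a n ≤ bE p q n (fun k => u * a k + v * a (n - k)) + r n)
    (hU : ∀ n, N < n → n ≤ M → bE p q n (fun k => u * U k + v * U (n - k)) + r n ≤ U n) :
    ∀ n ≤ M, a n ≤ U n := by
  have := comparison_zero hp hq hpq hu hu1 hv hv1 hN (fun n => a n - U n) (M := M)
    (fun n hn hM => sub_nonpos.2 (h0 n hn hM)) (fun n hn hM => by
      have e : bE p q n (fun k => u * (a k - U k) + v * (a (n - k) - U (n - k))) =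
          bE p q n (fun k => u * a k + v * a (n - k)) -
            bE p q n (fun k => u * U k + v * U (n - k)) := by
        rw [← bE_sub]; exact bE_congr fun k _ => by ring
      rw [e]
      linarith [ha n hn hM, hU n hn hM])
  exact fun n hn => sub_nonpos.1 (this n hn)

lemma bE_diff (n : ℕ) {u v : ℝ} (hpq : p + q = 1) (a r : ℕ → ℝ)
    (h1 : a n = bE p q n (fun k => u * a k + v * a (n - k)) + r n)
    (h2 : a (n + 1) = bE p q (n + 1) (fun k => u * a k + v * a (n + 1 - k)) + r (n + 1)) :
    a (n + 1) - a n = bE p q n (fun k => u * p * (a (k + 1) - a k) +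
      v * q * (a (n - k + 1) - a (n - k))) + (r (n + 1) - r n) := by
  rw [bE_succ] at h2
  have e : bE p q n (fun k => u * p * (a (k + 1) - a k) +
      v * q * (a (n - k + 1) - a (n - k))) =
      p * bE p q n (fun k => u * a (k + 1) + v * a (n + 1 - (k + 1))) +
      q * bE p q n (fun k => u * a k + v * a (n + 1 - k)) -
      bE p q n (fun k => u * a k + v * a (n - k)) := by
    rw [← bE_mul, ← bE_mul, ← bE_add, ← bE_sub]
    refine bE_congr fun k hk => ?_
    have e1 : n + 1 - (k + 1) = n - k := by omega
    have e2 : n + 1 - k = n - k + 1 := by omega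
    rw [e1, e2]
    have : q = 1 - p := by linarith
    rw [this]; ring
  rw [e, h1, h2]; ring

end Comparison

/-- Deterministic solutions of the splitting recursion with toll `s + t * n`. -/
structure Aff (p q s t : ℝ) (f : ℕ → ℝ) : Prop where
  zero : f 0 = 0
  one : f 1 = 0
  recur : ∀ n, 2 ≤ n → f n = bE p q n (fun k => f k + f (n - k)) + (s + t * n)

/-- First difference. -/
def df (f : ℕ → ℝ) (n : ℕ) : ℝ := f (n + 1) - f n

section AffDiff

variable {p q s t : ℝ} {f : ℕ → ℝ}

lemma Aff.df_recur (hpq : p + q = 1) (hf : Aff p q s t f) {n : ℕ} (hn : 2 ≤ n) :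
    df f n = bE p q n (fun k => p * df f k + q * df f (n - k)) + t := by
  have h1 := hf.recur n hn
  have h2 := hf.recur (n + 1) (by omega)
  have := bE_diff (u := 1) (v := 1) n hpq f (fun n => s + t * n) (by simpa using h1)
    (by simpa using h2)
  simp only [one_mul] at this
  unfold df
  rw [this]; push_cast; ring

lemma Aff.ddf_recur (hpq : p + q = 1) (hf : Aff p q s t f) {n : ℕ} (hn : 2 ≤ n) :
    df (df f) n = bE p q n (fun k => p ^ 2 * df (df f) k + q ^ 2 * df (df f) (n - k)) := by
  have := bE_diff (u := p) (v := q) n hpq (df f) (fun _ => t) (hf.df_recur hpq hn)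
    (hf.df_recur hpq (n := n + 1) (by omega))
  rw [sub_self, add_zero] at this
  rw [df, this]
  exact bE_congr fun k _ => by simp only [df]; ring

lemma Aff.ddf_bound (hp : 0 < p) (hq : 0 < q) (hpq : p + q = 1) (hf : Aff p q s t f) :
    ∃ C, 0 ≤ C ∧ ∀ n : ℕ, |df (df f) n| ≤ C / (n + 1) := by
  obtain ⟨C, hC, hb⟩ := exists_bound_le (fun n => |df (df f) n| * (n + 1)) 1
  refine ⟨C, hC, fun n => ?_⟩
  have hp1 : p ^ 2 ≤ 1 := by nlinarith
  have hq1 : q ^ 2 ≤ 1 := by nlinarith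
  refine comparison hp hq hpq (u := p ^ 2) (v := q ^ 2) (by positivity) hp1 (by positivity)
    hq1 (N := 1) (M := n) le_rfl (fun n => |df (df f) n|) (fun n => C / (n + 1)) (fun _ => 0) ?_ ?_ ?_
    n le_rfl
  · intro k hk _
    rw [le_div_iff₀ (by positivity)]
    exact hb k hk
  · intro k hk _
    rw [hf.ddf_recur hpq hk, add_zero]
    refine (bE_abs_le hp hq _ _).trans (bE_mono hp hq fun j _ => ?_)
    refine (abs_add_le _ _).trans (le_of_eq ?_)
    rw [abs_mul, abs_mul, abs_of_nonneg (sq_nonneg p), abs_of_nonneg (sq_nonneg q)]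
  · intro k _ _
    rw [add_zero]
    have e : bE p q k (fun j => p ^ 2 * (C / ((j : ℝ) + 1)) + q ^ 2 * (C / (((k - j : ℕ) : ℝ) + 1)))
        = C * (p ^ 2 * bE p q k (fun j => 1 / ((j : ℝ) + 1)) +
          q ^ 2 * bE p q k (fun j => 1 / (((k - j : ℕ) : ℝ) + 1))) := by
      rw [← bE_mul, ← bE_mul, ← bE_add, ← bE_mul]
      exact bE_congr fun j _ => by ring
    rw [e]
    have h1 := bE_inv_succ_le hp hq hpq k
    have h2 : bE p q k (fun j => 1 / (((k - j : ℕ) : ℝ) + 1)) ≤ 1 / ((k + 1) * q) := by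
      have hflip : bE p q k (fun j => 1 / (((k - j : ℕ) : ℝ) + 1)) =
          bE q p k (fun j => 1 / ((j : ℝ) + 1)) := bE_flip k (fun j => 1 / ((j : ℝ) + 1))
      rw [hflip]
      exact bE_inv_succ_le hq hp (by linarith) k
    have h3 : p ^ 2 * bE p q k (fun j => 1 / ((j : ℝ) + 1)) ≤ p ^ 2 * (1 / ((k + 1) * p)) := by
      gcongr
    have h4 : q ^ 2 * bE p q k (fun j => 1 / (((k - j : ℕ) : ℝ) + 1)) ≤
        q ^ 2 * (1 / ((k + 1) * q)) := by gcongr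
    have h5 : p ^ 2 * (1 / ((k + 1) * p)) + q ^ 2 * (1 / ((k + 1) * q)) = 1 / ((k : ℝ) + 1) := by
      have : p ^ 2 * (1 / ((k + 1) * p)) + q ^ 2 * (1 / ((k + 1) * q)) = (p + q) / ((k : ℝ) + 1) := by
        field_simp
      rw [this, hpq]
    calc _ ≤ C * (1 / ((k : ℝ) + 1)) := by gcongr; linarith
      _ = _ := by ring

end AffDiff

section Taylor

variable {f : ℕ → ℝ} {C : ℝ}

lemma df_lipschitz (hC : 0 ≤ C) (h : ∀ n : ℕ, |df (df f) n| ≤ C / (n + 1)) {a b : ℕ} (hab : a ≤ b) :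
    |df f b - df f a| ≤ C * ((b : ℝ) - a) / (a + 1) := by
  induction b, hab using Nat.le_induction with
  | base => simp
  | succ b hb ih =>
    have h1 : df f (b + 1) - df f a = df (df f) b + (df f b - df f a) := by
      simp only [df]; ring
    rw [h1]
    refine (abs_add_le _ _).trans ?_
    have h2 : C / ((b : ℝ) + 1) ≤ C / (a + 1) := by
      have : (a : ℝ) ≤ b := by exact_mod_cast hb
      gcongr
    have h3 : C * (((b + 1 : ℕ) : ℝ) - a) / (a + 1) = C / (a + 1) + C * ((b : ℝ) - a) / (a + 1) := by
      push_cast; ring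
    rw [h3]
    linarith [h b]

lemma taylor_up (hC : 0 ≤ C) (h : ∀ n : ℕ, |df (df f) n| ≤ C / (n + 1)) {m a : ℕ} (hm : m ≤ a) :
    |f a - f m - df f m * ((a : ℝ) - m)| ≤ C * ((a : ℝ) - m) ^ 2 / (m + 1) := by
  induction a, hm using Nat.le_induction with
  | base => simp
  | succ a ha ih =>
    have h1 : f (a + 1) - f m - df f m * (((a + 1 : ℕ) : ℝ) - m) =
        (f a - f m - df f m * ((a : ℝ) - m)) + (df f a - df f m) := by
      simp only [df]; push_cast; ring
    rw [h1]
    refine (abs_add_le _ _).trans ?_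
    have h2 := df_lipschitz hC h ha
    have h4 : (0 : ℝ) ≤ (a : ℝ) - m := by
      have : (m : ℝ) ≤ a := by exact_mod_cast ha
      linarith
    refine (add_le_add ih h2).trans ?_
    rw [← add_div]
    gcongr
    push_cast
    nlinarith

lemma taylor_down (hC : 0 ≤ C) (h : ∀ n : ℕ, |df (df f) n| ≤ C / (n + 1)) {a m : ℕ} (hm : a ≤ m) :
    |f a - f m - df f m * ((a : ℝ) - m)| ≤ C * ((a : ℝ) - m) ^ 2 / m := by
  induction m, hm using Nat.le_induction with
  | base => simp
  | succ m hm ih =>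
    have hma : (a : ℝ) ≤ m := by exact_mod_cast hm
    have h1 : f a - f (m + 1) - df f (m + 1) * ((a : ℝ) - (m + 1 : ℕ)) =
        (f a - f m - df f m * ((a : ℝ) - m)) + df (df f) m * (m + 1 - a) := by
      simp only [df]; push_cast; ring
    rw [h1]
    refine (abs_add_le _ _).trans ?_
    have h2 : |df (df f) m * ((m : ℝ) + 1 - a)| ≤ C / (m + 1) * (m + 1 - a) := by
      rw [abs_mul, abs_of_nonneg (by linarith : (0 : ℝ) ≤ (m : ℝ) + 1 - a)]
      exact mul_le_mul_of_nonneg_right (h m) (by linarith)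
    refine (add_le_add ih h2).trans ?_
    push_cast
    rcases Nat.eq_zero_or_pos m with rfl | hm0
    · have : a = 0 := by omega
      subst this
      simp
    · have hm0' : (0 : ℝ) < m := by exact_mod_cast hm0
      have e : C * ((a : ℝ) - (m + 1)) ^ 2 / (m + 1) -
          (C * ((a : ℝ) - m) ^ 2 / m + C / (m + 1) * (m + 1 - a)) =
          C * (a * (m - a)) / (m * (m + 1)) := by
        field_simp; ring
      have : 0 ≤ C * (a * ((m : ℝ) - a)) / (m * (m + 1)) := by
        have : 0 ≤ (m : ℝ) - a := by linarith
        positivity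
      linarith

lemma taylor (hC : 0 ≤ C) (h : ∀ n : ℕ, |df (df f) n| ≤ C / (n + 1)) {m : ℕ} (hm : 1 ≤ m) (a : ℕ) :
    |f a - f m - df f m * ((a : ℝ) - m)| ≤ C * ((a : ℝ) - m) ^ 2 / m := by
  rcases le_total a m with ha | ha
  · exact taylor_down hC h ha
  · refine (taylor_up hC h ha).trans ?_
    have : (0 : ℝ) < m := by exact_mod_cast hm
    gcongr
    linarith

lemma df_dist (hC : 0 ≤ C) (h : ∀ n : ℕ, |df (df f) n| ≤ C / (n + 1)) {m : ℕ} (hm : 1 ≤ m) (a : ℕ) :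
    |df f a - df f m| ≤ 4 * C * (|(a : ℝ) - m| / m + |(a : ℝ) - m| ^ 3 / m ^ 2) := by
  have hm0 : (0 : ℝ) < m := by exact_mod_cast hm
  rcases le_total m a with ha | ha
  · have ha' : (m : ℝ) ≤ a := by exact_mod_cast ha
    refine (df_lipschitz hC h ha).trans ?_
    rw [abs_of_nonneg (by linarith : (0 : ℝ) ≤ (a : ℝ) - m)]
    have h1 : C * ((a : ℝ) - m) / (m + 1) ≤ C * (((a : ℝ) - m) / m) := by
      rw [mul_div_assoc]
      gcongr
      linarith
    have h2 : 0 ≤ C * (((a : ℝ) - m) / m) := by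
      have : 0 ≤ (a : ℝ) - m := by linarith
      positivity
    have h3 : 0 ≤ C * (((a : ℝ) - m) ^ 3 / m ^ 2) := by
      have : 0 ≤ (a : ℝ) - m := by linarith
      positivity
    linarith
  · have ha' : (a : ℝ) ≤ m := by exact_mod_cast ha
    rw [abs_sub_comm]
    refine (df_lipschitz hC h ha).trans ?_
    rw [abs_of_nonpos (by linarith : (a : ℝ) - m ≤ 0)]
    set y : ℝ := -((a : ℝ) - m) with hy
    have hy0 : 0 ≤ y := by linarith
    have hy1 : (m : ℝ) - a = y := by ring
    rw [hy1]
    rcases le_total (m : ℝ) (2 * a) with h2 | h2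
    · have h1 : C * y / (a + 1) ≤ C * y / (m / 2) := by
        gcongr
        linarith
      have h3 : 0 ≤ C * (y ^ 3 / m ^ 2) := by positivity
      have h4 : 0 ≤ C * (y / m) := by positivity
      have h5 : C * y / (m / 2) = 2 * (C * (y / m)) := by field_simp
      linarith
    · have h1 : C * y / (a + 1) ≤ C * y := by
        apply div_le_self (by positivity)
        have : (0 : ℝ) ≤ a := by positivity
        linarith
      have h6 : C * y ≤ 4 * (C * (y ^ 3 / m ^ 2)) := by
        have : y ≤ 4 * (y ^ 3 / m ^ 2) := by
          rw [mul_div_assoc', le_div_iff₀ (by positivity)]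
          have : (m : ℝ) ≤ 2 * y := by linarith
          have : (m : ℝ) ^ 2 ≤ 4 * y ^ 2 := by nlinarith
          nlinarith
        nlinarith
      have h4 : 0 ≤ C * (y / m) := by positivity
      linarith

end Taylor


section Deviations

variable {p q s t : ℝ} {f : ℕ → ℝ} {C : ℝ}

lemma floor_dist {x : ℝ} (hx : 0 ≤ x) : |x - ⌊x⌋₊| ≤ 1 := by
  have h1 := Nat.floor_le hx
  have h2 := (Nat.lt_floor_add_one x).le
  rw [abs_of_nonneg (by linarith)]
  linarith

lemma floor_half {x : ℝ} (hx : 2 ≤ x) : x / 2 ≤ ⌊x⌋₊ ∧ 1 ≤ ⌊x⌋₊ := by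
  have h2 := (Nat.lt_floor_add_one x).le
  exact ⟨by linarith, Nat.le_floor (by push_cast; linarith)⟩

lemma abs_add_pow_le (a b : ℝ) (j : ℕ) : |a + b| ^ j ≤ 2 ^ j * (|a| ^ j + |b| ^ j) := by
  have h : |a + b| ≤ 2 * max |a| |b| := by
    refine (abs_add_le a b).trans ?_
    linarith [le_max_left |a| |b|, le_max_right |a| |b|]
  calc |a + b| ^ j ≤ (2 * max |a| |b|) ^ j := by gcongr
    _ = 2 ^ j * (max |a| |b|) ^ j := by ring
    _ ≤ _ := by
      gcongr
      rcases max_choice |a| |b| with e | e <;> rw [e]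
      · exact le_add_of_nonneg_right (by positivity)
      · exact le_add_of_nonneg_left (by positivity)

lemma dev_moment (hp : 0 < p) (hq : 0 < q) (hpq : p + q = 1) (j : ℕ) :
    ∃ C, 0 ≤ C ∧ ∀ n : ℕ, 1 ≤ n →
      bE p q n (fun k => |(k : ℝ) - ⌊n * p⌋₊| ^ j) ≤ C * √n ^ j := by
  refine ⟨2 ^ j * (2 * Real.exp 1 * j.factorial + 1), by positivity, fun n hn => ?_⟩
  have h1 : bE p q n (fun k => |(k : ℝ) - ⌊n * p⌋₊| ^ j) ≤
      bE p q n (fun k => 2 ^ j * (|(k : ℝ) - n * p| ^ j + 1)) := by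
    refine bE_mono hp hq fun k _ => ?_
    have e : (k : ℝ) - ⌊n * p⌋₊ = (k - n * p) + (n * p - ⌊n * p⌋₊) := by ring
    rw [e]
    refine (abs_add_pow_le _ _ j).trans ?_
    gcongr
    exact pow_le_one₀ (abs_nonneg _) (floor_dist (by positivity))
  refine h1.trans ?_
  rw [bE_mul, bE_add, bE_const hpq, mul_assoc]
  have h2 := bE_moment hp hq hpq j n
  have h3 : (1 : ℝ) ≤ √n ^ j := by
    apply one_le_pow₀
    rw [Real.one_le_sqrt]
    exact_mod_cast hn
  gcongr
  linarith

lemma sqrt_pow_two_mul (n j : ℕ) : √(n : ℝ) ^ (2 * j) = (n : ℝ) ^ j := by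
  rw [pow_mul, Real.sq_sqrt (by positivity)]

lemma df_dev_sq (hp : 0 < p) (hq : 0 < q) (hpq : p + q = 1) (hC : 0 ≤ C)
    (h : ∀ n : ℕ, |df (df f) n| ≤ C / (n + 1)) :
    ∃ D, 0 ≤ D ∧ ∀ n : ℕ, 2 ≤ n * p →
      bE p q n (fun k => (df f k - df f ⌊n * p⌋₊) ^ 2) ≤ D / n := by
  obtain ⟨D2, hD2, h2⟩ := dev_moment hp hq hpq 2
  obtain ⟨D6, hD6, h6⟩ := dev_moment hp hq hpq 6
  refine ⟨32 * C ^ 2 * (4 * D2 / p ^ 2 + 16 * D6 / p ^ 4), by positivity, fun n hn => ?_⟩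
  have hn0 : (0 : ℝ) < n := by
    by_contra! hc
    nlinarith
  have hn1 : 1 ≤ n := by exact_mod_cast hn0
  obtain ⟨hm, hm1⟩ := floor_half hn
  set m := ⌊n * p⌋₊ with hmdef
  have hm0 : (0 : ℝ) < m := by exact_mod_cast hm1
  have hinv : 1 / (m : ℝ) ≤ 2 / (n * p) := by
    rw [div_le_div_iff₀ hm0 (by positivity)]; linarith
  have h1 : bE p q n (fun k => (df f k - df f m) ^ 2) ≤
      bE p q n (fun k => 32 * C ^ 2 * ((1 / m) ^ 2 * |(k : ℝ) - m| ^ 2 +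
        (1 / m) ^ 4 * |(k : ℝ) - m| ^ 6)) := by
    refine bE_mono hp hq fun k _ => ?_
    have := df_dist hC h hm1 k
    rw [← sq_abs]
    set y := |(k : ℝ) - m|
    calc |df f k - df f m| ^ 2 ≤ (4 * C * (y / m + y ^ 3 / m ^ 2)) ^ 2 := by gcongr
      _ = 16 * C ^ 2 * (y / m + y ^ 3 / m ^ 2) ^ 2 := by ring
      _ ≤ 16 * C ^ 2 * (2 * ((y / m) ^ 2 + (y ^ 3 / m ^ 2) ^ 2)) := by
        gcongr
        nlinarith [sq_nonneg (y / m - y ^ 3 / m ^ 2)]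
      _ = _ := by ring
  refine h1.trans ?_
  rw [bE_mul, bE_add, bE_mul, bE_mul, mul_div_assoc]
  gcongr
  have e2 : √(n : ℝ) ^ 2 = n := Real.sq_sqrt hn0.le
  have e6 : √(n : ℝ) ^ 6 = n ^ 3 := sqrt_pow_two_mul n 3
  have k2 := h2 n hn1
  have k6 := h6 n hn1
  rw [e2] at k2
  rw [e6] at k6
  calc _ ≤ (2 / (n * p)) ^ 2 * (D2 * n) + (2 / (n * p)) ^ 4 * (D6 * n ^ 3) := by
        have p2 : 0 ≤ bE p q n fun k => |(k : ℝ) - m| ^ 2 :=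
          bE_nonneg hp hq fun k _ => by positivity
        have p6 : 0 ≤ bE p q n fun k => |(k : ℝ) - m| ^ 6 :=
          bE_nonneg hp hq fun k _ => by positivity
        gcongr
    _ = _ := by field_simp; ring

/-- Deviation of the toll-corrected split value from its mean. -/
def splitDev (s t : ℝ) (f : ℕ → ℝ) (n k : ℕ) : ℝ := f k + f (n - k) + (s + t * n) - f n

/-- The slope of `splitDev` at the typical split. -/
noncomputable def slope (p q : ℝ) (f : ℕ → ℝ) (x : ℝ) : ℝ := df f ⌊x * p⌋₊ - df f ⌊x * q⌋₊

lemma splitDev_mean (hpq : p + q = 1) (hf : Aff p q s t f) {n : ℕ} (hn : 2 ≤ n) :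
    bE p q n (splitDev s t f n) = 0 := by
  unfold splitDev
  rw [bE_sub, bE_const hpq, bE_add, bE_const hpq, ← hf.recur n hn, sub_self]

lemma taylor_dev (hp : 0 < p) (hC : 0 ≤ C) (h : ∀ n : ℕ, |df (df f) n| ≤ C / (n + 1))
    {n : ℕ} (hn : 2 ≤ n * p) (k : ℕ) :
    |f k - f ⌊n * p⌋₊ - df f ⌊n * p⌋₊ * ((k : ℝ) - ⌊n * p⌋₊)| ≤
      4 * C / p * ((((k : ℝ) - n * p) ^ 2 + 1) / n) := by
  have hn0 : (0 : ℝ) < n := by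
    by_contra! hc
    nlinarith
  obtain ⟨hm, hm1⟩ := floor_half hn
  have hfd := floor_dist (x := n * p) (by positivity)
  set m := ⌊n * p⌋₊ with hmdef
  have hm0 : (0 : ℝ) < m := by exact_mod_cast hm1
  refine (taylor hC h hm1 k).trans ?_
  have h1 : ((k : ℝ) - m) ^ 2 ≤ 2 * (((k : ℝ) - n * p) ^ 2 + 1) := by
    have := sq_le_sq' (abs_le.1 hfd).1 (abs_le.1 hfd).2
    nlinarith [sq_nonneg ((k : ℝ) - n * p - (n * p - m))]
  calc C * ((k : ℝ) - m) ^ 2 / m ≤ C * (2 * (((k : ℝ) - n * p) ^ 2 + 1)) / (n * p / 2) := by gcongr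
    _ = _ := by field_simp; ring

lemma splitDev_approx (hp : 0 < p) (hq : 0 < q) (hpq : p + q = 1) (hf : Aff p q s t f) :
    ∃ C, 0 ≤ C ∧ ∀ n : ℕ, 2 ≤ n * p → 2 ≤ n * q → ∀ k ≤ n,
      |splitDev s t f n k - slope p q f n * ((k : ℝ) - n * p)| ≤
        C * (1 + ((k : ℝ) - n * p) ^ 2 / n) := by
  obtain ⟨C, hC, h⟩ := hf.ddf_bound hp hq hpq
  refine ⟨2 * (4 * C / p + 4 * C / q), by positivity, fun n hn hn' k hk => ?_⟩
  have hq' : q = 1 - p := by linarith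
  have hn0 : (0 : ℝ) < n := by
    by_contra! hc
    nlinarith
  have hn4 : (4 : ℝ) ≤ n := by nlinarith
  have hn2 : 2 ≤ n := by
    have : (2 : ℝ) ≤ n := by linarith
    exact_mod_cast this
  set C' := 4 * C / p + 4 * C / q with hC'
  have hC'0 : 0 ≤ C' := by positivity
  set A := f ⌊n * p⌋₊ + f ⌊n * q⌋₊ + df f ⌊n * p⌋₊ * (n * p - ⌊n * p⌋₊) +
    df f ⌊n * q⌋₊ * (n * q - ⌊n * q⌋₊) + (s + t * n) - f n with hA
  have key : ∀ k ≤ n, |splitDev s t f n k - slope p q f n * ((k : ℝ) - n * p) - A| ≤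
      C' * ((((k : ℝ) - n * p) ^ 2 + 1) / n) := by
    intro k hk
    have h1 := taylor_dev hp hC h hn k
    have h2 := taylor_dev hq hC h hn' (n - k)
    have e2 : (((n - k : ℕ) : ℝ) - n * q) ^ 2 = ((k : ℝ) - n * p) ^ 2 := by
      rw [Nat.cast_sub hk, hq']; ring
    rw [e2] at h2
    have e : splitDev s t f n k - slope p q f n * ((k : ℝ) - n * p) - A =
        (f k - f ⌊n * p⌋₊ - df f ⌊n * p⌋₊ * ((k : ℝ) - ⌊n * p⌋₊)) +
        (f (n - k) - f ⌊n * q⌋₊ - df f ⌊n * q⌋₊ * (((n - k : ℕ) : ℝ) - ⌊n * q⌋₊)) := by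
      rw [hA, Nat.cast_sub hk]
      unfold splitDev slope
      linear_combination (-(df f ⌊n * q⌋₊) * n) * hq'
    rw [e]
    refine (abs_add_le _ _).trans ?_
    rw [hC', add_mul]
    exact add_le_add h1 h2
  have hA1 : |A| ≤ C' := by
    have e : bE p q n (fun k => splitDev s t f n k - slope p q f n * ((k : ℝ) - n * p) - A) = -A := by
      rw [bE_sub, bE_const hpq, bE_sub, bE_mul, bE_dev hpq]
      rw [splitDev_mean hpq hf hn2]; ring
    rw [← abs_neg, ← e]
    refine (bE_abs_le hp hq _ _).trans ((bE_mono hp hq key).trans ?_)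
    rw [bE_mul]
    have e3 : bE p q n (fun k => (((k : ℝ) - n * p) ^ 2 + 1) / n) = p * q + 1 / n := by
      have : bE p q n (fun k => (((k : ℝ) - n * p) ^ 2 + 1) / n) =
          1 / n * (bE p q n (fun k => ((k : ℝ) - n * p) ^ 2) + bE p q n fun _ => (1 : ℝ)) := by
        rw [← bE_add, ← bE_mul]; exact bE_congr fun k _ => by ring
      rw [this, bE_var hpq, bE_const hpq]; field_simp
    rw [e3]
    have : p * q ≤ 1 / 2 := by rw [hq']; nlinarith [sq_nonneg (p - 1 / 2)]
    have h4 : 1 / (n : ℝ) ≤ 1 / 2 := by gcongr; linarith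
    nlinarith
  have h5 : splitDev s t f n k - slope p q f n * ((k : ℝ) - n * p) =
      (splitDev s t f n k - slope p q f n * ((k : ℝ) - n * p) - A) + A := by ring
  rw [h5]
  refine (abs_add_le _ _).trans ((add_le_add (key k hk) hA1).trans ?_)
  have h6 : (((k : ℝ) - n * p) ^ 2 + 1) / n ≤ ((k : ℝ) - n * p) ^ 2 / n + 1 := by
    rw [add_div]
    gcongr
    rw [div_le_one hn0]; linarith
  have h7 : 0 ≤ ((k : ℝ) - n * p) ^ 2 / n := by positivity
  nlinarith

lemma slope_bound (hp : 0 < p) (hq : 0 < q) (hpq : p + q = 1) (hf : Aff p q s t f) :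
    ∃ C, 0 ≤ C ∧ ∀ x : ℝ, 0 ≤ x → |slope p q f x| ≤ C := by
  obtain ⟨C, hC, h⟩ := hf.ddf_bound hp hq hpq
  have key : ∀ a b : ℝ, 0 < a → 0 < b → ∀ x : ℝ, 0 ≤ x → ⌊x * a⌋₊ ≤ ⌊x * b⌋₊ →
      |df f ⌊x * b⌋₊ - df f ⌊x * a⌋₊| ≤ C * (b / a) := by
    intro a b ha hb x hx hab
    refine (df_lipschitz hC h hab).trans ?_
    rw [mul_div_assoc]
    refine mul_le_mul_of_nonneg_left ?_ hC
    have h1 := (Nat.lt_floor_add_one (x * a)).le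
    have h2 := Nat.floor_le (show 0 ≤ x * b by positivity)
    rw [div_le_div_iff₀ (by positivity) ha]
    have h3 : (0 : ℝ) ≤ ⌊x * a⌋₊ := by positivity
    nlinarith
  refine ⟨C * (p / q) + C * (q / p), by positivity, fun x hx => ?_⟩
  have h1 : 0 ≤ C * (p / q) := by positivity
  have h2 : 0 ≤ C * (q / p) := by positivity
  unfold slope
  rcases le_total ⌊x * p⌋₊ ⌊x * q⌋₊ with hle | hle
  · rw [abs_sub_comm]
    linarith [key p q hp hq x hx hle]
  · linarith [key q p hq hp x hx hle]

end Deviations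


section Covariances

variable {p q s t s' t' : ℝ} {f g : ℕ → ℝ} {C : ℝ}

lemma pos_of_two_le (hp : 0 < p) {n : ℕ} (hn : 2 ≤ n * p) : (0 : ℝ) < n := by
  by_contra! hc
  nlinarith

lemma bE_even_moment (hp : 0 < p) (hq : 0 < q) (hpq : p + q = 1) (j : ℕ) :
    ∃ C, 0 ≤ C ∧ ∀ n : ℕ, bE p q n (fun k => ((k : ℝ) - n * p) ^ (2 * j)) ≤ C * n ^ j := by
  refine ⟨2 * Real.exp 1 * (2 * j).factorial, by positivity, fun n => ?_⟩
  have := bE_moment hp hq hpq (2 * j) n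
  rw [sqrt_pow_two_mul] at this
  refine le_trans (le_of_eq (bE_congr fun k _ => ?_)) this
  rw [pow_mul, pow_mul, sq_abs]

lemma splitDev_moments (hp : 0 < p) (hq : 0 < q) (hpq : p + q = 1) (hf : Aff p q s t f) :
    ∃ C, 0 ≤ C ∧ ∀ n : ℕ, 2 ≤ n * p → 2 ≤ n * q →
      bE p q n (fun k => splitDev s t f n k ^ 2) ≤ C * (slope p q f n ^ 2 * n + 1) ∧
      bE p q n (fun k => splitDev s t f n k ^ 4) ≤ C * (slope p q f n ^ 4 * n ^ 2 + 1) := by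
  obtain ⟨C, hC, h⟩ := splitDev_approx hp hq hpq hf
  obtain ⟨M2, hM2, h2⟩ := bE_even_moment hp hq hpq 1
  obtain ⟨M4, hM4, h4⟩ := bE_even_moment hp hq hpq 2
  obtain ⟨M8, hM8, h8⟩ := bE_even_moment hp hq hpq 4
  refine ⟨2 * M2 + 4 * C ^ 2 * (1 + M4) + (8 * M4 + 64 * C ^ 4 * (1 + M8)), by positivity,
    fun n hn hn' => ?_⟩
  have hn0 := pos_of_two_le hp hn
  set d := slope p q f n
  have k2 : ∀ k ≤ n, splitDev s t f n k ^ 2 ≤ 2 * d ^ 2 * ((k : ℝ) - n * p) ^ (2 * 1) +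
      4 * C ^ 2 * (1 + 1 / n ^ 2 * ((k : ℝ) - n * p) ^ (2 * 2)) := by
    intro k hk
    have h1 := h n hn hn' k hk
    set y := (k : ℝ) - n * p
    set D := splitDev s t f n k
    have h3 : (D - d * y) ^ 2 ≤ (C * (1 + y ^ 2 / n)) ^ 2 := by
      rw [← sq_abs]; gcongr
    have h5 : (1 + y ^ 2 / n) ^ 2 ≤ 2 * (1 + 1 / n ^ 2 * y ^ (2 * 2)) := by
      have e : 1 / n ^ 2 * y ^ (2 * 2) = (y ^ 2 / n) ^ 2 := by ring
      rw [e]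
      nlinarith [sq_nonneg (1 - y ^ 2 / n)]
    calc D ^ 2 ≤ 2 * d ^ 2 * y ^ (2 * 1) + 2 * (D - d * y) ^ 2 := by
          have e : D ^ 2 = (d * y + (D - d * y)) ^ 2 := by ring
          rw [e]
          exact add_sq_le.trans_eq (by ring)
      _ ≤ 2 * d ^ 2 * y ^ (2 * 1) + 2 * (C * (1 + y ^ 2 / n)) ^ 2 := by gcongr
      _ = 2 * d ^ 2 * y ^ (2 * 1) + 2 * C ^ 2 * (1 + y ^ 2 / n) ^ 2 := by ring
      _ ≤ 2 * d ^ 2 * y ^ (2 * 1) + 2 * C ^ 2 * (2 * (1 + 1 / n ^ 2 * y ^ (2 * 2))) := by gcongr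
      _ = _ := by ring
  have k4 : ∀ k ≤ n, splitDev s t f n k ^ 4 ≤ 8 * d ^ 4 * ((k : ℝ) - n * p) ^ (2 * 2) +
      64 * C ^ 4 * (1 + 1 / n ^ 4 * ((k : ℝ) - n * p) ^ (2 * 4)) := by
    intro k hk
    have h1 := k2 k hk
    set y := (k : ℝ) - n * p
    set D := splitDev s t f n k
    have h5 : (1 + 1 / n ^ 2 * y ^ (2 * 2)) ^ 2 ≤ 2 * (1 + 1 / n ^ 4 * y ^ (2 * 4)) := by
      have e : 1 / n ^ 4 * y ^ (2 * 4) = (1 / n ^ 2 * y ^ (2 * 2)) ^ 2 := by ring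
      rw [e]
      nlinarith [sq_nonneg (1 - 1 / n ^ 2 * y ^ (2 * 2))]
    calc D ^ 4 = (D ^ 2) ^ 2 := by ring
      _ ≤ (2 * d ^ 2 * y ^ (2 * 1) + 4 * C ^ 2 * (1 + 1 / n ^ 2 * y ^ (2 * 2))) ^ 2 := by gcongr
      _ ≤ 2 * (2 * d ^ 2 * y ^ (2 * 1)) ^ 2 +
          2 * (4 * C ^ 2 * (1 + 1 / n ^ 2 * y ^ (2 * 2))) ^ 2 := add_sq_le.trans_eq (by ring)
      _ = 8 * d ^ 4 * y ^ (2 * 2) + 32 * C ^ 4 * (1 + 1 / n ^ 2 * y ^ (2 * 2)) ^ 2 := by ring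
      _ ≤ 8 * d ^ 4 * y ^ (2 * 2) + 32 * C ^ 4 * (2 * (1 + 1 / n ^ 4 * y ^ (2 * 4))) := by gcongr
      _ = _ := by ring
  have a2 : 0 ≤ M2 * (d ^ 2 * n) := by positivity
  have a2' : 0 ≤ C ^ 2 * M4 * (d ^ 2 * n) := by positivity
  constructor
  · refine (bE_mono hp hq k2).trans ?_
    rw [bE_add, bE_mul, bE_mul, bE_add, bE_mul, bE_const hpq]
    have b2 := h2 n
    have b4 := h4 n
    calc _ ≤ 2 * d ^ 2 * (M2 * n ^ 1) + 4 * C ^ 2 * (1 + 1 / n ^ 2 * (M4 * n ^ 2)) := by gcongr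
      _ = 2 * M2 * (d ^ 2 * n) + 4 * C ^ 2 * (1 + M4) * 1 := by field_simp
      _ ≤ 2 * M2 * (d ^ 2 * n + 1) + 4 * C ^ 2 * (1 + M4) * (d ^ 2 * n + 1) +
          (8 * M4 + 64 * C ^ 4 * (1 + M8)) * (d ^ 2 * n + 1) := by
        refine le_add_of_le_of_nonneg ?_ (by positivity)
        gcongr
        · linarith
        · exact le_add_of_nonneg_left (by positivity)
      _ = _ := by ring
  · refine (bE_mono hp hq k4).trans ?_
    rw [bE_add, bE_mul, bE_mul, bE_add, bE_mul, bE_const hpq]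
    have b4 := h4 n
    have b8 := h8 n
    calc _ ≤ 8 * d ^ 4 * (M4 * n ^ 2) + 64 * C ^ 4 * (1 + 1 / n ^ 4 * (M8 * n ^ 4)) := by gcongr
      _ = 8 * M4 * (d ^ 4 * n ^ 2) + 64 * C ^ 4 * (1 + M8) * 1 := by field_simp
      _ ≤ 8 * M4 * (d ^ 4 * n ^ 2 + 1) + 64 * C ^ 4 * (1 + M8) * (d ^ 4 * n ^ 2 + 1) +
          (2 * M2 + 4 * C ^ 2 * (1 + M4)) * (d ^ 4 * n ^ 2 + 1) := by
        refine le_add_of_le_of_nonneg ?_ (by positivity)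
        gcongr
        · linarith
        · exact le_add_of_nonneg_left (by positivity)
      _ = _ := by ring

/-- Covariance toll of two additive parameters. -/
noncomputable def tau (p q s t s' t' : ℝ) (f g : ℕ → ℝ) (n : ℕ) : ℝ :=
  bE p q n (fun k => splitDev s t f n k * splitDev s' t' g n k)

lemma tau_approx (hp : 0 < p) (hq : 0 < q) (hpq : p + q = 1) (hf : Aff p q s t f)
    (hg : Aff p q s' t' g) :
    ∃ C, 0 ≤ C ∧ ∀ n : ℕ, 2 ≤ n * p → 2 ≤ n * q →
      |tau p q s t s' t' f g n - slope p q f n * slope p q g n * (n * p * q)| ≤ C * √n := by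
  obtain ⟨C, hC, h⟩ := splitDev_approx hp hq hpq hf
  obtain ⟨C', hC', h'⟩ := splitDev_approx hp hq hpq hg
  obtain ⟨A, hA, hA'⟩ := slope_bound hp hq hpq hf
  obtain ⟨B, hB, hB'⟩ := slope_bound hp hq hpq hg
  obtain ⟨M4, hM4, h4⟩ := bE_even_moment hp hq hpq 2
  set K := C * B + C * C' + A * C' with hK
  have hK0 : 0 ≤ K := by positivity
  refine ⟨K * (2 * (2 * (1 + M4)) + 1), by positivity, fun n hn hn' => ?_⟩
  have hn0 := pos_of_two_le hp hn
  have hn1 : (1 : ℝ) ≤ √n := by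
    rw [Real.one_le_sqrt]
    have : 1 ≤ n := by exact_mod_cast hn0
    exact_mod_cast this
  set d := slope p q f n
  set d' := slope p q g n
  have hd : |d| ≤ A := hA' n hn0.le
  have hd' : |d'| ≤ B := hB' n hn0.le
  have e : tau p q s t s' t' f g n - d * d' * (n * p * q) =
      bE p q n (fun k => splitDev s t f n k * splitDev s' t' g n k -
        d * d' * ((k : ℝ) - n * p) ^ 2) := by
    rw [bE_sub, bE_mul, bE_var hpq]; rfl
  rw [e]
  have key : ∀ k ≤ n, |splitDev s t f n k * splitDev s' t' g n k -
      d * d' * ((k : ℝ) - n * p) ^ 2| ≤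
      K * √n * (2 * (2 * (1 + 1 / n ^ 2 * ((k : ℝ) - n * p) ^ (2 * 2))) +
        1 / n * ((k : ℝ) - n * p) ^ 2) := by
    intro k hk
    have h1 := h n hn hn' k hk
    have h1' := h' n hn hn' k hk
    set y := (k : ℝ) - n * p
    set D := splitDev s t f n k
    set D' := splitDev s' t' g n k
    set R := 1 + y ^ 2 / n with hR
    have hR0 : 0 ≤ R := by positivity
    have hR2 : R ^ 2 ≤ 2 * (1 + 1 / n ^ 2 * y ^ (2 * 2)) := by
      have e : 1 / n ^ 2 * y ^ (2 * 2) = (y ^ 2 / n) ^ 2 := by ring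
      rw [e, hR]
      nlinarith [sq_nonneg (1 - y ^ 2 / n)]
    have hRy : R * |y| ≤ √n * (R ^ 2 + 1 / n * y ^ 2) := by
      have hs : √(n : ℝ) ^ 2 = n := Real.sq_sqrt hn0.le
      have e1 : 1 / (n : ℝ) * y ^ 2 = (|y| / √n) ^ 2 := by
        rw [div_pow, hs, sq_abs]; ring
      have e2 : |y| = √n * (|y| / √n) := by field_simp
      rw [e1]
      calc R * |y| = √n * (R * (|y| / √n)) := by field_simp
        _ ≤ _ := by
          gcongr
          nlinarith [sq_nonneg (R - |y| / √n), sq_nonneg R, sq_nonneg (|y| / √n)]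
    have e3 : D * D' - d * d' * y ^ 2 =
        (D - d * y) * (d' * y) + (D - d * y) * (D' - d' * y) + (d * y) * (D' - d' * y) := by ring
    rw [e3]
    have b1 : |(D - d * y) * (d' * y)| ≤ (C * R) * (B * |y|) := by
      rw [abs_mul, abs_mul]; gcongr
    have b2 : |(D - d * y) * (D' - d' * y)| ≤ (C * R) * (C' * R) := by
      rw [abs_mul]; gcongr
    have b3 : |(d * y) * (D' - d' * y)| ≤ (A * |y|) * (C' * R) := by
      rw [abs_mul, abs_mul]; gcongr
    have hR3 : R ^ 2 ≤ √n * R ^ 2 := le_mul_of_one_le_left (sq_nonneg R) hn1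
    calc _ ≤ (C * R) * (B * |y|) + (C * R) * (C' * R) + (A * |y|) * (C' * R) := by
          refine (abs_add_le _ _).trans (add_le_add ((abs_add_le _ _).trans (add_le_add b1 b2)) b3)
      _ = (C * B + A * C') * (R * |y|) + C * C' * R ^ 2 := by ring
      _ ≤ (C * B + A * C') * (√n * (R ^ 2 + 1 / n * y ^ 2)) +
          C * C' * (√n * (R ^ 2 + 1 / n * y ^ 2)) := by
        gcongr
        refine hR3.trans ?_
        gcongr
        exact le_add_of_nonneg_right (by positivity)
      _ = K * √n * (R ^ 2 + 1 / n * y ^ 2) := by rw [hK]; ring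
      _ ≤ _ := by
        gcongr
        linarith [sq_nonneg R]
  refine (bE_abs_le hp hq _ _).trans ((bE_mono hp hq key).trans ?_)
  rw [bE_mul, bE_add, bE_mul, bE_mul, bE_mul, bE_var hpq, bE_add, bE_const hpq, bE_mul]
  have b4 := h4 n
  calc _ ≤ K * √n * (2 * (2 * (1 + 1 / n ^ 2 * (M4 * n ^ 2))) + 1 / n * (n * p * q)) := by gcongr
    _ = K * √n * (2 * (2 * (1 + M4)) + p * q) := by field_simp
    _ ≤ K * √n * (2 * (2 * (1 + M4)) + 1) := by
      gcongr
      nlinarith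
    _ = _ := by ring

/-- One-step renewal estimate and variance bound for the first difference. -/
lemma df_split (hp : 0 < p) (hq : 0 < q) (hpq : p + q = 1) (hf : Aff p q s t f) :
    ∃ D, 0 ≤ D ∧ ∀ n : ℕ, 2 ≤ n * p → 2 ≤ n * q →
      bE p q n (fun k => (p * df f k + q * df f (n - k) + t - df f n) ^ 2) ≤ D / n ∧
      (df f n - t - p * df f ⌊n * p⌋₊ - q * df f ⌊n * q⌋₊) ^ 2 ≤ D / n := by
  obtain ⟨C, hC, h⟩ := hf.ddf_bound hp hq hpq
  obtain ⟨D1, hD1, h1⟩ := df_dev_sq hp hq hpq hC h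
  obtain ⟨D2, hD2, h2⟩ := df_dev_sq hq hp (by linarith) hC h
  refine ⟨2 * (D1 + D2), by positivity, fun n hn hn' => ?_⟩
  have hn0 := pos_of_two_le hp hn
  have hn2 : 2 ≤ n := by
    have : (2 : ℝ) ≤ n := by nlinarith
    exact_mod_cast this
  set G : ℕ → ℝ := fun k => p * df f k + q * df f (n - k) + t - df f n with hG
  set c := df f n - t - p * df f ⌊n * p⌋₊ - q * df f ⌊n * q⌋₊ with hc
  have hG0 : bE p q n G = 0 := by
    have := hf.df_recur hpq hn2
    rw [hG, bE_sub, bE_const hpq, bE_add n (fun k => p * df f k + q * df f (n - k)), bE_const hpq]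
    linarith
  have e : bE p q n (fun k => (G k + c) ^ 2) = bE p q n (fun k => G k ^ 2) + c ^ 2 := by
    have : bE p q n (fun k => (G k + c) ^ 2) =
        bE p q n (fun k => G k ^ 2) + 2 * c * bE p q n G + bE p q n (fun _ => c ^ 2) := by
      rw [← bE_mul, ← bE_add, ← bE_add]; exact bE_congr fun k _ => by ring
    rw [this, hG0, bE_const hpq]; ring
  have b : bE p q n (fun k => (G k + c) ^ 2) ≤ 2 * (D1 + D2) / n := by
    have : bE p q n (fun k => (G k + c) ^ 2) ≤ bE p q n (fun k =>
        2 * ((df f k - df f ⌊n * p⌋₊) ^ 2 + (df f (n - k) - df f ⌊n * q⌋₊) ^ 2)) := by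
      refine bE_mono hp hq fun k _ => ?_
      have e1 : G k + c = p * (df f k - df f ⌊n * p⌋₊) + q * (df f (n - k) - df f ⌊n * q⌋₊) := by
        rw [hG, hc]; ring
      rw [e1]
      set u := df f k - df f ⌊n * p⌋₊
      set v := df f (n - k) - df f ⌊n * q⌋₊
      have p1 : p ^ 2 ≤ 1 := by nlinarith
      have q1 : q ^ 2 ≤ 1 := by nlinarith
      nlinarith [sq_nonneg (p * u - q * v), sq_nonneg u, sq_nonneg v,
        mul_le_mul_of_nonneg_right p1 (sq_nonneg u), mul_le_mul_of_nonneg_right q1 (sq_nonneg v)]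
    refine this.trans ?_
    rw [bE_mul, bE_add]
    have e2 := bE_flip (p := p) (q := q) n (fun k => (df f k - df f ⌊n * q⌋₊) ^ 2)
    rw [e2]
    have := h1 n hn
    have := h2 n hn'
    calc _ ≤ 2 * (D1 / n + D2 / n) := by gcongr
      _ = _ := by ring
  have n1 : 0 ≤ bE p q n (fun k => G k ^ 2) := bE_nonneg hp hq fun k _ => sq_nonneg _
  constructor
  · have := sq_nonneg c
    linarith
  · linarith

lemma df_step_sq (hp : 0 < p) (hq : 0 < q) (hpq : p + q = 1) (hC : 0 ≤ C)
    (h : ∀ n : ℕ, |df (df f) n| ≤ C / (n + 1)) (t : ℝ) :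
    ∃ D, 0 ≤ D ∧ ∀ n : ℕ, 2 ≤ n * p →
      bE p q n (fun k => (df f k + t - df f n) ^ 2) ≤ D := by
  obtain ⟨D1, hD1, h1⟩ := df_dev_sq hp hq hpq hC h
  refine ⟨2 * D1 + 2 * (|t| + C / p) ^ 2, by positivity, fun n hn => ?_⟩
  have hn0 := pos_of_two_le hp hn
  have hm : ⌊n * p⌋₊ ≤ n := by
    apply Nat.floor_le_of_le
    nlinarith
  have hb : |df f n - df f ⌊n * p⌋₊| ≤ C / p := by
    refine (df_lipschitz hC h hm).trans ?_
    have h1 := (Nat.lt_floor_add_one (n * p)).le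
    rw [div_le_div_iff₀ (by positivity) hp]
    have h3 : (0 : ℝ) ≤ ⌊n * p⌋₊ * p := by positivity
    have h4 : ((n : ℝ) - ⌊n * p⌋₊) * p ≤ ⌊n * p⌋₊ + 1 := by linarith
    rw [mul_assoc]
    exact mul_le_mul_of_nonneg_left h4 hC
  have : bE p q n (fun k => (df f k + t - df f n) ^ 2) ≤
      bE p q n (fun k => 2 * (df f k - df f ⌊n * p⌋₊) ^ 2 + 2 * (|t| + C / p) ^ 2) := by
    refine bE_mono hp hq fun k _ => ?_
    have e : df f k + t - df f n = (df f k - df f ⌊n * p⌋₊) + (t - (df f n - df f ⌊n * p⌋₊)) := by ring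
    rw [e]
    have h5 : (t - (df f n - df f ⌊n * p⌋₊)) ^ 2 ≤ (|t| + C / p) ^ 2 := by
      rw [← sq_abs]
      gcongr
      exact (abs_sub _ _).trans (by gcongr)
    refine add_sq_le.trans ?_
    linarith
  refine this.trans ?_
  rw [bE_add, bE_mul, bE_const hpq]
  have h2 := h1 n hn
  have h3 : D1 / n ≤ D1 := by
    apply div_le_self hD1
    have : 1 ≤ n := by exact_mod_cast hn0
    exact_mod_cast this
  linarith

lemma tau_step (hp : 0 < p) (hq : 0 < q) (hpq : p + q = 1) (hf : Aff p q s t f)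
    (hg : Aff p q s' t' g) :
    ∃ C, 0 ≤ C ∧ ∀ n : ℕ, 2 ≤ n * p → 2 ≤ n * q →
      |tau p q s t s' t' f g (n + 1) - tau p q s t s' t' f g n| ≤ C := by
  have key : ∀ (s t : ℝ) (f : ℕ → ℝ), Aff p q s t f → ∃ D, 0 ≤ D ∧ ∀ n : ℕ, 2 ≤ n * p → 2 ≤ n * q →
      bE p q n (fun k => splitDev s t f n k ^ 2) ≤ D * n ∧
      bE p q n (fun k => (p * df f k + q * df f (n - k) + t - df f n) ^ 2) ≤ D / n ∧
      bE p q n (fun k => (df f k + t - df f n) ^ 2) ≤ D ∧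
      bE p q n (fun k => (df f (n - k) + t - df f n) ^ 2) ≤ D := by
    intro s t f hf
    obtain ⟨C, hC, h⟩ := hf.ddf_bound hp hq hpq
    obtain ⟨A, hA, hA'⟩ := slope_bound hp hq hpq hf
    obtain ⟨D1, hD1, h1⟩ := splitDev_moments hp hq hpq hf
    obtain ⟨D2, hD2, h2⟩ := df_split hp hq hpq hf
    obtain ⟨D3, hD3, h3⟩ := df_step_sq hp hq hpq hC h t
    obtain ⟨D4, hD4, h4⟩ := df_step_sq hq hp (by linarith) hC h t
    refine ⟨D1 * (A ^ 2 + 1) + D2 + D3 + D4, by positivity, fun n hn hn' => ?_⟩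
    have hn0 := pos_of_two_le hp hn
    have hn1 : (1 : ℝ) ≤ n := by
      have : 1 ≤ n := by exact_mod_cast hn0
      exact_mod_cast this
    have p1 : 0 ≤ D1 * (A ^ 2 + 1) := by positivity
    refine ⟨?_, ?_, ?_, ?_⟩
    · refine (h1 n hn hn').1.trans ?_
      have hs : slope p q f n ^ 2 ≤ A ^ 2 := by
        rw [← sq_abs]
        have := hA' n hn0.le
        gcongr
      calc D1 * (slope p q f n ^ 2 * n + 1) ≤ D1 * (A ^ 2 * n + n) := by gcongr
        _ = D1 * (A ^ 2 + 1) * n := by ring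
        _ ≤ _ := by gcongr; linarith
    · refine (h2 n hn hn').1.trans ?_
      gcongr; linarith
    · refine (h3 n hn).trans ?_
      linarith
    · rw [bE_flip n (fun k => (df f k + t - df f n) ^ 2)]
      refine (h4 n hn').trans ?_
      linarith
  obtain ⟨D, hD, hD'⟩ := key s t f hf
  obtain ⟨E, hE, hE'⟩ := key s' t' g hg
  refine ⟨2 * (D + E), by positivity, fun n hn hn' => ?_⟩
  have hn0 := pos_of_two_le hp hn
  have hq' : q = 1 - p := by linarith
  obtain ⟨a1, a2, a3, a4⟩ := hD' n hn hn'
  obtain ⟨b1, b2, b3, b4⟩ := hE' n hn hn'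
  have sA : ∀ (s t : ℝ) (f : ℕ → ℝ) (k : ℕ), splitDev s t f (n + 1) (k + 1) =
      splitDev s t f n k + (df f k + t - df f n) := by
    intro s t f k
    unfold splitDev df
    rw [Nat.add_sub_add_right]; push_cast; ring
  have sB : ∀ (s t : ℝ) (f : ℕ → ℝ), ∀ k ≤ n, splitDev s t f (n + 1) k =
      splitDev s t f n k + (df f (n - k) + t - df f n) := by
    intro s t f k hk
    unfold splitDev df
    rw [Nat.sub_add_comm hk]; push_cast; ring
  have e : tau p q s t s' t' f g (n + 1) - tau p q s t s' t' f g n = bE p q n (fun k =>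
      splitDev s t f n k * (p * df g k + q * df g (n - k) + t' - df g n) +
      splitDev s' t' g n k * (p * df f k + q * df f (n - k) + t - df f n) +
      (p * ((df f k + t - df f n) * (df g k + t' - df g n)) +
        q * ((df f (n - k) + t - df f n) * (df g (n - k) + t' - df g n)))) := by
    unfold tau
    rw [bE_succ, ← bE_mul, ← bE_mul, ← bE_add, ← bE_sub]
    refine bE_congr fun k hk => ?_
    rw [sA, sA, sB _ _ _ k hk, sB _ _ _ k hk, hq']; ring
  rw [e]
  refine (bE_abs_le hp hq _ _).trans ?_
  have young : ∀ u v w : ℝ, 0 < w → |u * v| ≤ 1 / 2 * (1 / w * u ^ 2 + w * v ^ 2) := by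
    intro u v w hw
    rw [abs_le]
    have h1 : 1 / w * u ^ 2 + w * v ^ 2 - 2 * (u * v) = 1 / w * (u - w * v) ^ 2 := by
      field_simp; ring
    have h2 : 1 / w * u ^ 2 + w * v ^ 2 + 2 * (u * v) = 1 / w * (u + w * v) ^ 2 := by
      field_simp; ring
    have h3 : 0 ≤ 1 / w * (u - w * v) ^ 2 := by positivity
    have h4 : 0 ≤ 1 / w * (u + w * v) ^ 2 := by positivity
    constructor <;> linarith
  have hb : ∀ k ≤ n, |splitDev s t f n k * (p * df g k + q * df g (n - k) + t' - df g n) +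
      splitDev s' t' g n k * (p * df f k + q * df f (n - k) + t - df f n) +
      (p * ((df f k + t - df f n) * (df g k + t' - df g n)) +
        q * ((df f (n - k) + t - df f n) * (df g (n - k) + t' - df g n)))| ≤
      1 / 2 * (1 / n * splitDev s t f n k ^ 2 +
        n * (p * df g k + q * df g (n - k) + t' - df g n) ^ 2) +
      1 / 2 * (1 / n * splitDev s' t' g n k ^ 2 +
        n * (p * df f k + q * df f (n - k) + t - df f n) ^ 2) +
      (p * (1 / 2 * (1 / 1 * (df f k + t - df f n) ^ 2 + 1 * (df g k + t' - df g n) ^ 2)) +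
       q * (1 / 2 * (1 / 1 * (df f (n - k) + t - df f n) ^ 2 +
        1 * (df g (n - k) + t' - df g n) ^ 2))) := by
    intro k _
    refine (abs_add_le _ _).trans (add_le_add ((abs_add_le _ _).trans
      (add_le_add (young _ _ _ hn0) (young _ _ _ hn0))) ((abs_add_le _ _).trans ?_))
    rw [abs_mul p, abs_mul q, abs_of_pos hp, abs_of_pos hq]
    gcongr
    · exact young _ _ 1 one_pos
    · exact young _ _ 1 one_pos
  refine (bE_mono hp hq hb).trans ?_
  simp only [bE_add, bE_mul]
  have c1 := mul_le_mul_of_nonneg_left a1 (show 0 ≤ 1 / (n : ℝ) by positivity)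
  have c2 := mul_le_mul_of_nonneg_left a2 hn0.le
  have d1 := mul_le_mul_of_nonneg_left b1 (show 0 ≤ 1 / (n : ℝ) by positivity)
  have d2 := mul_le_mul_of_nonneg_left b2 hn0.le
  have f1 : 1 / (n : ℝ) * (D * n) = D := by field_simp
  have f2 : (n : ℝ) * (D / n) = D := by field_simp
  have f3 : 1 / (n : ℝ) * (E * n) = E := by field_simp
  have f4 : (n : ℝ) * (E / n) = E := by field_simp
  rw [f1] at c1
  rw [f2] at c2
  rw [f3] at d1
  rw [f4] at d2
  have g1 := mul_le_mul_of_nonneg_left (add_le_add a3 b3) hp.le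
  have g2 := mul_le_mul_of_nonneg_left (add_le_add a4 b4) hq.le
  have g3 : p * (D + E) + q * (D + E) = D + E := by rw [← add_mul, hpq, one_mul]
  linarith

end Covariances


section Renewal

variable {p q : ℝ}

/-- Maximum principle for approximate subsolutions of `g x = p * g (p * x) + q * g (q * x)`. -/
lemma real_max_principle (hp : 0 < p) (hq : 0 < q) (hpq : p + q = 1) :
    ∃ K, 0 ≤ K ∧ ∀ (E : Set ℝ), (∀ x ∈ E, p * x ∈ E ∧ q * x ∈ E) → ∀ (g : ℝ → ℝ) (m B M : ℝ),
      0 < m → 0 ≤ B →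
      (∀ x ∈ E, m ≤ p * x → m ≤ q * x →
        g x ≤ p * g (p * x) + q * g (q * x) + B * x ^ (-(1 / 4) : ℝ)) →
      (∀ x ∈ E, m ≤ x → (p * x < m ∨ q * x < m) → g x ≤ M) →
      ∀ x ∈ E, m ≤ x → g x ≤ M + K * B * m ^ (-(1 / 4) : ℝ) := by
  have hp1 : p < 1 := by linarith
  have hq1 : q < 1 := by linarith
  have gp : p < p ^ (3 / 4 : ℝ) := by
    conv_lhs => rw [← Real.rpow_one p]
    exact Real.rpow_lt_rpow_of_exponent_gt hp hp1 (by norm_num)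
  have gq : q < q ^ (3 / 4 : ℝ) := by
    conv_lhs => rw [← Real.rpow_one q]
    exact Real.rpow_lt_rpow_of_exponent_gt hq hq1 (by norm_num)
  set γ := p ^ (3 / 4 : ℝ) + q ^ (3 / 4 : ℝ) - 1 with hγ
  have hγ0 : 0 < γ := by linarith
  refine ⟨1 / γ, by positivity, fun E hE g m B M hm hB hg hM => ?_⟩
  have resc : ∀ a x : ℝ, 0 < a → 0 < x →
      a * (a * x) ^ (-(1 / 4) : ℝ) = a ^ (3 / 4 : ℝ) * x ^ (-(1 / 4) : ℝ) := by
    intro a x ha hx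
    rw [Real.mul_rpow ha.le hx.le, ← mul_assoc]
    congr 1
    conv_lhs => rw [← Real.rpow_one a, ← Real.rpow_mul ha.le, ← Real.rpow_add ha]
    norm_num
  have key : ∀ j : ℕ, ∀ x ∈ E, m ≤ x → x * (max p q) ^ j ≤ m →
      g x ≤ M + 1 / γ * B * (m ^ (-(1 / 4) : ℝ) - x ^ (-(1 / 4) : ℝ)) := by
    have base : ∀ x ∈ E, m ≤ x → (p * x < m ∨ q * x < m) →
        g x ≤ M + 1 / γ * B * (m ^ (-(1 / 4) : ℝ) - x ^ (-(1 / 4) : ℝ)) := by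
      intro x hx hmx h
      have h1 := hM x hx hmx h
      have h2 : x ^ (-(1 / 4) : ℝ) ≤ m ^ (-(1 / 4) : ℝ) :=
        Real.rpow_le_rpow_of_nonpos hm hmx (by norm_num)
      have h3 : 0 ≤ 1 / γ * B * (m ^ (-(1 / 4) : ℝ) - x ^ (-(1 / 4) : ℝ)) :=
        mul_nonneg (by positivity) (by linarith)
      linarith
    intro j
    induction j with
    | zero =>
      intro x hx hmx hxm
      rw [pow_zero, mul_one] at hxm
      exact base x hx hmx (Or.inl (by nlinarith))
    | succ j ih =>
      intro x hx hmx hxm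
      by_cases hc : p * x < m ∨ q * x < m
      · exact base x hx hmx hc
      · push Not at hc
        have hx0 : 0 < x := by linarith
        have hr : 0 ≤ (max p q) ^ j := by positivity
        have hstep : ∀ a, a ≤ max p q → a * x * (max p q) ^ j ≤ m := by
          intro a ha
          refine le_trans ?_ hxm
          rw [pow_succ]
          calc a * x * (max p q) ^ j ≤ max p q * x * (max p q) ^ j := by gcongr
            _ = _ := by ring
        have i1 := ih (p * x) (hE x hx).1 hc.1 (hstep p (le_max_left _ _))
        have i2 := ih (q * x) (hE x hx).2 hc.2 (hstep q (le_max_right _ _))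
        have h1 := hg x hx hc.1 hc.2
        have r1 := resc p x hp hx0
        have r2 := resc q x hq hx0
        have j1 := mul_le_mul_of_nonneg_left i1 hp.le
        have j2 := mul_le_mul_of_nonneg_left i2 hq.le
        set X := x ^ (-(1 / 4) : ℝ)
        set Y := m ^ (-(1 / 4) : ℝ)
        have e : p * (M + 1 / γ * B * (Y - (p * x) ^ (-(1 / 4) : ℝ))) +
            q * (M + 1 / γ * B * (Y - (q * x) ^ (-(1 / 4) : ℝ))) + B * X =
            M + 1 / γ * B * (Y - X) := by
          have e1 : p * (M + 1 / γ * B * (Y - (p * x) ^ (-(1 / 4) : ℝ))) +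
            q * (M + 1 / γ * B * (Y - (q * x) ^ (-(1 / 4) : ℝ))) + B * X =
            (p + q) * (M + 1 / γ * B * Y) - 1 / γ * B * (p * (p * x) ^ (-(1 / 4) : ℝ) +
              q * (q * x) ^ (-(1 / 4) : ℝ)) + B * X := by ring
          rw [e1, r1, r2, hpq]
          have e2 : p ^ (3 / 4 : ℝ) * X + q ^ (3 / 4 : ℝ) * X = (γ + 1) * X := by rw [hγ]; ring
          rw [e2]; field_simp; ring
        linarith
  intro x hx hmx
  have hr1 : max p q < 1 := max_lt hp1 hq1
  have hx0 : 0 < x := by linarith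
  obtain ⟨j, hj⟩ := exists_pow_lt_of_lt_one (show 0 < m / x by positivity) hr1
  have h1 := key j x hx hmx (by
    rw [lt_div_iff₀ hx0] at hj
    linarith)
  have h2 : 0 ≤ 1 / γ * B * x ^ (-(1 / 4) : ℝ) := by positivity
  linarith

/-- Slowly varying approximate fixed points of `φ x = p * φ (p * x) + q * φ (q * x)`. -/
structure Slow (p q : ℝ) (φ : ℝ → ℝ) : Prop where
  approx : ∃ B X, 0 ≤ B ∧ 1 ≤ X ∧ ∀ x, X ≤ x →
    |φ x - p * φ (p * x) - q * φ (q * x)| ≤ B * x ^ (-(1 / 4) : ℝ)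
  lip : ∃ C, 0 ≤ C ∧ ∀ x y, 1 ≤ x → x ≤ y → |φ y - φ x| ≤ C * (y - x + 1) / x

variable {φ : ℝ → ℝ}

lemma Slow.neg (hφ : Slow p q φ) : Slow p q (fun x => -φ x) := by
  obtain ⟨⟨B, X, hB, hX, h⟩, C, hC, h'⟩ := hφ
  refine ⟨⟨B, X, hB, hX, fun x hx => ?_⟩, C, hC, fun x y hx hxy => ?_⟩
  · rw [← abs_neg]; convert h x hx using 2; ring
  · rw [← abs_neg]; convert h' x y hx hxy using 2; ring

lemma Slow.bddAbove (hp : 0 < p) (hq : 0 < q) (hpq : p + q = 1) (hφ : Slow p q φ) :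
    ∃ B, 0 ≤ B ∧ ∀ x, 1 ≤ x → φ x ≤ B := by
  obtain ⟨K, hK, hmax⟩ := real_max_principle hp hq hpq
  obtain ⟨⟨B, X, hB, hX, h⟩, C, hC, h'⟩ := hφ
  have loc : ∀ x, 1 ≤ x → φ x ≤ |φ 1| + C * x := by
    intro x hx
    have h1 := (abs_le.1 (h' 1 x le_rfl hx)).2
    have h2 := le_abs_self (φ 1)
    rw [div_one] at h1
    linarith
  have g1 := hmax Set.univ (fun _ _ => ⟨trivial, trivial⟩) φ X B (|φ 1| + C * (X / p + X / q))
    (by linarith) hB (fun x _ hx _ => by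
      have : X ≤ x := by nlinarith
      have := (abs_le.1 (h x this)).2
      linarith) (fun x _ hx hx' => by
      have hxb : x ≤ X / p + X / q := by
        have h1 : 0 < X / p := by positivity
        have h2 : 0 < X / q := by positivity
        rcases hx' with h3 | h3
        · have : x ≤ X / p := by rw [le_div_iff₀ hp]; linarith
          linarith
        · have : x ≤ X / q := by rw [le_div_iff₀ hq]; linarith
          linarith
      refine (loc x (by linarith)).trans ?_
      gcongr)
  set D := |φ 1| + C * (X / p + X / q) + K * B * X ^ (-(1 / 4) : ℝ)
  refine ⟨max D (|φ 1| + C * X), le_max_of_le_right (by positivity), fun x hx => ?_⟩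
  rcases le_total X x with hc | hc
  · exact (g1 x trivial hc).trans (le_max_left _ _)
  · refine (loc x hx).trans (le_trans ?_ (le_max_right _ _))
    gcongr

lemma Slow.bounded (hp : 0 < p) (hq : 0 < q) (hpq : p + q = 1) (hφ : Slow p q φ) :
    ∃ B, 0 ≤ B ∧ ∀ x, 1 ≤ x → |φ x| ≤ B := by
  obtain ⟨B1, hB1, h1⟩ := hφ.bddAbove hp hq hpq
  obtain ⟨B2, hB2, h2⟩ := hφ.neg.bddAbove hp hq hpq
  refine ⟨B1 + B2, by positivity, fun x hx => abs_le.2 ⟨?_, ?_⟩⟩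
  · linarith [h2 x hx]
  · linarith [h1 x hx]

lemma Slow.tendsto_approx (hφ : Slow p q φ) :
    Tendsto (fun x => φ x - p * φ (p * x) - q * φ (q * x)) atTop (𝓝 0) := by
  obtain ⟨⟨B, X, hB, hX, h⟩, -⟩ := hφ
  have h1 : Tendsto (fun x : ℝ => B * x ^ (-(1 / 4) : ℝ)) atTop (𝓝 (B * 0)) :=
    (tendsto_rpow_neg_atTop (by norm_num)).const_mul B
  rw [mul_zero] at h1
  refine squeeze_zero_norm' ?_ h1
  filter_upwards [eventually_ge_atTop X] with x hx
  exact h x hx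

lemma Slow.tendsto_iterate (hp : 0 < p) (hq : 0 < q) (hφ : Slow p q φ) (N : ℕ) :
    Tendsto (fun x => φ x - bE p q N (fun k => φ (p ^ k * q ^ (N - k) * x))) atTop (𝓝 0) := by
  induction N with
  | zero => simp [bE_zero]
  | succ N ih =>
    have tp : Tendsto (fun x : ℝ => p * x) atTop atTop := tendsto_id.const_mul_atTop hp
    have tq : Tendsto (fun x : ℝ => q * x) atTop atTop := tendsto_id.const_mul_atTop hq
    have h := (hφ.tendsto_approx.add ((ih.comp tp).const_mul p)).add ((ih.comp tq).const_mul q)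
    simp only [mul_zero, add_zero] at h
    refine h.congr fun x => ?_
    simp only [Function.comp]
    rw [bE_succ]
    have e1 : bE p q N (fun k => φ (p ^ (k + 1) * q ^ (N + 1 - (k + 1)) * x)) =
        bE p q N (fun k => φ (p ^ k * q ^ (N - k) * (p * x))) :=
      bE_congr fun k _ => by
        rw [Nat.add_sub_add_right]; congr 1; ring
    have e2 : bE p q N (fun k => φ (p ^ k * q ^ (N + 1 - k) * x)) =
        bE p q N (fun k => φ (p ^ k * q ^ (N - k) * (q * x))) :=
      bE_congr fun k hk => by
        rw [Nat.sub_add_comm hk]; congr 1; ring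
    rw [e1, e2]; ring

lemma bE_abs_dev_le (hp : 0 < p) (hq : 0 < q) (hpq : p + q = 1) {n : ℕ} (hn : 1 ≤ n) :
    bE p q n (fun k => |(k : ℝ) - n * p|) ≤ √n := by
  have hn0 : (0 : ℝ) < n := by exact_mod_cast hn
  have hs0 : 0 < √(n : ℝ) := Real.sqrt_pos.2 hn0
  have hs : √(n : ℝ) ^ 2 = n := Real.sq_sqrt hn0.le
  have : bE p q n (fun k => |(k : ℝ) - n * p|) ≤
      bE p q n (fun k => 1 / 2 * (√n + 1 / √n * ((k : ℝ) - n * p) ^ 2)) := by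
    refine bE_mono hp hq fun k _ => ?_
    rw [← sq_abs ((k : ℝ) - n * p)]
    set y := |(k : ℝ) - n * p|
    have e : √n + 1 / √n * y ^ 2 - 2 * y = 1 / √n * (√(n : ℝ) - y) ^ 2 := by
      field_simp; ring
    have : 0 ≤ 1 / √n * (√(n : ℝ) - y) ^ 2 := by positivity
    linarith
  refine this.trans ?_
  rw [bE_mul, bE_add, bE_const hpq, bE_mul, bE_var hpq]
  have e : 1 / √n * ((n : ℝ) * p * q) = √n * (p * q) := by
    field_simp
    exact hs.symm
  rw [e]
  have : p * q ≤ 1 := by nlinarith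
  nlinarith

/-- Coupling: the two children of a node see asymptotically the same value. -/
lemma Slow.tendsto_children (hp : 0 < p) (hq : 0 < q) (hpq : p + q = 1) (hφ : Slow p q φ) :
    Tendsto (fun x => φ (p * x) - φ (q * x)) atTop (𝓝 0) := by
  obtain ⟨B, hB, hb⟩ := hφ.bounded hp hq hpq
  rw [Metric.tendsto_atTop]
  intro ε hε
  obtain ⟨N, hN⟩ : ∃ N : ℕ, B / (p * q) / √((N + 1 : ℕ) : ℝ) < ε / 2 := by
    have h1 : Tendsto (fun N : ℕ => √((N + 1 : ℕ) : ℝ)) atTop atTop :=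
      Real.tendsto_sqrt_atTop.comp (tendsto_natCast_atTop_atTop.comp (tendsto_add_atTop_nat 1))
    have h2 := h1.const_div_atTop (B / (p * q))
    exact ((h2.eventually (gt_mem_nhds (half_pos hε))).exists)
  have tp : Tendsto (fun x : ℝ => p * x) atTop atTop := tendsto_id.const_mul_atTop hp
  have tq : Tendsto (fun x : ℝ => q * x) atTop atTop := tendsto_id.const_mul_atTop hq
  have ht := hφ.tendsto_iterate hp hq N
  have h := (ht.comp tp).sub (ht.comp tq)
  rw [sub_zero] at h
  have he : ∀ᶠ x : ℝ in atTop, ∀ k ∈ Finset.range (N + 2), 1 ≤ p ^ k * q ^ (N + 1 - k) * x := by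
    rw [Filter.eventually_all_finset]
    intro k _
    exact (tendsto_id.const_mul_atTop (by positivity)).eventually_ge_atTop 1
  obtain ⟨X, hX⟩ := (he.and (h.eventually (Metric.ball_mem_nhds 0 (half_pos hε)))).exists_forall_of_atTop
  refine ⟨X, fun x hx => ?_⟩
  obtain ⟨h1, h2⟩ := hX x hx
  simp only [Function.comp] at h2
  have h2' : |φ (p * x) - bE p q N (fun k => φ (p ^ k * q ^ (N - k) * (p * x))) -
      (φ (q * x) - bE p q N (fun k => φ (p ^ k * q ^ (N - k) * (q * x))))| < ε / 2 := by
    simpa [Real.dist_eq] using h2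
  set F : ℕ → ℝ := fun k => φ (p ^ k * q ^ (N + 1 - k) * x) with hF
  have e : bE p q N (fun k => φ (p ^ k * q ^ (N - k) * (p * x))) -
      bE p q N (fun k => φ (p ^ k * q ^ (N - k) * (q * x))) =
      bE p q N (fun k => F (k + 1) - F k) := by
    rw [← bE_sub]
    refine bE_congr fun k hk => ?_
    simp only [hF]
    rw [Nat.add_sub_add_right, Nat.sub_add_comm hk]
    congr 2 <;> ring
  have st := bE_stein hpq N F
  have hst : |bE p q (N + 1) (fun k => ((k : ℝ) - (N + 1) * p) * F k)| ≤ B * √((N + 1 : ℕ) : ℝ) := by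
    refine (bE_abs_le hp hq _ _).trans ?_
    have : bE p q (N + 1) (fun k => |((k : ℝ) - (N + 1) * p) * F k|) ≤
        bE p q (N + 1) (fun k => B * |(k : ℝ) - (N + 1 : ℕ) * p|) := by
      refine bE_mono hp hq fun k hk => ?_
      rw [abs_mul, mul_comm]
      push_cast
      gcongr
      exact hb _ (h1 k (Finset.mem_range.2 (by omega)))
    refine this.trans ?_
    rw [bE_mul]
    gcongr
    exact bE_abs_dev_le hp hq hpq (by omega)
  rw [st, abs_mul] at hst
  have hN0 : (0 : ℝ) < (N + 1 : ℕ) := by positivity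
  have hfin : |bE p q N (fun k => F (k + 1) - F k)| < ε / 2 := by
    refine lt_of_le_of_lt ?_ hN
    rw [abs_of_pos (by positivity : 0 < ((N : ℝ) + 1) * p * q)] at hst
    have hs : √((N + 1 : ℕ) : ℝ) ^ 2 = (N : ℝ) + 1 := by
      rw [Real.sq_sqrt hN0.le]; push_cast; ring
    have hs0 : 0 < √((N + 1 : ℕ) : ℝ) := Real.sqrt_pos.2 hN0
    rw [div_div, le_div_iff₀ (by positivity)]
    rw [← hs] at hst
    set R := √((N + 1 : ℕ) : ℝ)
    refine le_of_mul_le_mul_right ?_ hs0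
    calc _ = R ^ 2 * p * q * |bE p q N fun k => F (k + 1) - F k| := by ring
      _ ≤ _ := hst
  rw [Real.dist_eq, sub_zero]
  rw [← e] at hfin
  rw [abs_lt] at *
  constructor <;> linarith

/-- Along any orbit of the scaling semigroup, the values eventually nearly agree. -/
lemma Slow.tendsto_scale (hp : 0 < p) (hq : 0 < q) (hpq : p + q = 1) (hφ : Slow p q φ) (i j : ℕ) :
    Tendsto (fun x => φ (p ^ i * q ^ j * x) - φ x) atTop (𝓝 0) := by
  have h0 := hφ.tendsto_children hp hq hpq
  have h1 := hφ.tendsto_approx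
  have hP : Tendsto (fun x => φ (p * x) - φ x) atTop (𝓝 0) := by
    have := (h0.const_mul q).sub h1
    simp only [mul_zero, sub_zero] at this
    refine this.congr fun x => ?_
    linear_combination φ (p * x) * hpq
  have hQ : Tendsto (fun x => φ (q * x) - φ x) atTop (𝓝 0) := by
    have := hP.sub h0
    simp only [sub_zero] at this
    exact this.congr fun x => by ring
  have step : ∀ a b : ℝ, 0 < b → Tendsto (fun x => φ (a * x) - φ x) atTop (𝓝 0) →
      Tendsto (fun x => φ (b * x) - φ x) atTop (𝓝 0) →
      Tendsto (fun x => φ (a * b * x) - φ x) atTop (𝓝 0) := by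
    intro a b hb ha hb'
    have tb : Tendsto (fun x : ℝ => b * x) atTop atTop := tendsto_id.const_mul_atTop hb
    have := (ha.comp tb).add hb'
    simp only [add_zero] at this
    refine this.congr fun x => ?_
    simp only [Function.comp]
    rw [← mul_assoc]; ring
  refine step _ _ (by positivity) ?_ ?_
  · induction i with
    | zero => simp
    | succ i ih => rw [pow_succ]; exact step _ _ hp ih hP
  · induction j with
    | zero => simp
    | succ i ih => rw [pow_succ]; exact step _ _ hq ih hQ

end Renewal


section Orbits

variable {p q : ℝ} {φ : ℝ → ℝ}

/-- Ratios of elements of the scaling semigroup generated by `p` and `q`. -/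
def scaleRatios (p q : ℝ) : Set ℝ :=
  {γ | ∃ i j a b : ℕ, γ = p ^ i * q ^ j / (p ^ a * q ^ b)}

/-- Orbit of `z` under the scaling semigroup generated by `p` and `q`. -/
def scaleOrbit (p q z : ℝ) : Set ℝ := {x | ∃ i j : ℕ, x = p ^ i * q ^ j * z}

lemma scaleOrbit_closed {z x : ℝ} (hx : x ∈ scaleOrbit p q z) :
    p * x ∈ scaleOrbit p q z ∧ q * x ∈ scaleOrbit p q z := by
  obtain ⟨i, j, rfl⟩ := hx
  exact ⟨⟨i + 1, j, by ring⟩, ⟨i, j + 1, by ring⟩⟩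

lemma self_mem_scaleOrbit (z : ℝ) : z ∈ scaleOrbit p q z := ⟨0, 0, by simp⟩

lemma Slow.uniform_ratio (hp : 0 < p) (hq : 0 < q) (hpq : p + q = 1) (hφ : Slow p q φ)
    {ε : ℝ} (hε : 0 < ε) (R : ℝ) :
    ∃ X, 1 ≤ X ∧ ∀ x, X ≤ x → ∀ γ ∈ scaleRatios p q, 1 ≤ γ → γ ≤ R →
      |φ (γ * x) - φ x| ≤ ε := by
  obtain ⟨C, hC, hlip⟩ := hφ.lip
  set Γ := scaleRatios p q ∩ Set.Icc 1 R with hΓ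
  have htb : TotallyBounded Γ := (isCompact_Icc.totallyBounded).subset Set.inter_subset_right
  set δ := ε / (3 * (C + 1)) with hδ
  have hδ0 : 0 < δ := by positivity
  obtain ⟨T, hTΓ, hTf, hT⟩ := Metric.finite_approx_of_totallyBounded htb δ hδ0
  have hlim : ∀ γ ∈ T, ∀ᶠ x in atTop, |φ (γ * x) - φ x| ≤ ε / 3 := by
    intro γ hγ
    obtain ⟨⟨i, j, a, b, rfl⟩, -⟩ := hTΓ hγ
    have tb : Tendsto (fun x : ℝ => (p ^ a * q ^ b)⁻¹ * x) atTop atTop :=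
      tendsto_id.const_mul_atTop (by positivity)
    have h1 := (hφ.tendsto_scale hp hq hpq i j).comp tb
    have h2 := (hφ.tendsto_scale hp hq hpq a b).comp tb
    have h3 := h1.sub h2
    rw [sub_zero] at h3
    have h4 := h3.eventually (Metric.closedBall_mem_nhds 0 (show 0 < ε / 3 by positivity))
    filter_upwards [h4] with x hx
    simp only [Function.comp, Real.dist_eq, sub_zero] at hx
    have e1 : p ^ i * q ^ j * ((p ^ a * q ^ b)⁻¹ * x) = p ^ i * q ^ j / (p ^ a * q ^ b) * x := by
      ring
    have e2 : p ^ a * q ^ b * ((p ^ a * q ^ b)⁻¹ * x) = x := by field_simp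
    rw [e1, e2] at hx
    convert hx using 2; ring
  have hall : ∀ᶠ x in atTop, ∀ γ ∈ T, |φ (γ * x) - φ x| ≤ ε / 3 :=
    (hTf.eventually_all (l := atTop)).2 hlim
  obtain ⟨X, hX⟩ := (hall.and (eventually_ge_atTop (max 1 (3 * C / ε)))).exists_forall_of_atTop
  refine ⟨max X 1, le_max_right _ _, fun x hx γ hγ h1 hR => ?_⟩
  obtain ⟨hx1, hx2⟩ := hX x (le_trans (le_max_left _ _) hx)
  have hx3 : 1 ≤ x := le_trans (le_max_left _ _) hx2
  have hx4 : 3 * C / ε ≤ x := le_trans (le_max_right _ _) hx2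
  have hx0 : 0 < x := by linarith
  obtain ⟨γ', hγ', hd⟩ := Set.mem_iUnion₂.1 (hT ⟨hγ, h1, hR⟩)
  rw [Metric.mem_ball, Real.dist_eq] at hd
  have h1' := (hTΓ hγ').2.1
  have near : ∀ u v : ℝ, 1 ≤ u → u ≤ v → v - u ≤ δ →
      |φ (v * x) - φ (u * x)| ≤ 2 * ε / 3 := by
    intro u v hu huv hd
    refine (hlip (u * x) (v * x) (by nlinarith) (by gcongr)).trans ?_
    have a1 : C * (v * x - u * x + 1) / (u * x) ≤ C * (v * x - u * x + 1) / x := by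
      have : 0 ≤ v * x - u * x := by nlinarith
      gcongr
      nlinarith
    have a2 : C * (v * x - u * x + 1) / x = C * (v - u) + C / x := by field_simp
    have a3 : C * (v - u) ≤ ε / 3 := by
      calc C * (v - u) ≤ (C + 1) * δ := by gcongr; linarith
        _ = ε / 3 := by rw [hδ]; field_simp
    have a4 : C / x ≤ ε / 3 := by
      rw [div_le_iff₀ hε] at hx4
      rw [div_le_iff₀ hx0]
      linarith
    linarith
  have hnear : |φ (γ * x) - φ (γ' * x)| ≤ 2 * ε / 3 := by
    rcases le_total γ γ' with hle | hle
    · rw [abs_sub_comm]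
      exact near γ γ' h1 hle (by linarith [(abs_lt.1 hd).1])
    · exact near γ' γ h1' hle (by linarith [(abs_lt.1 hd).2])
  have e : φ (γ * x) - φ x = (φ (γ * x) - φ (γ' * x)) + (φ (γ' * x) - φ x) := by ring
  rw [e]
  refine (abs_add_le _ _).trans ?_
  linarith [hx1 γ' hγ']

lemma Slow.orbit_osc (hp : 0 < p) (hq : 0 < q) (hpq : p + q = 1) (hφ : Slow p q φ)
    {ε : ℝ} (hε : 0 < ε) :
    ∃ m₀, 1 ≤ m₀ ∧ ∀ m, m₀ ≤ m → ∀ z, ∃ c, ∀ x ∈ scaleOrbit p q z, m ≤ x → |φ x - c| ≤ ε := by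
  obtain ⟨K, hK, hmax⟩ := real_max_principle hp hq hpq
  obtain ⟨X, hX1, hX⟩ := hφ.uniform_ratio hp hq hpq (half_pos hε) (1 / p + 1 / q)
  obtain ⟨B, Y, hB, hY, happ⟩ := hφ.approx
  have ht : Tendsto (fun x : ℝ => K * B * x ^ (-(1 / 4) : ℝ)) atTop (𝓝 (K * B * 0)) :=
    (tendsto_rpow_neg_atTop (by norm_num)).const_mul _
  rw [mul_zero] at ht
  obtain ⟨Z, hZ⟩ := (ht.eventually (ge_mem_nhds (half_pos hε))).exists_forall_of_atTop
  refine ⟨max X (max Y Z), le_max_of_le_left hX1, fun m hm z => ?_⟩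
  have hmX : X ≤ m := le_trans (le_max_left _ _) hm
  have hmY : Y ≤ m := le_trans (le_max_left _ _) (le_trans (le_max_right _ _) hm)
  have hmZ := hZ m (le_trans (le_max_right _ _) (le_trans (le_max_right _ _) hm))
  have hm0 : 0 < m := by linarith
  have hp1 : p < 1 := by linarith
  have hq1 : q < 1 := by linarith
  set L : Set ℝ := {x | x ∈ scaleOrbit p q z ∧ m ≤ x ∧ (p * x < m ∨ q * x < m)} with hL
  have hLR : ∀ x ∈ L, x ≤ (1 / p + 1 / q) * m := by
    rintro x ⟨-, -, h | h⟩
    · have : x ≤ 1 / p * m := by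
        rw [div_mul_eq_mul_div, le_div_iff₀ hp]; linarith
      have : 0 < 1 / q * m := by positivity
      linarith
    · have : x ≤ 1 / q * m := by
        rw [div_mul_eq_mul_div, le_div_iff₀ hq]; linarith
      have : 0 < 1 / p * m := by positivity
      linarith
  have pair : ∀ x ∈ L, ∀ y ∈ L, x ≤ y → |φ y - φ x| ≤ ε / 2 := by
    intro x hx y hy hxy
    have hx0 : 0 < x := by linarith [hx.2.1]
    have e : y = y / x * x := by field_simp
    rw [e]
    refine hX x (by linarith [hx.2.1]) _ ?_ ?_ ?_
    · obtain ⟨i, j, hy'⟩ := hy.1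
      obtain ⟨a, b, hx'⟩ := hx.1
      refine ⟨i, j, a, b, ?_⟩
      have hz : z ≠ 0 := by
        rintro rfl
        simp at hx'
        linarith
      rw [hy', hx']
      field_simp
    · rw [le_div_iff₀ hx0]; linarith
    · rw [div_le_iff₀ hx0]
      refine (hLR y hy).trans ?_
      have := hx.2.1
      gcongr
  have pair' : ∀ x ∈ L, ∀ y ∈ L, |φ y - φ x| ≤ ε / 2 := by
    intro x hx y hy
    rcases le_total x y with h | h
    · exact pair x hx y hy h
    · rw [abs_sub_comm]; exact pair y hy x hx h
  have hc : ∃ c, ∀ y ∈ L, |φ y - c| ≤ ε / 2 := by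
    rcases L.eq_empty_or_nonempty with h | ⟨x, hx⟩
    · exact ⟨0, by simp [h]⟩
    · exact ⟨φ x, pair' x hx⟩
  obtain ⟨c, hc⟩ := hc
  refine ⟨c, fun x hx hmx => ?_⟩
  have bnd : ∀ x, m ≤ p * x → Y ≤ x := fun x h => by nlinarith
  have u1 := hmax (scaleOrbit p q z) (fun _ h => scaleOrbit_closed h) φ m B (c + ε / 2) hm0 hB
    (fun x _ h1 _ => by linarith [(abs_le.1 (happ x (bnd x h1))).2])
    (fun x hx h1 h2 => by linarith [(abs_le.1 (hc x ⟨hx, h1, h2⟩)).2]) x hx hmx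
  have u2 := hmax (scaleOrbit p q z) (fun _ h => scaleOrbit_closed h) (fun x => -φ x) m B
    (-c + ε / 2) hm0 hB
    (fun x _ h1 _ => by linarith [(abs_le.1 (happ x (bnd x h1))).1])
    (fun x hx h1 h2 => by linarith [(abs_le.1 (hc x ⟨hx, h1, h2⟩)).1]) x hx hmx
  rw [abs_le]
  constructor <;> linarith

end Orbits


section Phase

variable {p q s t : ℝ} {f : ℕ → ℝ}

noncomputable def entropy (p q : ℝ) : ℝ := -(p * Real.log p + q * Real.log q)

lemma entropy_pos (hp : 0 < p) (hq : 0 < q) (hpq : p + q = 1) : 0 < entropy p q := by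
  have h1 : Real.log p < 0 := Real.log_neg hp (by linarith)
  have h2 : Real.log q < 0 := Real.log_neg hq (by linarith)
  unfold entropy
  nlinarith [mul_pos hp (neg_pos.2 h1), mul_pos hq (neg_pos.2 h2)]

lemma rpow_quarter_le {x : ℝ} (hx : 1 ≤ x) :
    1 / √x ≤ x ^ (-(1 / 4) : ℝ) ∧ 1 / x ≤ x ^ (-(1 / 4) : ℝ) := by
  constructor
  · rw [Real.sqrt_eq_rpow, one_div, ← Real.rpow_neg (by linarith)]
    exact Real.rpow_le_rpow_of_exponent_le hx (by norm_num)
  · rw [one_div, ← Real.rpow_neg_one]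
    exact Real.rpow_le_rpow_of_exponent_le hx (by norm_num)

lemma floor_mul_floor (hp : 0 < p) (hp1 : p ≤ 1) {x : ℝ} (hx : 0 ≤ x) :
    ⌊(⌊x⌋₊ : ℝ) * p⌋₊ ≤ ⌊p * x⌋₊ ∧ ⌊p * x⌋₊ ≤ ⌊(⌊x⌋₊ : ℝ) * p⌋₊ + 1 := by
  have h1 := Nat.floor_le hx
  have h2 := Nat.lt_floor_add_one x
  constructor
  · exact Nat.floor_le_floor (by nlinarith)
  · rw [← Nat.floor_add_one (by positivity)]
    exact Nat.floor_le_floor (by nlinarith)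

lemma df_floor_floor {C : ℝ} (hp : 0 < p) (hp1 : p ≤ 1) (hC : 0 ≤ C)
    (h : ∀ n : ℕ, |df (df f) n| ≤ C / (n + 1)) {x : ℝ} (hx : 2 ≤ x) :
    |df f ⌊p * x⌋₊ - df f ⌊(⌊x⌋₊ : ℝ) * p⌋₊| ≤ 2 * C / p * (1 / x) := by
  obtain ⟨h1, h2⟩ := floor_mul_floor hp hp1 (x := x) (by linarith)
  have h3 := df_lipschitz hC h h1
  have h4 := Nat.lt_floor_add_one ((⌊x⌋₊ : ℝ) * p)
  have h5 := (floor_half hx).1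
  refine h3.trans ?_
  have h2' : (⌊p * x⌋₊ : ℝ) ≤ ⌊(⌊x⌋₊ : ℝ) * p⌋₊ + 1 := by exact_mod_cast h2
  have e : 2 * C / p * (1 / x) = C * 1 / (x / 2 * p) := by field_simp
  rw [e]
  have : x / 2 * p ≤ ⌊x⌋₊ * p := by nlinarith
  have : 0 < x / 2 * p := by positivity
  gcongr <;> linarith

theorem Aff.slow (hp : 0 < p) (hq : 0 < q) (hpq : p + q = 1) (hf : Aff p q s t f) :
    Slow p q (fun x => df f ⌊x⌋₊ - t / entropy p q * Real.log x) := by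
  obtain ⟨C, hC, h⟩ := hf.ddf_bound hp hq hpq
  obtain ⟨D, hD, hD'⟩ := df_split hp hq hpq hf
  have hh := entropy_pos hp hq hpq
  refine ⟨⟨√(2 * D) + 2 * C + 2 * C, 2 + 4 / p + 4 / q, by positivity, ?_, ?_⟩, ?_⟩
  · have : 0 < 4 / p := by positivity
    have : 0 < 4 / q := by positivity
    linarith
  · intro x hx
    have hp4 : 0 < 4 / p := by positivity
    have hq4 : 0 < 4 / q := by positivity
    have hx2 : 2 ≤ x := by linarith
    have hx0 : 0 < x := by linarith
    have hn := (floor_half hx2).1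
    have hxp : 2 ≤ (⌊x⌋₊ : ℝ) * p := by
      have : 4 / p ≤ x := by linarith
      rw [div_le_iff₀ hp] at this
      nlinarith
    have hxq : 2 ≤ (⌊x⌋₊ : ℝ) * q := by
      have : 4 / q ≤ x := by linarith
      rw [div_le_iff₀ hq] at this
      nlinarith
    have h1 := (hD' _ hxp hxq).2
    have h2 := df_floor_floor hp (by linarith) hC h hx2
    have h3 := df_floor_floor hq (by linarith) hC h hx2
    obtain ⟨r1, r2⟩ := rpow_quarter_le (x := x) (by linarith)
    have h4 : |df f ⌊x⌋₊ - t - p * df f ⌊(⌊x⌋₊ : ℝ) * p⌋₊ - q * df f ⌊(⌊x⌋₊ : ℝ) * q⌋₊|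
        ≤ √(2 * D) * (1 / √x) := by
      rw [← Real.sqrt_sq_eq_abs, mul_one_div, ← Real.sqrt_div (by positivity)]
      apply Real.sqrt_le_sqrt
      refine h1.trans ?_
      have : 2 * D / x = D / (x / 2) := by field_simp
      rw [this]
      gcongr
    have e : df f ⌊x⌋₊ - t / entropy p q * Real.log x
        - p * (df f ⌊p * x⌋₊ - t / entropy p q * Real.log (p * x))
        - q * (df f ⌊q * x⌋₊ - t / entropy p q * Real.log (q * x)) =
        (df f ⌊x⌋₊ - t - p * df f ⌊(⌊x⌋₊ : ℝ) * p⌋₊ - q * df f ⌊(⌊x⌋₊ : ℝ) * q⌋₊)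
        - p * (df f ⌊p * x⌋₊ - df f ⌊(⌊x⌋₊ : ℝ) * p⌋₊)
        - q * (df f ⌊q * x⌋₊ - df f ⌊(⌊x⌋₊ : ℝ) * q⌋₊) := by
      have e1 : t / entropy p q * entropy p q = t := by field_simp
      rw [Real.log_mul hp.ne' hx0.ne', Real.log_mul hq.ne' hx0.ne']
      have e2 : entropy p q = -(p * Real.log p + q * Real.log q) := rfl
      generalize t / entropy p q = a at *
      have e3 : q = 1 - p := by linarith
      rw [← e1, e2]
      linear_combination (a * Real.log x) * hpq
    rw [e]
    refine (abs_sub _ _).trans ?_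
    have h5 := abs_sub (df f ⌊x⌋₊ - t - p * df f ⌊(⌊x⌋₊ : ℝ) * p⌋₊ - q * df f ⌊(⌊x⌋₊ : ℝ) * q⌋₊)
        (p * (df f ⌊p * x⌋₊ - df f ⌊(⌊x⌋₊ : ℝ) * p⌋₊))
    have h6 : |p * (df f ⌊p * x⌋₊ - df f ⌊(⌊x⌋₊ : ℝ) * p⌋₊)| ≤ 2 * C * (1 / x) := by
      rw [abs_mul, abs_of_pos hp]
      calc _ ≤ p * (2 * C / p * (1 / x)) := by gcongr
        _ = _ := by field_simp
    have h7 : |q * (df f ⌊q * x⌋₊ - df f ⌊(⌊x⌋₊ : ℝ) * q⌋₊)| ≤ 2 * C * (1 / x) := by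
      rw [abs_mul, abs_of_pos hq]
      calc _ ≤ q * (2 * C / q * (1 / x)) := by gcongr
        _ = _ := by field_simp
    have h8 : √(2 * D) * (1 / √x) ≤ √(2 * D) * x ^ (-(1 / 4) : ℝ) := by gcongr
    have h9 : 2 * C * (1 / x) ≤ 2 * C * x ^ (-(1 / 4) : ℝ) := by gcongr
    linarith
  · refine ⟨C + |t / entropy p q|, by positivity, ?_⟩
    intro x y hx hxy
    have hx0 : 0 < x := by linarith
    have h1 := df_lipschitz hC h (Nat.floor_le_floor hxy)
    have h2 : C * ((⌊y⌋₊ : ℝ) - ⌊x⌋₊) / (⌊x⌋₊ + 1) ≤ C * (y - x + 1) / x := by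
      have a1 := Nat.floor_le (a := y) (by linarith)
      have a2 := Nat.lt_floor_add_one x
      gcongr ?_ * ?_ / ?_; linarith
    have h3 : 0 ≤ Real.log y - Real.log x := sub_nonneg.2 (Real.log_le_log hx0 hxy)
    have h4 : Real.log y - Real.log x ≤ (y - x + 1) / x := by
      rw [← Real.log_div (by linarith) hx0.ne']
      have hy0 : 0 < y := by linarith
      refine (Real.log_le_sub_one_of_pos (by positivity)).trans ?_
      have : y / x - 1 = (y - x) / x := by field_simp
      rw [this]
      gcongr
      linarith
    have e : df f ⌊y⌋₊ - t / entropy p q * Real.log y - (df f ⌊x⌋₊ - t / entropy p q * Real.log x)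
      = (df f ⌊y⌋₊ - df f ⌊x⌋₊) - t / entropy p q * (Real.log y - Real.log x) := by ring
    rw [e]
    refine (abs_sub _ _).trans ?_
    rw [abs_mul, abs_of_nonneg h3]
    have h5 : |t / entropy p q| * (Real.log y - Real.log x) ≤ |t / entropy p q| * ((y - x + 1) / x) := by
      gcongr
    calc _ ≤ C * (y - x + 1) / x + |t / entropy p q| * ((y - x + 1) / x) := by linarith
      _ = _ := by ring

theorem Aff.tendsto_slope (hp : 0 < p) (hq : 0 < q) (hpq : p + q = 1) (hf : Aff p q s t f) :
    Tendsto (slope p q f) atTop (𝓝 (t / entropy p q * (Real.log p - Real.log q))) := by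
  have h := (hf.slow hp hq hpq).tendsto_children hp hq hpq
  have h2 := h.add_const (t / entropy p q * (Real.log p - Real.log q))
  rw [zero_add] at h2
  refine h2.congr' ?_
  filter_upwards [eventually_gt_atTop 0] with x hx
  rw [Real.log_mul hp.ne' hx.ne', Real.log_mul hq.ne' hx.ne']
  simp only [slope, mul_comm x]
  ring

end Phase


structure CovFn (p q s t s' t' : ℝ) (f g V : ℕ → ℝ) : Prop where
  zero : V 0 = 0
  one : V 1 = 0
  recur : ∀ n, 2 ≤ n → V n = bE p q n (fun k => V k + V (n - k)) + tau p q s t s' t' f g n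

section CovFn

variable {p q s t s' t' : ℝ} {f g V : ℕ → ℝ}

lemma bE_log_succ_le (hp : 0 < p) (hq : 0 < q) (hpq : p + q = 1) (n : ℕ) :
    p * bE p q n (fun k => Real.log ((k : ℝ) + 1)) ≤
      p * Real.log ((n : ℝ) + 1) + p * Real.log p + q / ((n : ℝ) + 1) := by
  have hn : (0 : ℝ) < n + 1 := by positivity
  have h1 : bE p q n (fun k => Real.log ((k : ℝ) + 1)) ≤
      bE p q n (fun k => 1 / (((n : ℝ) + 1) * p) * (k : ℝ) +
        (Real.log (((n : ℝ) + 1) * p) + 1 / (((n : ℝ) + 1) * p) - 1)) := by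
    refine bE_mono hp hq fun k _ => ?_
    have hk : (0 : ℝ) < k + 1 := by positivity
    have := Real.log_le_sub_one_of_pos (x := ((k : ℝ) + 1) / (((n : ℝ) + 1) * p)) (by positivity)
    rw [Real.log_div hk.ne' (by positivity)] at this
    have e : ((k : ℝ) + 1) / (((n : ℝ) + 1) * p) =
      1 / (((n : ℝ) + 1) * p) * k + 1 / (((n : ℝ) + 1) * p) := by ring
    linarith
  rw [bE_add, bE_mul, bE_id hpq, bE_const hpq, Real.log_mul hn.ne' hp.ne'] at h1
  have h2 := mul_le_mul_of_nonneg_left h1 hp.le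
  refine h2.trans (le_of_eq ?_)
  have e3 : q = 1 - p := by linarith
  rw [e3]
  field_simp
  ring

lemma bE_log_split_le (hp : 0 < p) (hq : 0 < q) (hpq : p + q = 1) (n : ℕ) :
    bE p q n (fun k => p * Real.log ((k : ℝ) + 1) + q * Real.log (((n - k : ℕ) : ℝ) + 1)) ≤
      Real.log ((n : ℝ) + 1) - entropy p q + 1 / ((n : ℝ) + 1) := by
  rw [bE_add, bE_mul, bE_mul, bE_flip n (fun k => Real.log ((k : ℝ) + 1))]
  have h1 := bE_log_succ_le hp hq hpq n
  have h2 := bE_log_succ_le hq hp (by linarith) n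
  unfold entropy
  have e : q / ((n : ℝ) + 1) + p / ((n : ℝ) + 1) = 1 / ((n : ℝ) + 1) := by
    rw [← add_div, add_comm, hpq]
  have e2 : p * Real.log ((n : ℝ) + 1) + q * Real.log ((n : ℝ) + 1) = Real.log ((n : ℝ) + 1) := by
    rw [← add_mul, hpq, one_mul]
  linarith

theorem CovFn.step (hp : 0 < p) (hq : 0 < q) (hpq : p + q = 1) (hf : Aff p q s t f)
    (hg : Aff p q s' t' g) (hV : CovFn p q s t s' t' f g V) :
    ∃ A, 0 ≤ A ∧ ∀ n : ℕ, |V (n + 1) - V n| ≤ A * (Real.log ((n : ℝ) + 1) + 1) := by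
  obtain ⟨C, hC, hτ⟩ := tau_step hp hq hpq hf hg
  have hh := entropy_pos hp hq hpq
  obtain ⟨N, hN⟩ := exists_nat_ge (2 / p + 2 / q + 2 / entropy p q + 2)
  have hp2 : 0 < 2 / p := by positivity
  have hq2 : 0 < 2 / q := by positivity
  have hh2 : 0 < 2 / entropy p q := by positivity
  have hN2 : 2 ≤ N := by
    have : (2 : ℝ) ≤ N := by linarith
    exact_mod_cast this
  obtain ⟨B, hB, hB'⟩ := exists_bound_le (fun n => |V (n + 1) - V n|) N
  have hlog : ∀ n : ℕ, 0 ≤ Real.log ((n : ℝ) + 1) := fun n =>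
    Real.log_nonneg (by linarith [(Nat.cast_nonneg n : (0 : ℝ) ≤ n)])
  set A := 2 * C / entropy p q with hA
  have hA0 : 0 ≤ A := by positivity
  have key : ∀ n : ℕ, |V (n + 1) - V n| ≤ A * Real.log ((n : ℝ) + 1) + B := by
    intro n
    refine comparison hp hq hpq hp.le (by linarith) hq.le (by linarith) (N := N) (M := n)
      (by omega) (fun n => |V (n + 1) - V n|) (fun n => A * Real.log ((n : ℝ) + 1) + B)
      (fun _ => C) ?_ ?_ ?_ n le_rfl
    · intro n hn _
      have h1 : |V (n + 1) - V n| ≤ B := hB' n hn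
      have h2 := mul_nonneg hA0 (hlog n)
      linarith
    · intro n hn _
      have hnN : (N : ℝ) ≤ n := by exact_mod_cast hn.le
      have hnp : 2 ≤ (n : ℝ) * p := by
        rw [← div_le_iff₀ hp]; linarith
      have hnq : 2 ≤ (n : ℝ) * q := by
        rw [← div_le_iff₀ hq]; linarith
      have h1 := bE_diff (u := 1) (v := 1) n hpq V (tau p q s t s' t' f g)
        (by simpa using hV.recur n (by omega)) (by simpa using hV.recur (n + 1) (by omega))
      rw [h1]
      refine (abs_add_le _ _).trans (add_le_add ?_ (hτ n hnp hnq))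
      refine (bE_abs_le hp hq n _).trans (bE_mono hp hq fun k _ => ?_)
      refine (abs_add_le _ _).trans ?_
      rw [one_mul, one_mul, abs_mul, abs_mul, abs_of_pos hp, abs_of_pos hq]
    · intro n hn _
      have hnN : (N : ℝ) ≤ n := by exact_mod_cast hn.le
      have h1 := bE_log_split_le hp hq hpq n
      have e : bE p q n (fun k => p * (A * Real.log ((k : ℝ) + 1) + B) +
          q * (A * Real.log (((n - k : ℕ) : ℝ) + 1) + B)) =
          A * bE p q n (fun k => p * Real.log ((k : ℝ) + 1) + q * Real.log (((n - k : ℕ) : ℝ) + 1))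
          + B := by
        rw [← bE_mul, ← bE_const hpq n B, ← bE_add]
        refine bE_congr fun k _ => ?_
        rw [bE_const hpq]
        linear_combination B * hpq
      rw [e]
      have h2 : 1 / ((n : ℝ) + 1) ≤ entropy p q / 2 := by
        rw [div_le_div_iff₀ (by positivity) (by positivity)]
        have : 2 / entropy p q ≤ n := by linarith
        rw [div_le_iff₀ hh] at this
        linarith
      have h3 : A * (entropy p q / 2) = C := by rw [hA]; field_simp
      have h4 := mul_le_mul_of_nonneg_left h1 hA0
      have h5 := mul_le_mul_of_nonneg_left h2 hA0
      rw [h3] at h5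
      have h6 : A * entropy p q = 2 * C := by rw [hA]; field_simp
      rw [mul_add, mul_sub, h6] at h4
      linarith
  refine ⟨A + B, by positivity, fun n => (key n).trans ?_⟩
  have := mul_nonneg hB (hlog n)
  nlinarith

theorem lipschitz_of_step {A : ℝ} (hA : 0 ≤ A)
    (h : ∀ n : ℕ, |V (n + 1) - V n| ≤ A * (Real.log ((n : ℝ) + 1) + 1)) {a b n : ℕ}
    (ha : a ≤ n) (hb : b ≤ n) :
    |V a - V b| ≤ A * (Real.log ((n : ℝ) + 1) + 1) * |(a : ℝ) - b| := by
  have key : ∀ a b : ℕ, a ≤ b → b ≤ n →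
      |V b - V a| ≤ A * (Real.log ((n : ℝ) + 1) + 1) * ((b : ℝ) - a) := by
    intro a b hab
    induction b, hab using Nat.le_induction with
    | base => intro _; simp
    | succ b hab ih =>
      intro hbn
      have h1 := ih (by omega)
      have h2 := h b
      have h3 : Real.log ((b : ℝ) + 1) ≤ Real.log ((n : ℝ) + 1) := by
        have : (b : ℝ) + 1 ≤ n := by exact_mod_cast hbn
        exact Real.log_le_log (by positivity) (by linarith)
      have h4 : A * (Real.log ((b : ℝ) + 1) + 1) ≤ A * (Real.log ((n : ℝ) + 1) + 1) := by gcongr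
      have h5 := abs_sub_le (V (b + 1)) (V b) (V a)
      push_cast
      linarith
  rcases le_total a b with hab | hab
  · have := key a b hab hb
    rw [abs_sub_comm, abs_sub_comm (a : ℝ), abs_of_nonneg (a := (b : ℝ) - a)]
    · exact this
    · have : (a : ℝ) ≤ b := by exact_mod_cast hab
      linarith
  · have := key b a hab ha
    rw [abs_of_nonneg (a := (a : ℝ) - b)]
    · exact this
    · have : (b : ℝ) ≤ a := by exact_mod_cast hab
      linarith

end CovFn


section CovRatio

variable {p q s t s' t' : ℝ} {f g V : ℕ → ℝ}

lemma bE_dist_floor_le (hp : 0 < p) (hq : 0 < q) (hpq : p + q = 1) {L x : ℝ} (hL : 0 ≤ L)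
    (hx : 2 ≤ x) (h : ∀ a b : ℕ, a ≤ ⌊x⌋₊ → b ≤ ⌊x⌋₊ → |V a - V b| ≤ L * |(a : ℝ) - b|) :
    |bE p q ⌊x⌋₊ V - V ⌊p * x⌋₊| ≤ 3 * L * √x := by
  have hn := (floor_half hx).2
  have hx0 : 0 < x := by linarith
  have e : bE p q ⌊x⌋₊ V - V ⌊p * x⌋₊ = bE p q ⌊x⌋₊ (fun k => V k - V ⌊p * x⌋₊) := by
    rw [bE_sub, bE_const hpq]
  rw [e]
  have f1 := Nat.floor_le hx0.le
  have f2 := Nat.lt_floor_add_one x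
  have f3 := Nat.floor_le (a := p * x) (by positivity)
  have f4 := Nat.lt_floor_add_one (p * x)
  have h1 : bE p q ⌊x⌋₊ (fun k => |V k - V ⌊p * x⌋₊|) ≤
      bE p q ⌊x⌋₊ (fun k => L * |(k : ℝ) - ⌊x⌋₊ * p| + L * 2) := by
    refine bE_mono hp hq fun k hk => (h _ _ hk (Nat.floor_le_floor (by nlinarith))).trans ?_
    rw [← mul_add]
    refine mul_le_mul_of_nonneg_left ?_ hL
    have h2 : |(⌊x⌋₊ : ℝ) * p - ⌊p * x⌋₊| ≤ 2 := by
      rw [abs_le]; constructor <;> nlinarith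
    have := abs_sub_le (k : ℝ) (⌊x⌋₊ * p) ⌊p * x⌋₊
    linarith
  rw [bE_add, bE_mul, bE_const hpq] at h1
  have h3 := bE_abs_dev_le hp hq hpq hn
  have h4 : √(⌊x⌋₊ : ℝ) ≤ √x := Real.sqrt_le_sqrt f1
  have h5 : 1 ≤ √x := Real.one_le_sqrt.2 (by linarith)
  refine (bE_abs_le hp hq _ _).trans (h1.trans ?_)
  calc _ ≤ L * √x + L * (2 * √x) := by gcongr <;> linarith
    _ = _ := by ring

lemma slope_floor {C : ℝ} (hp : 0 < p) (hq : 0 < q) (hpq : p + q = 1) (hC : 0 ≤ C)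
    (h : ∀ n : ℕ, |df (df f) n| ≤ C / (n + 1)) {x : ℝ} (hx : 2 ≤ x) :
    |slope p q f x - slope p q f ⌊x⌋₊| * x ≤ 2 * C / p + 2 * C / q := by
  have h1 := df_floor_floor hp (by linarith) hC h hx
  have h2 := df_floor_floor hq (by linarith) hC h hx
  have hx0 : 0 < x := by linarith
  have e : slope p q f x - slope p q f ⌊x⌋₊ =
      (df f ⌊p * x⌋₊ - df f ⌊(⌊x⌋₊ : ℝ) * p⌋₊) - (df f ⌊q * x⌋₊ - df f ⌊(⌊x⌋₊ : ℝ) * q⌋₊) := by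
    simp only [slope, mul_comm x]; ring
  rw [← le_div_iff₀ hx0, e]
  refine (abs_sub _ _).trans ?_
  calc _ ≤ 2 * C / p * (1 / x) + 2 * C / q * (1 / x) := add_le_add h1 h2
    _ = _ := by ring

theorem CovFn.approx (hp : 0 < p) (hq : 0 < q) (hpq : p + q = 1) (hf : Aff p q s t f)
    (hg : Aff p q s' t' g) (hV : CovFn p q s t s' t' f g V) :
    ∃ C X, 0 ≤ C ∧ 2 ≤ X ∧ ∀ x : ℝ, X ≤ x →
      |V ⌊x⌋₊ / x - p * (V ⌊p * x⌋₊ / (p * x)) - q * (V ⌊q * x⌋₊ / (q * x))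
        - p * q * (slope p q f x * slope p q g x)| ≤ C * x ^ (-(1 / 4) : ℝ) := by
  obtain ⟨A, hA, hstep⟩ := hV.step hp hq hpq hf hg
  obtain ⟨C₁, hC₁, hτ⟩ := tau_approx hp hq hpq hf hg
  obtain ⟨Cf, hCf, hf'⟩ := hf.ddf_bound hp hq hpq
  obtain ⟨Cg, hCg, hg'⟩ := hg.ddf_bound hp hq hpq
  obtain ⟨Bf, hBf, hsf⟩ := slope_bound hp hq hpq hf
  obtain ⟨Bg, hBg, hsg⟩ := slope_bound hp hq hpq hg
  have hp4 : 0 < 4 / p := by positivity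
  have hq4 : 0 < 4 / q := by positivity
  set C₃ := Bf * Bg + (2 * Cf / p + 2 * Cf / q) * Bg + Bf * (2 * Cg / p + 2 * Cg / q) with hC₃
  have hC₃0 : 0 ≤ C₃ := by positivity
  refine ⟨54 * A + C₁ + C₃, 2 + 4 / p + 4 / q, by positivity, by linarith, fun x hx => ?_⟩
  have hx2 : 2 ≤ x := by linarith
  have hx0 : 0 < x := by linarith
  obtain ⟨hn, hn1⟩ := floor_half hx2
  have f1 := Nat.floor_le hx0.le
  have f2 := Nat.lt_floor_add_one x
  have hxp : 2 ≤ (⌊x⌋₊ : ℝ) * p := by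
    have : 4 / p ≤ x := by linarith
    rw [div_le_iff₀ hp] at this
    nlinarith
  have hxq : 2 ≤ (⌊x⌋₊ : ℝ) * q := by
    have : 4 / q ≤ x := by linarith
    rw [div_le_iff₀ hq] at this
    nlinarith
  have hn2 : 2 ≤ ⌊x⌋₊ := by
    have : (2 : ℝ) ≤ ⌊x⌋₊ := by nlinarith
    exact_mod_cast this
  set w := x ^ (1 / 4 : ℝ) with hw
  have hw0 : 0 < w := by positivity
  have hw1 : 1 ≤ w := Real.one_le_rpow (by linarith) (by norm_num)
  have hw4 : w ^ 4 = x := by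
    rw [hw, ← Real.rpow_natCast, ← Real.rpow_mul hx0.le]; norm_num
  have hwn : x ^ (-(1 / 4) : ℝ) = w⁻¹ := by rw [hw, ← Real.rpow_neg hx0.le]
  have hws : √x = w ^ 2 := by
    rw [← hw4, show w ^ 4 = (w ^ 2) ^ 2 by ring, Real.sqrt_sq (by positivity)]
  have hlog : Real.log ((⌊x⌋₊ : ℝ) + 1) ≤ 8 * w := by
    calc Real.log ((⌊x⌋₊ : ℝ) + 1) ≤ Real.log ((2 * w) ^ 4) := by
          apply Real.log_le_log (by positivity)
          rw [mul_pow, hw4]; linarith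
      _ = 4 * Real.log (2 * w) := by rw [Real.log_pow]; norm_num
      _ ≤ 4 * (2 * w) := by
          gcongr
          exact (Real.log_le_sub_one_of_pos (by positivity)).trans (by linarith)
      _ = _ := by ring
  have hL : A * (Real.log ((⌊x⌋₊ : ℝ) + 1) + 1) ≤ 9 * A * w := by
    calc _ ≤ A * (8 * w + w) := by gcongr
      _ = _ := by ring
  have hlip : ∀ a b : ℕ, a ≤ ⌊x⌋₊ → b ≤ ⌊x⌋₊ → |V a - V b| ≤ 9 * A * w * |(a : ℝ) - b| :=
    fun a b ha hb => (lipschitz_of_step hA hstep ha hb).trans (by gcongr)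
  have d1 := bE_dist_floor_le hp hq hpq (by positivity) hx2 hlip
  have d2 := bE_dist_floor_le hq hp (by linarith) (by positivity) hx2 hlip
  have hτ' := hτ _ hxp hxq
  have hsq : √(⌊x⌋₊ : ℝ) ≤ w ^ 2 := by rw [← hws]; exact Real.sqrt_le_sqrt f1
  have hrec := hV.recur _ hn2
  rw [bE_add, bE_flip ⌊x⌋₊ V] at hrec
  have s1 := slope_floor hp hq hpq hCf hf' hx2
  have s2 := slope_floor hp hq hpq hCg hg' hx2
  have b1 := hsf x hx0.le
  have b2 := hsg ⌊x⌋₊ (by positivity)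
  have b3 := hsf ⌊x⌋₊ (by positivity)
  have d3 : |slope p q f ⌊x⌋₊ * slope p q g ⌊x⌋₊ * (⌊x⌋₊ * p * q) -
      slope p q f x * slope p q g x * (x * p * q)| ≤ C₃ := by
    generalize slope p q f x = a at *
    generalize slope p q g x = b at *
    generalize slope p q f ⌊x⌋₊ = a' at *
    generalize slope p q g ⌊x⌋₊ = b' at *
    have e : a' * b' * (⌊x⌋₊ * p * q) - a * b * (x * p * q) =
        p * q * (-(a' * b' * (x - ⌊x⌋₊)) - (a - a') * x * b' - a * ((b - b') * x)) := by ring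
    have hpq1 : p * q ≤ 1 := by nlinarith
    rw [e, abs_mul, abs_of_pos (mul_pos hp hq)]
    have i1 : |a' * b' * (x - ⌊x⌋₊)| ≤ Bf * Bg * 1 := by
      rw [abs_mul, abs_mul, abs_of_nonneg (a := x - ⌊x⌋₊) (by linarith)]
      gcongr
      linarith
    have i2 : |(a - a') * x * b'| ≤ (2 * Cf / p + 2 * Cf / q) * Bg := by
      rw [abs_mul, abs_mul, abs_of_pos hx0]
      gcongr
    have i3 : |a * ((b - b') * x)| ≤ Bf * (2 * Cg / p + 2 * Cg / q) := by
      rw [abs_mul, abs_mul, abs_of_pos hx0]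
      gcongr
    have i4 : |-(a' * b' * (x - ⌊x⌋₊)) - (a - a') * x * b' - a * ((b - b') * x)| ≤ C₃ := by
      refine (abs_sub _ _).trans ?_
      have := abs_sub (-(a' * b' * (x - ⌊x⌋₊))) ((a - a') * x * b')
      rw [abs_neg] at this
      linarith
    calc _ ≤ 1 * C₃ := by gcongr
      _ = C₃ := one_mul _
  have total : |V ⌊x⌋₊ - V ⌊p * x⌋₊ - V ⌊q * x⌋₊ - slope p q f x * slope p q g x * (x * p * q)|
      ≤ (54 * A + C₁ + C₃) * w ^ 3 := by
    have e : V ⌊x⌋₊ - V ⌊p * x⌋₊ - V ⌊q * x⌋₊ - slope p q f x * slope p q g x * (x * p * q) =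
        (bE p q ⌊x⌋₊ V - V ⌊p * x⌋₊) + (bE q p ⌊x⌋₊ V - V ⌊q * x⌋₊) +
        (tau p q s t s' t' f g ⌊x⌋₊ -
          slope p q f ⌊x⌋₊ * slope p q g ⌊x⌋₊ * (⌊x⌋₊ * p * q)) +
        (slope p q f ⌊x⌋₊ * slope p q g ⌊x⌋₊ * (⌊x⌋₊ * p * q) -
      slope p q f x * slope p q g x * (x * p * q)) := by
      linear_combination hrec
    rw [e]
    refine (abs_add_le _ _).trans ?_
    refine (add_le_add_left ((abs_add_le _ _).trans (add_le_add_left (abs_add_le _ _) _)) _).trans ?_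
    have k1 : C₁ * √(⌊x⌋₊ : ℝ) ≤ C₁ * w ^ 3 := by
      have : w ^ 2 ≤ w ^ 3 := pow_le_pow_right₀ hw1 (by norm_num)
      gcongr
      linarith
    have k2 : C₃ ≤ C₃ * w ^ 3 := le_mul_of_one_le_right hC₃0 (one_le_pow₀ hw1)
    rw [hws] at d1 d2
    have k3 : 3 * (9 * A * w) * w ^ 2 = 27 * A * w ^ 3 := by ring
    rw [k3] at d1 d2
    linarith
  have e : V ⌊x⌋₊ / x - p * (V ⌊p * x⌋₊ / (p * x)) - q * (V ⌊q * x⌋₊ / (q * x))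
        - p * q * (slope p q f x * slope p q g x) =
      (V ⌊x⌋₊ - V ⌊p * x⌋₊ - V ⌊q * x⌋₊ - slope p q f x * slope p q g x * (x * p * q)) / x := by
    field_simp
  rw [e, abs_div, abs_of_pos hx0, div_le_iff₀ hx0, hwn]
  refine total.trans (le_of_eq ?_)
  rw [← hw4]
  field_simp

end CovRatio


section Variance

variable {p q s t s' t' : ℝ} {f g V : ℕ → ℝ}

lemma tau_self_nonneg (hp : 0 < p) (hq : 0 < q) (s t : ℝ) (f : ℕ → ℝ) (n : ℕ) :
    0 ≤ tau p q s t s t f f n :=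
  bE_nonneg hp hq fun _ _ => mul_self_nonneg _

theorem CovFn.nonneg (hp : 0 < p) (hq : 0 < q) (hpq : p + q = 1)
    (hV : CovFn p q s t s t f f V) (n : ℕ) : 0 ≤ V n := by
  have := comparison_zero hp hq hpq zero_le_one le_rfl zero_le_one le_rfl (N := 1) (M := n) le_rfl
    (fun n => -V n) (fun k hk _ => ?_) (fun k hk _ => ?_) n le_rfl
  · linarith
  · interval_cases k
    · simp [hV.zero]
    · simp [hV.one]
  · rw [hV.recur k hk]
    have e : bE p q k (fun j => 1 * -V j + 1 * -V (k - j)) =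
        -bE p q k (fun j => V j + V (k - j)) := by
      rw [← bE_neg]; exact bE_congr fun j _ => by ring
    rw [e]
    linarith [tau_self_nonneg hp hq s t f k]

lemma bE_ge_single (hp : 0 < p) (hq : 0 < q) {n j : ℕ} (hj : j ≤ n) {F : ℕ → ℝ}
    (hF : ∀ k ≤ n, 0 ≤ F k) : bw p q n j * F j ≤ bE p q n F := by
  unfold bE
  exact Finset.single_le_sum (f := fun k => bw p q n k * F k)
    (fun k hk => mul_nonneg (bw_nonneg hp hq n k) (hF k (by simpa [Nat.lt_succ_iff] using hk)))
    (by simpa [Nat.lt_succ_iff] using hj)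

theorem CovFn.pos (hp : 0 < p) (hq : 0 < q) (hpq : p + q = 1) (hf : Aff p q s t f)
    (hst : s + t * 2 ≠ 0) (hV : CovFn p q s t s t f f V) {n : ℕ} (hn : 2 ≤ n) : 0 < V n := by
  have h0 := hV.nonneg hp hq hpq
  have h2 : 0 < V 2 := by
    refine lt_of_le_of_ne (h0 2) fun h => ?_
    have h1 := hV.recur 2 le_rfl
    have h3 : 0 ≤ bE p q 2 (fun k => V k + V (2 - k)) :=
      bE_nonneg hp hq fun k _ => add_nonneg (h0 _) (h0 _)
    have h4 := bE_ge_single hp hq (Nat.zero_le 2)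
      (F := fun k => splitDev s t f 2 k * splitDev s t f 2 k) fun k _ => mul_self_nonneg _
    have h5 : splitDev s t f 2 0 = s + t * 2 := by
      simp [splitDev, hf.zero]
    rw [h5] at h4
    have h6 : 0 < bw p q 2 0 * ((s + t * 2) * (s + t * 2)) :=
      mul_pos (bw_pos hp hq (by norm_num)) (mul_self_pos.2 hst)
    unfold tau at h1
    linarith
  rw [hV.recur n hn]
  have h7 := bE_ge_single hp hq hn (F := fun k => V k + V (n - k)) fun k _ => add_nonneg (h0 _) (h0 _)
  have h8 : 0 < bw p q n 2 * (V 2 + V (n - 2)) :=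
    mul_pos (bw_pos hp hq hn) (by linarith [h0 (n - 2)])
  linarith [tau_self_nonneg hp hq s t f n]

theorem CovFn.linear_lower (hp : 0 < p) (hq : 0 < q) (hpq : p + q = 1) (hf : Aff p q s t f)
    (hst : s + t * 2 ≠ 0) (hV : CovFn p q s t s t f f V) :
    ∃ c, 0 < c ∧ ∀ n : ℕ, 2 ≤ n → c * n ≤ V n := by
  have hpq0 : 0 < p * q := mul_pos hp hq
  obtain ⟨N, hN⟩ := exists_nat_ge (4 / (p * q) + 2)
  have hN2 : 2 ≤ N := by
    have : 0 < 4 / (p * q) := by positivity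
    have : (2 : ℝ) ≤ N := by linarith
    exact_mod_cast this
  set L : ℕ → ℝ := fun n => (n : ℝ) + 1 - 4 * (1 / ((n : ℝ) + 1)) with hL
  obtain ⟨B, hB, hB'⟩ := exists_bound_le (fun n => if 2 ≤ n then L n / V n else 0) N
  have hc : 0 < 1 / (B + 1) := by positivity
  have key : ∀ n, 1 / (B + 1) * L n ≤ V n := by
    intro n
    refine comparison hp hq hpq zero_le_one le_rfl zero_le_one le_rfl (N := N) (M := n)
      (by omega) (fun n => 1 / (B + 1) * L n) V (fun _ => 0) ?_ ?_ ?_ n le_rfl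
    · intro k hk _
      by_cases h2 : 2 ≤ k
      · have h3 := hB' k hk
        simp only [h2, if_true] at h3
        rw [div_le_iff₀ (hV.pos hp hq hpq hf hst h2)] at h3
        rw [one_div_mul_eq_div, div_le_iff₀ (by positivity)]
        nlinarith [hV.pos hp hq hpq hf hst h2]
      · have h3 : L k ≤ 0 := by
          have : k = 0 ∨ k = 1 := by omega
          rcases this with rfl | rfl <;> norm_num [hL]
        exact (mul_nonpos_of_nonneg_of_nonpos hc.le h3).trans (hV.nonneg hp hq hpq k)
    · intro k hk _
      rw [add_zero]
      have e : bE p q k (fun j => 1 * (1 / (B + 1) * L j) + 1 * (1 / (B + 1) * L (k - j))) =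
          1 / (B + 1) * (((k : ℝ) + 2) - 4 * (bE p q k (fun j => 1 / ((j : ℝ) + 1)) +
            bE q p k (fun j => 1 / ((j : ℝ) + 1)))) := by
        rw [← bE_flip (p := p) (q := q) k (fun j => 1 / ((j : ℝ) + 1)), ← bE_add, ← bE_mul,
          ← bE_const hpq k ((k : ℝ) + 2), ← bE_sub, ← bE_mul]
        refine bE_congr fun j hj => ?_
        simp only [hL]
        rw [Nat.cast_sub hj]
        ring
      rw [e]
      refine mul_le_mul_of_nonneg_left ?_ hc.le
      have h1 := bE_inv_succ_le hp hq hpq k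
      have h2 := bE_inv_succ_le hq hp (by linarith) k
      have hk' : 4 / (p * q) ≤ (k : ℝ) + 1 := by
        have : (N : ℝ) ≤ k := by exact_mod_cast hk.le
        linarith
      have hk0 : (0 : ℝ) < (k : ℝ) + 1 := by positivity
      have h3 : 4 * (1 / (((k : ℝ) + 1) * p) + 1 / (((k : ℝ) + 1) * q)) ≤ 1 := by
        have e2 : 4 * (1 / (((k : ℝ) + 1) * p) + 1 / (((k : ℝ) + 1) * q)) =
            4 / (p * q) / ((k : ℝ) + 1) := by
          have : q = 1 - p := by linarith
          field_simp
          linarith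
        rw [e2, div_le_one hk0]
        exact hk'
      have h4 : 0 < 4 * (1 / ((k : ℝ) + 1)) := by positivity
      simp only [hL]
      linarith
    · intro k hk _
      rw [hV.recur k (by omega), add_zero]
      simp only [one_mul]
      linarith [tau_self_nonneg hp hq s t f k]
  refine ⟨1 / (B + 1) / 2, by positivity, fun n hn => le_trans ?_ (key n)⟩
  have hn' : (2 : ℝ) ≤ n := by exact_mod_cast hn
  have : (n : ℝ) / 2 ≤ L n := by
    have : 1 / ((n : ℝ) + 1) ≤ 1 / 3 := by gcongr; linarith
    simp only [hL]
    linarith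
  calc _ = 1 / (B + 1) * ((n : ℝ) / 2) := by ring
    _ ≤ _ := by gcongr

lemma lt_div_of_child_lt (hp : 0 < p) (hq : 0 < q) (hpq : p + q = 1) {m x : ℝ} (hm : 0 < m)
    (hx : m ≤ x) (h : p * x < m ∨ q * x < m) : x ≤ m / (p * q) := by
  rw [le_div_iff₀ (mul_pos hp hq)]
  have hx0 : 0 < x := by linarith
  rcases h with h | h <;> nlinarith [mul_pos hp hq, mul_pos hp hx0, mul_pos hq hx0]

theorem CovFn.superlinear (hp : 0 < p) (hq : 0 < q) (hpq : p + q = 1) (hne : p ≠ q)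
    (hf : Aff p q s t f) (ht : t ≠ 0) (hV : CovFn p q s t s t f f V) :
    Tendsto (fun n : ℕ => V n / n) atTop atTop := by
  have hh := entropy_pos hp hq hpq
  obtain ⟨K, hK, hmax⟩ := real_max_principle hp hq hpq
  obtain ⟨C, X, hC, hX, happ⟩ := hV.approx hp hq hpq hf hf
  have hlim := hf.tendsto_slope hp hq hpq
  set l := t / entropy p q * (Real.log p - Real.log q) with hl
  have hl0 : l ≠ 0 := by
    refine mul_ne_zero (div_ne_zero ht hh.ne') (sub_ne_zero.2 fun h => hne ?_)
    exact Real.log_injOn_pos (Set.mem_Ioi.2 hp) (Set.mem_Ioi.2 hq) h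
  have hl2 : 0 < l * l := mul_self_pos.2 hl0
  have hev := (hlim.mul hlim).eventually (lt_mem_nhds (half_lt_self hl2))
  obtain ⟨Y, hY⟩ := hev.exists_forall_of_atTop
  set κ := p * q * (l * l / 2) / entropy p q with hκ
  have hpq0 : 0 < p * q := mul_pos hp hq
  have hκ0 : 0 < κ := by positivity
  set m := max X Y with hm
  have hmX : X ≤ m := le_max_left _ _
  have hmY : Y ≤ m := le_max_right _ _
  have hm0 : 0 < m := by linarith
  have hp1 : p ≤ 1 := by linarith
  have key := hmax Set.univ (fun _ _ => ⟨trivial, trivial⟩)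
    (fun x => κ * Real.log x - V ⌊x⌋₊ / x) m C (κ * Real.log (m / (p * q))) hm0 hC
    (fun x _ h1 h2 => ?_) (fun x _ h1 h2 => ?_)
  · have hlog : Tendsto (fun n : ℕ => κ * Real.log n -
        (κ * Real.log (m / (p * q)) + K * C * m ^ (-(1 / 4) : ℝ))) atTop atTop :=
      tendsto_atTop_add_const_right _ _
        ((Real.tendsto_log_atTop.comp tendsto_natCast_atTop_atTop).const_mul_atTop hκ0)
    refine tendsto_atTop_mono' _ ?_ hlog
    filter_upwards [eventually_ge_atTop ⌈m⌉₊] with n hn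
    have := key n trivial (Nat.ceil_le.1 hn)
    simp only [Nat.floor_natCast] at this
    linarith
  · have hx0 : 0 < x := by
      by_contra hcon
      have : p * x ≤ 0 := mul_nonpos_of_nonneg_of_nonpos hp.le (not_lt.1 hcon)
      linarith
    have hxm : m ≤ x := by nlinarith
    have a1 := (abs_le.1 (happ x (hmX.trans hxm))).1
    have a2 := hY x (hmY.trans hxm)
    have e : κ * entropy p q = p * q * (l * l / 2) := by rw [hκ]; field_simp
    have a3 : κ * entropy p q ≤ p * q * (slope p q f x * slope p q f x) := by
      rw [e]; gcongr
    unfold entropy at a3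
    rw [Real.log_mul hp.ne' hx0.ne', Real.log_mul hq.ne' hx0.ne']
    have e2 : κ * Real.log x = p * (κ * Real.log x) + q * (κ * Real.log x) := by
      rw [← add_mul, hpq, one_mul]
    rw [e2]
    linarith
  · have hx0 : 0 < x := by linarith
    have a1 := lt_div_of_child_lt hp hq hpq hm0 h1 h2
    have a2 : 0 ≤ V ⌊x⌋₊ / x := div_nonneg (hV.nonneg hp hq hpq _) hx0.le
    have a3 : κ * Real.log x ≤ κ * Real.log (m / (p * q)) := by gcongr
    linarith

end Variance


section Covariance

variable {p q s s' t' : ℝ} {f g V W Z : ℕ → ℝ}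

lemma mean_square_split (hpq : p + q = 1) (a b z e ε B : ℝ) (hz : z - p * a - q * b = e)
    (c : ℝ) (hp : 0 ≤ p) (hq : 0 ≤ q) (ha : |a - c| ≤ ε) (hb : |b - c| ≤ ε) (hε : ε ≤ 1)
    (he : |e| ≤ B) (hB : B ≤ 1) :
    p * (ε ^ 2 - (a - c) ^ 2) + q * (ε ^ 2 - (b - c) ^ 2) + p * q * (a - b) ^ 2
      ≤ (ε ^ 2 - (z - c) ^ 2) + 3 * B := by
  have hz' : z = p * a + q * b + e := by linarith
  have hq' : q = 1 - p := by linarith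
  have hd : |p * (a - c) + q * (b - c)| ≤ 1 := by
    refine (abs_add_le _ _).trans ?_
    rw [abs_mul, abs_mul, abs_of_nonneg hp, abs_of_nonneg hq]
    nlinarith
  have e1 : (ε ^ 2 - (z - c) ^ 2) = p * (ε ^ 2 - (a - c) ^ 2) + q * (ε ^ 2 - (b - c) ^ 2)
      + p * q * (a - b) ^ 2 - 2 * (p * (a - c) + q * (b - c)) * e - e ^ 2 := by
    rw [hz', hq']; ring
  have e2 : (p * (a - c) + q * (b - c)) * e ≤ 1 * B := by
    refine (le_abs_self _).trans ?_
    rw [abs_mul]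
    gcongr
  have e3 : e ^ 2 ≤ B := by
    rw [← sq_abs]
    nlinarith [abs_nonneg e]
  rw [e1]
  linarith

/-- Quantitative bound on the covariance in terms of one variance. -/
theorem CovFn.cov_bound (hp : 0 < p) (hq : 0 < q) (hpq : p + q = 1) (hf : Aff p q s 0 f)
    (hg : Aff p q s' t' g) (hW : CovFn p q s 0 s' t' f g W) (hZ : CovFn p q s' t' s' t' g g Z) :
    ∃ K, 0 ≤ K ∧ ∀ ε, 0 < ε → ε ≤ 1 → ∃ m₀ : ℝ, 1 ≤ m₀ ∧ ∀ m, m₀ ≤ m → ∃ C, ∀ θ, 0 < θ →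
      ∀ n : ℕ, m ≤ n → |W n| ≤ θ / 2 * Z n +
        (ε ^ 2 / (2 * θ) + C + K * (1 + θ + 1 / θ) * m ^ (-(1 / 4) : ℝ)) * n := by
  obtain ⟨K, hK, hmax⟩ := real_max_principle hp hq hpq
  obtain ⟨C₁, X₁, hC₁, hX₁, happ₁⟩ := hW.approx hp hq hpq hf hg
  obtain ⟨C₂, X₂, hC₂, hX₂, happ₂⟩ := hZ.approx hp hq hpq hg hg
  have hslow : Slow p q (fun x => df f ⌊x⌋₊) := by simpa using hf.slow hp hq hpq
  obtain ⟨B, X₃, hB, hX₃, happ₃⟩ := hslow.approx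
  have hlim : Tendsto (fun x : ℝ => B * x ^ (-(1 / 4) : ℝ)) atTop (𝓝 (B * 0)) :=
    (tendsto_rpow_neg_atTop (by norm_num)).const_mul _
  rw [mul_zero] at hlim
  obtain ⟨X₄, hX₄⟩ := (hlim.eventually (ge_mem_nhds zero_lt_one)).exists_forall_of_atTop
  refine ⟨K * (C₁ + C₂ + 3 * B), by positivity, fun ε hε hε1 => ?_⟩
  obtain ⟨m₁, hm₁, hosc⟩ := hslow.orbit_osc hp hq hpq hε
  refine ⟨max m₁ (max (max X₁ X₂) (max X₃ X₄)), le_max_of_le_left hm₁, fun m hm => ?_⟩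
  simp only [max_le_iff] at hm
  obtain ⟨hmm₁, ⟨hmX₁, hmX₂⟩, hmX₃, hmX₄⟩ := hm
  have hm1 : 1 ≤ m := by linarith
  have hm0 : 0 < m := by linarith
  obtain ⟨M, hM, hWM⟩ := exists_bound_le (fun n => |W n|) ⌊m / (p * q)⌋₊
  refine ⟨M, fun θ hθ n hn => ?_⟩
  obtain ⟨c, hc⟩ := hosc m hmm₁ n
  have signed : ∀ σ : ℝ, |σ| = 1 → σ * W n ≤ θ / 2 * Z n +
        (ε ^ 2 / (2 * θ) + M + K * (C₁ + C₂ + 3 * B) * (1 + θ + 1 / θ) * m ^ (-(1 / 4) : ℝ)) * n := by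
    intro σ hσ
    set y : ℝ → ℝ := fun x => ε ^ 2 - (df f ⌊x⌋₊ - c) ^ 2 with hy
    have hy0 : ∀ x ∈ scaleOrbit p q n, m ≤ x → 0 ≤ y x := fun x hx hmx => by
      have := hc x hx hmx
      rw [hy]
      have := sq_le_sq' (abs_le.1 this).1 (abs_le.1 this).2
      linarith
    have key := hmax (scaleOrbit p q n) (fun _ h => scaleOrbit_closed h)
      (fun x => σ * (W ⌊x⌋₊ / x) - θ / 2 * (Z ⌊x⌋₊ / x) - 1 / (2 * θ) * y x) m
      (C₁ + θ / 2 * C₂ + 1 / (2 * θ) * (3 * B)) M hm0 (by positivity)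
      (fun x hx h1 h2 => ?_) (fun x hx h1 h2 => ?_) n (self_mem_scaleOrbit _) hn
    · have hn0 : (0 : ℝ) < n := by linarith
      simp only [Nat.floor_natCast] at key
      have hyn : 1 / (2 * θ) * y n ≤ ε ^ 2 / (2 * θ) := by
        rw [one_div_mul_eq_div]
        gcongr
        simp only [hy]
        linarith [sq_nonneg (df f ⌊(n : ℝ)⌋₊ - c)]
      have hr : 0 ≤ m ^ (-(1 / 4) : ℝ) := by positivity
      have hcoef : C₁ + θ / 2 * C₂ + 1 / (2 * θ) * (3 * B) ≤
          (C₁ + C₂ + 3 * B) * (1 + θ + 1 / θ) := by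
        have a1 : 1 / (2 * θ) = 1 / θ / 2 := by field_simp
        have a2 : 0 < 1 / θ := by positivity
        rw [a1]
        generalize 1 / θ = ω at *
        nlinarith [mul_nonneg hC₁ hθ.le, mul_nonneg hC₁ a2.le, mul_nonneg hC₂ hθ.le,
          mul_nonneg hC₂ a2.le, mul_nonneg hB hθ.le, mul_nonneg hB a2.le]
      have h3 : K * (C₁ + θ / 2 * C₂ + 1 / (2 * θ) * (3 * B)) * m ^ (-(1 / 4) : ℝ) ≤
          K * (C₁ + C₂ + 3 * B) * (1 + θ + 1 / θ) * m ^ (-(1 / 4) : ℝ) := by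
        rw [mul_assoc K (C₁ + C₂ + 3 * B)]
        gcongr
      have h4 : σ * (W n / n) - θ / 2 * (Z n / n) ≤ ε ^ 2 / (2 * θ) + M +
          K * (C₁ + C₂ + 3 * B) * (1 + θ + 1 / θ) * m ^ (-(1 / 4) : ℝ) := by linarith
      have h5 := mul_le_mul_of_nonneg_right h4 hn0.le
      have h6 : (σ * (W n / n) - θ / 2 * (Z n / n)) * n = σ * W n - θ / 2 * Z n := by field_simp
      rw [h6] at h5
      linarith
    · have hx0 : 0 < x := by
        by_contra hcon
        have : p * x ≤ 0 := mul_nonpos_of_nonneg_of_nonpos hp.le (not_lt.1 hcon)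
        linarith
      have hxm : m ≤ x := by nlinarith
      obtain ⟨hpx, hqx⟩ := scaleOrbit_closed hx
      have a1 := happ₁ x (hmX₁.trans hxm)
      have a2 := (abs_le.1 (happ₂ x (hmX₂.trans hxm))).1
      have a3 := happ₃ x (hmX₃.trans hxm)
      have a4 := hX₄ x (hmX₄.trans hxm)
      have a5 := mean_square_split hpq (df f ⌊p * x⌋₊) (df f ⌊q * x⌋₊) (df f ⌊x⌋₊) _ ε _ rfl c
        hp.le hq.le (hc _ hpx h1) (hc _ hqx h2) hε1 a3 a4
      have a1' : σ * (W ⌊x⌋₊ / x - p * (W ⌊p * x⌋₊ / (p * x)) - q * (W ⌊q * x⌋₊ / (q * x))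
        - p * q * (slope p q f x * slope p q g x)) ≤ C₁ * x ^ (-(1 / 4) : ℝ) := by
        refine (le_abs_self _).trans ?_
        rw [abs_mul, hσ, one_mul]
        exact a1
      have es : slope p q f x = df f ⌊p * x⌋₊ - df f ⌊q * x⌋₊ := by
        simp only [slope, mul_comm x]
      rw [← es] at a5
      have amgm : σ * (slope p q f x * slope p q g x) ≤
          θ / 2 * (slope p q g x * slope p q g x) + 1 / (2 * θ) * slope p q f x ^ 2 := by
        generalize slope p q f x = a
        generalize slope p q g x = b
        have hσ2 : σ ^ 2 = 1 := by rw [← sq_abs, hσ, one_pow]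
        have : θ / 2 * (b * b) + 1 / (2 * θ) * a ^ 2 - σ * (a * b) =
            (θ * b - σ * a) ^ 2 / (2 * θ) := by
          field_simp
          linear_combination (-a ^ 2) * hσ2
        have : 0 ≤ (θ * b - σ * a) ^ 2 / (2 * θ) := by positivity
        linarith
      have amgm' := mul_le_mul_of_nonneg_left amgm (mul_pos hp hq).le
      have a2' := mul_le_mul_of_nonneg_left a2 (by positivity : 0 ≤ θ / 2)
      have a5' := mul_le_mul_of_nonneg_left a5 (by positivity : 0 ≤ 1 / (2 * θ))
      simp only [hy]
      linarith
    · have hx1 : 1 ≤ x := by linarith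
      have b1 := lt_div_of_child_lt hp hq hpq hm0 h1 h2
      have b2 : |W ⌊x⌋₊| ≤ M := hWM _ (Nat.floor_le_floor b1)
      have b3 : 0 ≤ θ / 2 * (Z ⌊x⌋₊ / x) :=
        mul_nonneg (by positivity) (div_nonneg (hZ.nonneg hp hq hpq _) (by linarith))
      have b4 : 0 ≤ 1 / (2 * θ) * y x := mul_nonneg (by positivity) (hy0 x hx h1)
      have b5 : σ * (W ⌊x⌋₊ / x) ≤ M := by
        refine (le_abs_self _).trans ?_
        rw [abs_mul, hσ, one_mul, abs_div, abs_of_pos (by linarith : 0 < x),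
          div_le_iff₀ (by linarith)]
        nlinarith
      linarith
  rw [abs_le']
  have u1 := signed 1 (by simp)
  have u2 := signed (-1) (by simp)
  constructor <;> linarith

end Covariance


section Correlation

variable {p q s t' s' : ℝ} {f g V W Z : ℕ → ℝ}

theorem CovFn.corr_tendsto (hp : 0 < p) (hq : 0 < q) (hpq : p + q = 1) (hf : Aff p q s 0 f)
    (hg : Aff p q s' t' g) (hW : CovFn p q s 0 s' t' f g W) (hZ : CovFn p q s' t' s' t' g g Z)
    {c : ℝ} (hc : 0 < c) (hV : ∀ n : ℕ, 2 ≤ n → c * n ≤ V n)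
    (hZn : Tendsto (fun n : ℕ => Z n / n) atTop atTop) :
    Tendsto (fun n : ℕ => W n / (√(V n) * √(Z n))) atTop (𝓝 0) := by
  obtain ⟨K, hK, hb⟩ := hW.cov_bound hp hq hpq hf hg hZ
  rw [Metric.tendsto_atTop']
  intro δ hδ
  obtain ⟨ε, hε, hε1, hε2⟩ : ∃ ε : ℝ, 0 < ε ∧ ε ≤ 1 ∧ ε ^ 2 / (2 * δ * c) ≤ δ / 8 := by
    refine ⟨min 1 (δ ^ 2 * c / 4), by positivity, min_le_left _ _, ?_⟩
    rw [div_le_iff₀ (by positivity)]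
    have h1 : min 1 (δ ^ 2 * c / 4) ≤ 1 := min_le_left _ _
    have h2 : min 1 (δ ^ 2 * c / 4) ≤ δ ^ 2 * c / 4 := min_le_right _ _
    have h3 : 0 < min 1 (δ ^ 2 * c / 4) := by positivity
    nlinarith
  obtain ⟨m₀, hm₀, hm⟩ := hb ε hε hε1
  have hlim : Tendsto (fun x : ℝ => K / (δ * c) * x ^ (-(1 / 4) : ℝ)) atTop (𝓝 (K / (δ * c) * 0)) :=
    (tendsto_rpow_neg_atTop (by norm_num)).const_mul _
  rw [mul_zero] at hlim
  obtain ⟨m, hmm, hmδ⟩ := ((eventually_ge_atTop m₀).and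
    (hlim.eventually (ge_mem_nhds (by positivity : (0 : ℝ) < δ / 8)))).exists
  obtain ⟨C, hC⟩ := hm m hmm
  set k := K * m ^ (-(1 / 4) : ℝ) with hk
  have hk0 : 0 ≤ k := mul_nonneg hK (Real.rpow_nonneg (by linarith) _)
  set r : ℕ → ℝ := fun n => √((n : ℝ) / Z n) with hr
  have hr0 : Tendsto r atTop (𝓝 0) := by
    have h1 : Tendsto (fun n : ℕ => √((Z n / n)⁻¹)) atTop (𝓝 √0) :=
      (Real.continuous_sqrt.tendsto 0).comp (tendsto_inv_atTop_zero.comp hZn)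
    rw [Real.sqrt_zero] at h1
    simpa only [hr, inv_div] using h1
  have hfin : Tendsto (fun n => δ / 2 + δ / 8 + δ / 8 + (|C| + k) * (√(1 / c) * r n) +
      k * δ * r n ^ 2) atTop
      (𝓝 (δ / 2 + δ / 8 + δ / 8 + (|C| + k) * (√(1 / c) * 0) + k * δ * 0 ^ 2)) :=
    ((hr0.const_mul _).const_mul _ |>.const_add _).add ((hr0.pow 2).const_mul _)
  rw [show δ / 2 + δ / 8 + δ / 8 + (|C| + k) * (√(1 / c) * 0) + k * δ * 0 ^ 2 = 3 / 4 * δ by ring]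
    at hfin
  have hev := hfin.eventually_lt_const (by linarith : 3 / 4 * δ < δ)
  obtain ⟨N, hN⟩ := (hev.and ((hZn.eventually_gt_atTop 0).and ((eventually_ge_atTop 2).and
    (eventually_ge_atTop ⌈m⌉₊)))).exists_forall_of_atTop
  refine ⟨N, fun n hn => ?_⟩
  obtain ⟨h1, h2, h3, h4⟩ := hN n hn.le
  rw [dist_zero_right, Real.norm_eq_abs]
  refine lt_of_le_of_lt ?_ h1
  have hn0 : (0 : ℝ) < n := by exact_mod_cast (by omega : 0 < n)
  have hZ0 : 0 < Z n := by
    by_contra hcon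
    exact absurd h2 (not_lt.2 (div_nonpos_of_nonpos_of_nonneg (not_lt.1 hcon) hn0.le))
  have hVn := hV n h3
  have hV0 : 0 < V n := lt_of_lt_of_le (by positivity) hVn
  set a := √(V n) with ha
  set b := √(Z n) with hb
  set u := √(n : ℝ) with hu
  have ha0 : 0 < a := Real.sqrt_pos.2 hV0
  have hb0 : 0 < b := Real.sqrt_pos.2 hZ0
  have hu0 : 0 < u := Real.sqrt_pos.2 hn0
  have hb2 : Z n = b ^ 2 := (Real.sq_sqrt hZ0.le).symm
  have hu2 : (n : ℝ) = u ^ 2 := (Real.sq_sqrt hn0.le).symm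
  have hrn : r n = u / b := Real.sqrt_div hn0.le _
  have hρ : u / a ≤ √(1 / c) := by
    rw [hu, ha, ← Real.sqrt_div hn0.le]
    apply Real.sqrt_le_sqrt
    rw [div_le_div_iff₀ hV0 hc]
    linarith
  have hρ2 : (u / a) ^ 2 ≤ 1 / c := by
    rw [← Real.sq_sqrt (by positivity : 0 ≤ 1 / c)]
    gcongr
  have main := hC (δ * a / b) (by positivity) n (Nat.ceil_le.1 h4)
  rw [abs_div, abs_of_pos (mul_pos ha0 hb0), div_le_iff₀ (mul_pos ha0 hb0)]
  refine main.trans ?_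
  rw [mul_right_comm K, ← hk, hb2, hu2, hrn]
  have e : δ * a / b / 2 * b ^ 2 + (ε ^ 2 / (2 * (δ * a / b)) + C +
      k * (1 + δ * a / b + 1 / (δ * a / b))) * u ^ 2 =
      (δ / 2 + ε ^ 2 / (2 * δ) * (u / a) ^ 2 + k / δ * (u / a) ^ 2 +
        (C + k) * ((u / a) * (u / b)) + k * δ * (u / b) ^ 2) * (a * b) := by
    field_simp
    ring
  rw [e]
  refine mul_le_mul_of_nonneg_right ?_ (mul_pos ha0 hb0).le
  have i1 : ε ^ 2 / (2 * δ) * (u / a) ^ 2 ≤ δ / 8 := by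
    refine le_trans ?_ hε2
    calc _ ≤ ε ^ 2 / (2 * δ) * (1 / c) := by gcongr
      _ = _ := by field_simp
  have i2 : k / δ * (u / a) ^ 2 ≤ δ / 8 := by
    refine le_trans ?_ hmδ
    calc _ ≤ k / δ * (1 / c) := by gcongr
      _ = _ := by rw [hk]; field_simp
  have i3 : (C + k) * ((u / a) * (u / b)) ≤ (|C| + k) * (√(1 / c) * (u / b)) := by
    gcongr
    exact le_abs_self C
  linarith

end Correlation


section CharFun

lemma norm_exp_I_sub_one_le (x : ℝ) : ‖Complex.exp (Complex.I * x) - 1‖ ≤ |x| := by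
  simpa using Real.norm_exp_I_mul_ofReal_sub_one_le (x := x)

lemma norm_exp_I_taylor_le (x : ℝ) :
    ‖Complex.exp (Complex.I * x) - 1 - Complex.I * x + x ^ 2 / 2‖ ≤ 4 * |x| ^ 3 := by
  have hn : ‖Complex.I * (x : ℂ)‖ = |x| := by simp
  rcases le_total |x| 1 with h | h
  · have h1 := Complex.exp_bound (x := Complex.I * x) (by rw [hn]; exact h) (n := 3) (by norm_num)
    rw [hn] at h1
    have e : Complex.exp (Complex.I * x) - ∑ m ∈ Finset.range 3, (Complex.I * x) ^ m / (m.factorial : ℂ)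
        = Complex.exp (Complex.I * x) - 1 - Complex.I * x + x ^ 2 / 2 := by
      simp [Finset.sum_range_succ, mul_pow, Complex.I_sq]
      ring
    rw [e] at h1
    refine h1.trans ?_
    norm_num [Nat.factorial]
    nlinarith [pow_nonneg (abs_nonneg x) 3]
  · have h1 := norm_exp_I_sub_one_le x
    have h2 : ‖(x : ℂ) ^ 2 / 2‖ = |x| ^ 2 / 2 := by simp
    calc _ ≤ ‖Complex.exp (Complex.I * x) - 1‖ + ‖Complex.I * (x : ℂ)‖ + ‖(x : ℂ) ^ 2 / 2‖ :=
          (norm_add_le _ _).trans (add_le_add_left (norm_sub_le _ _) _)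
      _ ≤ |x| + |x| + |x| ^ 2 / 2 := by rw [hn, h2]; gcongr
      _ ≤ _ := by
        have h3 : |x| ≤ |x| ^ 3 := le_self_pow₀ h (by norm_num)
        have h4 : |x| ^ 2 ≤ |x| ^ 3 := pow_le_pow_right₀ h (by norm_num)
        linarith

lemma abs_exp_neg_taylor_le (w : ℝ) :
    |Real.exp (-w) - 1 + w| ≤ w ^ 2 * max 1 (Real.exp (-w)) := by
  have h0 := Real.add_one_le_exp (-w)
  rw [abs_of_nonneg (by linarith)]
  rcases le_total 0 w with h | h
  · have h1 : Real.exp (-w) ≤ 1 / (1 + w) := by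
      rw [Real.exp_neg, ← one_div]
      exact one_div_le_one_div_of_le (by linarith) (by linarith [Real.add_one_le_exp w])
    have h2 : 1 / (1 + w) ≤ 1 - w + w ^ 2 := by
      rw [div_le_iff₀ (by linarith)]
      nlinarith [pow_nonneg h 3]
    have h3 : w ^ 2 * 1 ≤ w ^ 2 * max 1 (Real.exp (-w)) := by gcongr; exact le_max_left _ _
    linarith
  · have h1 := Real.add_one_le_exp w
    have h2 : Real.exp w * Real.exp (-w) = 1 := by rw [← Real.exp_add]; simp
    have h3 : w ^ 2 * Real.exp (-w) ≤ w ^ 2 * max 1 (Real.exp (-w)) := by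
      gcongr; exact le_max_right _ _
    have h4 : (1 - w) * (w + 1) * Real.exp (-w) ≤ (1 - w) * Real.exp w * Real.exp (-w) := by
      have := Real.exp_pos (-w)
      gcongr
      linarith
    rw [mul_assoc (1 - w) (Real.exp w), h2] at h4
    nlinarith

/-- Pointwise expansion behind the comparison of a characteristic function with a Gaussian. -/
lemma gaussian_split_error {z₁ z₂ : ℂ} (h₁ : ‖z₁‖ ≤ 1) {Q Q₁ Q₂ : ℝ} (hQ : 0 ≤ Q)
    (hQ₁ : 0 ≤ Q₁) (hQ₂ : 0 ≤ Q₂) (D : ℝ) :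
    ‖z₁ * z₂ * Complex.exp (Complex.I * D) - Real.exp (-Q / 2) -
      Real.exp (-Q / 2) * (-((Q₁ + Q₂ - Q : ℝ) : ℂ) / 2 + Complex.I * D - D ^ 2 / 2)‖ ≤
      ‖z₁ - Real.exp (-Q₁ / 2)‖ + ‖z₂ - Real.exp (-Q₂ / 2)‖ +
        ((Q₁ + Q₂ - Q) ^ 2 + |(Q₁ + Q₂ - Q) * D| + 4 * |D| ^ 3) := by
  set W := Q₁ + Q₂ - Q with hW
  set E := Complex.exp (Complex.I * D) with hE
  have hE1 : ‖E‖ = 1 := by rw [hE, mul_comm]; exact Complex.norm_exp_ofReal_mul_I D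
  have hle : ∀ x : ℝ, 0 ≤ x → Real.exp (-x / 2) ≤ 1 := fun x hx => by
    rw [Real.exp_le_one_iff]; linarith
  have hnorm : ∀ x : ℝ, ‖(Real.exp x : ℂ)‖ = Real.exp x := fun x => by
    rw [Complex.norm_real, Real.norm_eq_abs, abs_of_pos (Real.exp_pos x)]
  have hprod : Real.exp (-Q₁ / 2) * Real.exp (-Q₂ / 2) = Real.exp (-Q / 2) * Real.exp (-(W / 2)) := by
    rw [← Real.exp_add, ← Real.exp_add]; congr 1; rw [hW]; ring
  have hprodC : (Real.exp (-Q₁ / 2) : ℂ) * Real.exp (-Q₂ / 2) =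
      Real.exp (-Q / 2) * Real.exp (-(W / 2)) := by exact_mod_cast hprod
  have e : z₁ * z₂ * E - Real.exp (-Q / 2) -
      Real.exp (-Q / 2) * (-(W : ℂ) / 2 + Complex.I * D - D ^ 2 / 2) =
      (z₁ * (z₂ - Real.exp (-Q₂ / 2)) + (z₁ - Real.exp (-Q₁ / 2)) * Real.exp (-Q₂ / 2)) * E +
      ((Real.exp (-Q / 2) * (Real.exp (-(W / 2)) - 1 + W / 2) : ℝ) : ℂ) * E -
      Real.exp (-Q / 2) * ((W / 2 : ℝ) : ℂ) * (E - 1) +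
      Real.exp (-Q / 2) * (E - 1 - Complex.I * D + D ^ 2 / 2) := by
    push_cast at hprodC ⊢
    linear_combination E * hprodC
  have b1 : ‖(z₁ * (z₂ - Real.exp (-Q₂ / 2)) + (z₁ - Real.exp (-Q₁ / 2)) * Real.exp (-Q₂ / 2)) * E‖
      ≤ ‖z₁ - Real.exp (-Q₁ / 2)‖ + ‖z₂ - Real.exp (-Q₂ / 2)‖ := by
    rw [norm_mul, hE1, mul_one]
    refine (norm_add_le _ _).trans ?_
    rw [norm_mul, norm_mul, hnorm]
    have := mul_le_mul_of_nonneg_right h₁ (norm_nonneg (z₂ - Real.exp (-Q₂ / 2)))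
    have := mul_le_mul_of_nonneg_left (hle Q₂ hQ₂) (norm_nonneg (z₁ - Real.exp (-Q₁ / 2)))
    linarith
  have b2 : ‖((Real.exp (-Q / 2) * (Real.exp (-(W / 2)) - 1 + W / 2) : ℝ) : ℂ) * E‖ ≤ W ^ 2 := by
    rw [norm_mul, hE1, mul_one, Complex.norm_real, Real.norm_eq_abs, abs_mul,
      abs_of_pos (Real.exp_pos _)]
    have h1 := abs_exp_neg_taylor_le (W / 2)
    have h2 : Real.exp (-Q / 2) * max 1 (Real.exp (-(W / 2))) ≤ 1 := by
      rw [mul_max_of_nonneg _ _ (Real.exp_pos _).le, mul_one, ← hprod]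
      exact max_le (hle Q hQ) (mul_le_one₀ (hle _ hQ₁) (Real.exp_pos _).le (hle _ hQ₂))
    calc _ ≤ Real.exp (-Q / 2) * ((W / 2) ^ 2 * max 1 (Real.exp (-(W / 2)))) := by gcongr
      _ = (W / 2) ^ 2 * (Real.exp (-Q / 2) * max 1 (Real.exp (-(W / 2)))) := by ring
      _ ≤ (W / 2) ^ 2 * 1 := by gcongr
      _ ≤ W ^ 2 := by nlinarith [sq_nonneg W]
  have b3 : ‖(Real.exp (-Q / 2) : ℂ) * ((W / 2 : ℝ) : ℂ) * (E - 1)‖ ≤ |W * D| := by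
    rw [norm_mul, norm_mul, hnorm, Complex.norm_real, Real.norm_eq_abs, abs_mul W D, abs_div]
    have := norm_exp_I_sub_one_le D
    calc _ ≤ 1 * (|W| / |2|) * |D| := by gcongr; exact hle Q hQ
      _ ≤ _ := by
        rw [abs_of_pos (by norm_num : (0 : ℝ) < 2)]
        nlinarith [mul_nonneg (abs_nonneg W) (abs_nonneg D)]
  have b4 : ‖(Real.exp (-Q / 2) : ℂ) * (E - 1 - Complex.I * D + D ^ 2 / 2)‖ ≤ 4 * |D| ^ 3 := by
    rw [norm_mul, hnorm]
    calc _ ≤ 1 * (4 * |D| ^ 3) := by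
          gcongr
          · exact hle Q hQ
          · exact norm_exp_I_taylor_le D
      _ = _ := one_mul _
  rw [e]
  refine (norm_add_le _ _).trans ?_
  refine (add_le_add_left ((norm_sub_le _ _).trans (add_le_add_left (norm_add_le _ _) _)) _).trans ?_
  linarith

variable {p q : ℝ}

lemma sum_bw_ofReal (n : ℕ) (F : ℕ → ℝ) :
    ∑ k ∈ Finset.range (n + 1), (bw p q n k : ℂ) * (F k : ℂ) = (bE p q n F : ℂ) := by
  simp [bE]

theorem gaussian_comparison_step (hp : 0 < p) (hq : 0 < q) (hpq : p + q = 1) {Φ : ℕ → ℂ}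
    {Q : ℕ → ℝ} {D : ℕ → ℝ} {n : ℕ} (hΦ : ∀ k, ‖Φ k‖ ≤ 1) (hQ : ∀ k, 0 ≤ Q k)
    (hrec : Φ n = ∑ k ∈ Finset.range (n + 1),
      (bw p q n k : ℂ) * (Φ k * Φ (n - k) * Complex.exp (Complex.I * D k)))
    (hQrec : Q n = bE p q n (fun k => Q k + Q (n - k)) + bE p q n (fun k => D k ^ 2))
    (hD : bE p q n D = 0) :
    ‖Φ n - Real.exp (-Q n / 2)‖ ≤
      bE p q n (fun k => ‖Φ k - Real.exp (-Q k / 2)‖ + ‖Φ (n - k) - Real.exp (-Q (n - k) / 2)‖) +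
      bE p q n (fun k => (Q k + Q (n - k) - Q n) ^ 2 + |(Q k + Q (n - k) - Q n) * D k| +
        4 * |D k| ^ 3) := by
  have hone : ∑ k ∈ Finset.range (n + 1), (bw p q n k : ℂ) = 1 := by
    have := sum_bw_ofReal (p := p) (q := q) n (fun _ => 1)
    rw [bE_const hpq] at this
    simpa using this
  have hsum : ∑ k ∈ Finset.range (n + 1),
      (bw p q n k : ℂ) * (-((Q k + Q (n - k) - Q n : ℝ) : ℂ) / 2 + Complex.I * D k - (D k : ℂ) ^ 2 / 2)
      = 0 := by
    have h1 := sum_bw_ofReal (p := p) (q := q) n (fun k => Q k + Q (n - k) - Q n + D k ^ 2)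
    have h2 := sum_bw_ofReal (p := p) (q := q) n D
    have h3 : bE p q n (fun k => Q k + Q (n - k) - Q n + D k ^ 2) = 0 := by
      rw [bE_add, bE_sub, bE_const hpq]; linarith
    rw [h3] at h1
    rw [hD] at h2
    have e : ∀ k, (bw p q n k : ℂ) *
        (-((Q k + Q (n - k) - Q n : ℝ) : ℂ) / 2 + Complex.I * D k - (D k : ℂ) ^ 2 / 2) =
        (-1 / 2) * ((bw p q n k : ℂ) * ((Q k + Q (n - k) - Q n + D k ^ 2 : ℝ) : ℂ)) +
        Complex.I * ((bw p q n k : ℂ) * (D k : ℂ)) := fun k => by push_cast; ring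
    rw [Finset.sum_congr rfl fun k _ => e k, Finset.sum_add_distrib, ← Finset.mul_sum,
      ← Finset.mul_sum, h1, h2]
    simp
  have key : Φ n - Real.exp (-Q n / 2) = ∑ k ∈ Finset.range (n + 1), (bw p q n k : ℂ) *
      (Φ k * Φ (n - k) * Complex.exp (Complex.I * D k) - Real.exp (-Q n / 2) -
      Real.exp (-Q n / 2) *
        (-((Q k + Q (n - k) - Q n : ℝ) : ℂ) / 2 + Complex.I * D k - (D k : ℂ) ^ 2 / 2)) := by
    simp only [mul_sub (bw p q n _ : ℂ), Finset.sum_sub_distrib, ← hrec, ← Finset.sum_mul, hone,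
      one_mul, mul_left_comm (bw p q n _ : ℂ) (Real.exp (-Q n / 2) : ℂ), ← Finset.mul_sum] at hsum ⊢
    rw [hsum, mul_zero, sub_zero]
  rw [key, ← bE_add]
  refine (norm_sum_le _ _).trans ?_
  unfold bE
  refine Finset.sum_le_sum fun k _ => ?_
  rw [norm_mul, Complex.norm_real, Real.norm_eq_abs, abs_of_nonneg (bw_nonneg hp hq n k)]
  exact mul_le_mul_of_nonneg_left
    (gaussian_split_error (hΦ k) (hQ n) (hQ k) (hQ (n - k)) (D k)) (bw_nonneg hp hq n k)

end CharFun


section SuperSolution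

variable {p q : ℝ}

lemma mul_sqrt_le {k m : ℝ} (hk : 0 ≤ k) (hm : 0 < m) : k * √k ≤ k * (m + k) / (2 * √m) := by
  have hz : 0 < √m := Real.sqrt_pos.2 hm
  rw [le_div_iff₀ (by positivity)]
  have e1 := Real.sq_sqrt hk
  have e2 := Real.sq_sqrt hm.le
  have : 2 * (√k * √m) ≤ m + k := by nlinarith [sq_nonneg (√k - √m)]
  nlinarith

lemma le_sqrt_concave {k m : ℝ} (hk : 0 ≤ k) (hm : 0 < m) :
    (3 * m * k - k ^ 2) / (2 * (m * √m)) ≤ √k := by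
  have hz : 0 < √m := Real.sqrt_pos.2 hm
  rw [div_le_iff₀ (by positivity)]
  have e1 := Real.sq_sqrt hk
  have e2 := Real.sq_sqrt hm.le
  have hx := Real.sqrt_nonneg k
  set x := √k
  set z := √m
  rw [← e1, ← e2]
  have : 0 ≤ x * ((x - z) ^ 2 * (x + 2 * z)) := by positivity
  nlinarith

lemma bE_split_sq (hpq : p + q = 1) (m : ℕ) :
    bE p q m (fun k => (k : ℝ) ^ 2 + ((m - k : ℕ) : ℝ) ^ 2) =
      (m : ℝ) ^ 2 - 2 * (m * (m - 1) * p * q) := by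
  have h := bE_mul_compl (p := p) (q := q) hpq m
  have e : bE p q m (fun k => (k : ℝ) ^ 2 + ((m - k : ℕ) : ℝ) ^ 2) =
      bE p q m (fun k => (m : ℝ) ^ 2 - 2 * ((k : ℝ) * ((m : ℝ) - k))) :=
    bE_congr fun k hk => by rw [Nat.cast_sub hk]; ring
  rw [e, bE_sub, bE_const hpq, bE_mul, h]

lemma bE_mul_sqrt_le (hp : 0 < p) (hq : 0 < q) (hpq : p + q = 1) {m : ℕ} (hm : 2 ≤ m) :
    bE p q m (fun k => (k : ℝ) * √k + ((m - k : ℕ) : ℝ) * √((m - k : ℕ) : ℝ)) ≤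
      m * √m * (1 - p * q / 2) := by
  have hm2 : (2 : ℝ) ≤ m := by exact_mod_cast hm
  have hm0 : (0 : ℝ) < m := by linarith
  have hz : 0 < √(m : ℝ) := Real.sqrt_pos.2 hm0
  have h1 : bE p q m (fun k => (k : ℝ) * √k + ((m - k : ℕ) : ℝ) * √((m - k : ℕ) : ℝ)) ≤
      bE p q m (fun k => 1 / (2 * √(m : ℝ)) *
        ((m : ℝ) ^ 2 + ((k : ℝ) ^ 2 + ((m - k : ℕ) : ℝ) ^ 2))) := by
    refine bE_mono hp hq fun k hk => ?_
    refine (add_le_add (mul_sqrt_le (Nat.cast_nonneg k) hm0)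
      (mul_sqrt_le (Nat.cast_nonneg (m - k)) hm0)).trans (le_of_eq ?_)
    rw [Nat.cast_sub hk]
    field_simp
    ring
  have h2 : bE p q m (fun k => (m : ℝ) ^ 2 + ((k : ℝ) ^ 2 + ((m - k : ℕ) : ℝ) ^ 2)) =
      2 * (m : ℝ) ^ 2 - 2 * (m * (m - 1) * p * q) := by
    rw [bE_add, bE_const hpq, bE_split_sq hpq]
    ring
  rw [bE_mul, h2] at h1
  refine h1.trans ?_
  rw [one_div_mul_eq_div, div_le_iff₀ (by positivity)]
  have e2 := Real.sq_sqrt hm0.le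
  have e : (m : ℝ) * √m * (1 - p * q / 2) * (2 * √m) = 2 * m ^ 2 * (1 - p * q / 2) := by
    calc _ = 2 * m * (√m) ^ 2 * (1 - p * q / 2) := by ring
      _ = _ := by rw [e2]; ring
  rw [e]
  have : 0 ≤ (m : ℝ) * (m - 2) * (p * q) :=
    mul_nonneg (mul_nonneg hm0.le (by linarith)) (mul_pos hp hq).le
  nlinarith

lemma bE_sqrt_ge (hp : 0 < p) (hq : 0 < q) (hpq : p + q = 1) {m : ℕ} (hm : 2 ≤ m) :
    √(m : ℝ) * (1 + p * q / 2) ≤ bE p q m (fun k => √(k : ℝ) + √((m - k : ℕ) : ℝ)) := by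
  have hm2 : (2 : ℝ) ≤ m := by exact_mod_cast hm
  have hm0 : (0 : ℝ) < m := by linarith
  have hz : 0 < √(m : ℝ) := Real.sqrt_pos.2 hm0
  have h1 : bE p q m (fun k => 1 / (2 * (m * √(m : ℝ))) *
        (3 * (m : ℝ) ^ 2 - ((k : ℝ) ^ 2 + ((m - k : ℕ) : ℝ) ^ 2))) ≤
      bE p q m (fun k => √(k : ℝ) + √((m - k : ℕ) : ℝ)) := by
    refine bE_mono hp hq fun k hk => ?_
    refine le_trans (le_of_eq ?_) (add_le_add (le_sqrt_concave (Nat.cast_nonneg k) hm0)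
      (le_sqrt_concave (Nat.cast_nonneg (m - k)) hm0))
    rw [Nat.cast_sub hk]
    field_simp
    ring
  rw [bE_mul, bE_sub, bE_const hpq, bE_split_sq hpq] at h1
  refine le_trans ?_ h1
  rw [one_div_mul_eq_div, le_div_iff₀ (by positivity)]
  have e2 := Real.sq_sqrt hm0.le
  have e : √(m : ℝ) * (1 + p * q / 2) * (2 * (m * √m)) = 2 * m ^ 2 * (1 + p * q / 2) := by
    calc _ = 2 * m * (√m) ^ 2 * (1 + p * q / 2) := by ring
      _ = _ := by rw [e2]; ring
  rw [e]
  have : 0 ≤ (m : ℝ) * (m - 2) * (p * q) :=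
    mul_nonneg (mul_nonneg hm0.le (by linarith)) (mul_pos hp hq).le
  nlinarith

theorem sqrt_supersolution (hp : 0 < p) (hq : 0 < q) (hpq : p + q = 1) {d r : ℕ → ℝ} {n : ℕ}
    {η C : ℝ} (hη : 0 ≤ η) (hC : 0 ≤ C) (h0 : d 0 ≤ 0) (h1 : d 1 ≤ 0)
    (hd : ∀ m, 2 ≤ m → m ≤ n → d m ≤ bE p q m (fun k => d k + d (m - k)) + r m)
    (hr : ∀ m, 2 ≤ m → m ≤ n → r m ≤ η * (m * √m) + C * √m) :
    d n ≤ 2 / (p * q) * (η * (n * √n) + C * n) := by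
  have hpq0 : 0 < p * q := mul_pos hp hq
  set c := 2 / (p * q) with hc
  have hc0 : 0 < c := by positivity
  have hcpq : c * (p * q / 2) = 1 := by rw [hc]; field_simp
  set U : ℕ → ℝ := fun m => c * (η * (m * √m) + C * (m - √m)) with hU
  have key : d n ≤ U n := by
    refine comparison hp hq hpq zero_le_one le_rfl zero_le_one le_rfl (N := 1) (M := n) le_rfl
      d U r ?_ ?_ ?_ n le_rfl
    · intro m hm _
      interval_cases m
      · simpa [hU] using h0
      · have : 0 ≤ c * η := by positivity
        simp only [hU, Nat.cast_one, Real.sqrt_one]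
        linarith
    · intro m hm hmn
      simpa using hd m hm hmn
    · intro m hm hmn
      have b1 := bE_mul_sqrt_le hp hq hpq hm
      have b2 := bE_sqrt_ge hp hq hpq hm
      have e : bE p q m (fun k => 1 * U k + 1 * U (m - k)) =
          c * η * bE p q m (fun k => (k : ℝ) * √k + ((m - k : ℕ) : ℝ) * √((m - k : ℕ) : ℝ)) +
          c * C * (m - bE p q m (fun k => √(k : ℝ) + √((m - k : ℕ) : ℝ))) := by
        rw [← bE_const (p := p) (q := q) hpq m (m : ℝ), ← bE_sub, ← bE_mul, ← bE_mul, ← bE_add]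
        refine bE_congr fun k hk => ?_
        have : ((m - k : ℕ) : ℝ) = m - k := Nat.cast_sub hk
        have h3 : (m : ℝ) = k + ((m - k : ℕ) : ℝ) := by rw [this]; ring
        simp only [hU]
        rw [h3]
        ring
      rw [e]
      have b3 := mul_le_mul_of_nonneg_left b1 (by positivity : 0 ≤ c * η)
      have b4 := mul_le_mul_of_nonneg_left b2 (by positivity : 0 ≤ c * C)
      have b5 := hr m hm hmn
      simp only [hU]
      have e1 : c * η * (m * √m * (1 - p * q / 2)) = c * η * (m * √m) - η * (m * √m) := by
        linear_combination (-(η * (m * √m))) * hcpq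
      have e2 : c * C * (√m * (1 + p * q / 2)) = c * C * √m + C * √m := by
        linear_combination (C * √m) * hcpq
      rw [e1] at b3
      rw [e2] at b4
      linarith
  refine key.trans ?_
  simp only [hU]
  have := Real.sqrt_nonneg (n : ℝ)
  gcongr
  linarith

end SuperSolution


section SplitMoments

variable {p q s t s' t' : ℝ} {f g V : ℕ → ℝ}

/-- `F n` is at most a small multiple of `n ^ j`, up to a constant. -/
def Small (F : ℕ → ℝ) (j : ℕ) : Prop :=
  ∀ ε : ℝ, 0 < ε → ∃ C, 0 ≤ C ∧ ∀ n : ℕ, F n ≤ ε * (n : ℝ) ^ j + C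

lemma exists_bound_of_eventually {F G : ℕ → ℝ} (hG : ∀ n, 0 ≤ G n)
    (h : ∀ᶠ n in atTop, F n ≤ G n) : ∃ C, 0 ≤ C ∧ ∀ n, F n ≤ G n + C := by
  obtain ⟨N, hN⟩ := eventually_atTop.1 h
  obtain ⟨C, hC, hb⟩ := exists_bound_le F N
  refine ⟨C, hC, fun n => ?_⟩
  rcases le_total n N with hn | hn
  · linarith [hb n hn, hG n]
  · linarith [hN n hn]

lemma small_of_eventually {F : ℕ → ℝ} {j : ℕ}
    (h : ∀ ε : ℝ, 0 < ε → ∃ C, 0 ≤ C ∧ ∀ᶠ n : ℕ in atTop, F n ≤ ε * (n : ℝ) ^ j + C) :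
    Small F j := by
  intro ε hε
  obtain ⟨C, hC, hF⟩ := h ε hε
  obtain ⟨C', hC', hb⟩ := exists_bound_of_eventually (fun n => by positivity) hF
  exact ⟨C + C', by positivity, fun n => by linarith [hb n]⟩

lemma eventually_two_le_mul (hp : 0 < p) : ∀ᶠ n : ℕ in atTop, 2 ≤ (n : ℝ) * p :=
  (tendsto_natCast_atTop_atTop.atTop_mul_const hp).eventually_ge_atTop 2

lemma splitDev_moments_small (hp : 0 < p) (hq : 0 < q) (hpq : p + q = 1)
    (hf : Aff p q s 0 f) :
    Small (fun n => bE p q n (fun k => splitDev s 0 f n k ^ 2)) 1 ∧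
    Small (fun n => bE p q n (fun k => splitDev s 0 f n k ^ 4)) 2 := by
  obtain ⟨C, hC, h⟩ := splitDev_moments hp hq hpq hf
  have hs := hf.tendsto_slope hp hq hpq
  simp only [zero_div, zero_mul] at hs
  have hs : Tendsto (fun n : ℕ => slope p q f n) atTop (𝓝 0) :=
    hs.comp tendsto_natCast_atTop_atTop
  have hs2 : Tendsto (fun n : ℕ => C * slope p q f n ^ 2) atTop (𝓝 0) := by
    simpa using (hs.pow 2).const_mul C
  have hs4 : Tendsto (fun n : ℕ => C * slope p q f n ^ 4) atTop (𝓝 0) := by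
    simpa using (hs.pow 4).const_mul C
  constructor
  · refine small_of_eventually fun ε hε => ⟨C, hC, ?_⟩
    filter_upwards [hs2.eventually_lt_const hε, eventually_two_le_mul hp, eventually_two_le_mul hq]
      with n h1 h2 h3
    refine (h n h2 h3).1.trans ?_
    have := mul_le_mul_of_nonneg_right h1.le (by positivity : (0 : ℝ) ≤ (n : ℝ) ^ 1)
    linarith
  · refine small_of_eventually fun ε hε => ⟨C, hC, ?_⟩
    filter_upwards [hs4.eventually_lt_const hε, eventually_two_le_mul hp, eventually_two_le_mul hq]
      with n h1 h2 h3
    refine (h n h2 h3).2.trans ?_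
    have := mul_le_mul_of_nonneg_right h1.le (by positivity : (0 : ℝ) ≤ (n : ℝ) ^ 2)
    linarith

lemma splitDev_moments_le (hp : 0 < p) (hq : 0 < q) (hpq : p + q = 1) (hf : Aff p q s t f) :
    ∃ C, 0 ≤ C ∧ ∀ n : ℕ,
      bE p q n (fun k => splitDev s t f n k ^ 2) ≤ C * n + C ∧
      bE p q n (fun k => splitDev s t f n k ^ 4) ≤ C * n ^ 2 + C := by
  obtain ⟨C, hC, h⟩ := splitDev_moments hp hq hpq hf
  obtain ⟨B, hB, hb⟩ := slope_bound hp hq hpq hf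
  have hb2 : ∀ n : ℕ, slope p q f n ^ 2 ≤ B ^ 2 := fun n => by
    rw [← sq_abs]; exact pow_le_pow_left₀ (abs_nonneg _) (hb n n.cast_nonneg) 2
  have hb4 : ∀ n : ℕ, slope p q f n ^ 4 ≤ B ^ 4 := fun n => by
    have := pow_le_pow_left₀ (sq_nonneg _) (hb2 n) 2
    rw [← pow_mul, ← pow_mul] at this
    exact this
  obtain ⟨C₂, hC₂, h2⟩ := exists_bound_of_eventually
    (F := fun n => bE p q n (fun k => splitDev s t f n k ^ 2)) (G := fun n => C * (B ^ 2 * n + 1))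
    (fun n => by positivity) (by
      filter_upwards [eventually_two_le_mul hp, eventually_two_le_mul hq] with n h2 h3
      refine (h n h2 h3).1.trans ?_
      have := mul_le_mul_of_nonneg_right (hb2 n) n.cast_nonneg
      exact mul_le_mul_of_nonneg_left (by linarith) hC)
  obtain ⟨C₄, hC₄, h4⟩ := exists_bound_of_eventually
    (F := fun n => bE p q n (fun k => splitDev s t f n k ^ 4))
    (G := fun n => C * (B ^ 4 * (n : ℝ) ^ 2 + 1))
    (fun n => by positivity) (by
      filter_upwards [eventually_two_le_mul hp, eventually_two_le_mul hq] with n h2 h3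
      refine (h n h2 h3).2.trans ?_
      have := mul_le_mul_of_nonneg_right (hb4 n) (by positivity : (0 : ℝ) ≤ (n : ℝ) ^ 2)
      exact mul_le_mul_of_nonneg_left (by linarith) hC)
  have hCB2 : 0 ≤ C * B ^ 2 := by positivity
  have hCB4 : 0 ≤ C * B ^ 4 := by positivity
  refine ⟨C * B ^ 2 + C * B ^ 4 + C + C₂ + C₄, by positivity, fun n => ⟨(h2 n).trans ?_,
    (h4 n).trans ?_⟩⟩
  · have : 0 ≤ (C * B ^ 4 + C + C₂ + C₄) * (n : ℝ) := by positivity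
    linarith
  · have : 0 ≤ (C * B ^ 2 + C + C₂ + C₄) * (n : ℝ) ^ 2 := by positivity
    linarith

lemma sq_log_small (A : ℝ) :
    Small (fun n => (A * (Real.log ((n : ℝ) + 1) + 1)) ^ 2 * (n + 1)) 2 := by
  refine small_of_eventually fun ε hε => ⟨0, le_rfl, ?_⟩
  have hc : 0 < ε / (12 * (A ^ 2 + 1)) := by positivity
  set c := ε / (12 * (A ^ 2 + 1)) with hcdef
  have hl := ((Real.isLittleO_pow_log_id_atTop (n := 2)).comp_tendsto
    (tendsto_atTop_add_const_right atTop (1 : ℝ) tendsto_natCast_atTop_atTop)).bound hc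
  filter_upwards [hl, eventually_ge_atTop 1,
    (tendsto_natCast_atTop_atTop (R := ℝ)).eventually_ge_atTop (1 / c)] with n h1 h2 h3
  have hn1 : (1 : ℝ) ≤ n := by exact_mod_cast h2
  simp only [Function.comp_def, id, Real.norm_eq_abs] at h1
  rw [abs_of_nonneg (by positivity), abs_of_nonneg (by positivity)] at h1
  rw [div_le_iff₀ hc] at h3
  set l := Real.log ((n : ℝ) + 1)
  have h4 : (l + 1) ^ 2 ≤ 6 * c * n := by nlinarith [sq_nonneg (l - 1)]
  have h5 : A ^ 2 * c ≤ ε / 12 := by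
    rw [hcdef, ← mul_div_assoc, div_le_div_iff₀ (by positivity) (by positivity)]
    nlinarith
  calc (A * (l + 1)) ^ 2 * (n + 1) = A ^ 2 * ((l + 1) ^ 2 * (n + 1)) := by ring
    _ ≤ A ^ 2 * ((6 * c * n) * (2 * n)) := by gcongr; linarith
    _ = 12 * (A ^ 2 * c) * n ^ 2 := by ring
    _ ≤ 12 * (ε / 12) * n ^ 2 := by gcongr
    _ = ε * (n : ℝ) ^ 2 + 0 := by ring

lemma CovFn.split_sq_le (hp : 0 < p) (hq : 0 < q) (hpq : p + q = 1) (hf : Aff p q s t f)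
    (hg : Aff p q s' t' g) (hV : CovFn p q s t s' t' f g V) (ε : ℝ) (hε : 0 < ε) :
    ∃ C, 0 ≤ C ∧ ∀ n : ℕ, 2 ≤ n → bE p q n (fun k => (V k + V (n - k) - V n) ^ 2) ≤
      tau p q s t s' t' f g n ^ 2 + (ε * n ^ 2 + C) := by
  obtain ⟨A, hA, hstep⟩ := hV.step hp hq hpq hf hg
  obtain ⟨C, hC, hlog⟩ := sq_log_small A (ε / 8) (by positivity)
  refine ⟨8 * C, by positivity, fun n hn => ?_⟩
  set L := A * (Real.log ((n : ℝ) + 1) + 1) with hL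
  have hL0 : 0 ≤ L := mul_nonneg hA (add_nonneg
    (Real.log_nonneg (by linarith [n.cast_nonneg (α := ℝ)])) zero_le_one)
  have hp1 : p ≤ 1 := by linarith
  have hn0 : (0 : ℝ) ≤ n := n.cast_nonneg
  set j := ⌊n * p⌋₊ with hj
  have hjn : j ≤ n := Nat.floor_le_of_le (mul_le_of_le_one_right hn0 hp1)
  have hj1 : |n * p - (j : ℝ)| ≤ 1 := floor_dist (by positivity)
  set U : ℕ → ℝ := fun k => V k + V (n - k) - V n with hU
  have hmean : bE p q n U = -tau p q s t s' t' f g n := by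
    have := hV.recur n hn
    rw [hU, bE_sub, bE_const hpq]
    linarith
  have hdev : bE p q n (fun k => (U k - U j) ^ 2) ≤ ε * n ^ 2 + 8 * C := by
    have h1 : bE p q n (fun k => (U k - U j) ^ 2) ≤
        bE p q n (fun k => 8 * L ^ 2 * (((k : ℝ) - n * p) ^ 2 + 1)) := by
      refine bE_mono hp hq fun k hk => ?_
      have a1 := lipschitz_of_step hA hstep hk hjn
      have a2 := lipschitz_of_step hA hstep (Nat.sub_le n k) (Nat.sub_le n j)
      rw [Nat.cast_sub hk, Nat.cast_sub hjn, sub_sub_sub_cancel_left, abs_sub_comm (j : ℝ)] at a2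
      have a3 : |U k - U j| ≤ 2 * L * |(k : ℝ) - j| := by
        have : U k - U j = (V k - V j) + (V (n - k) - V (n - j)) := by simp only [hU]; ring
        rw [this]
        refine (abs_add_le _ _).trans ?_
        linarith
      have a4 : ((k : ℝ) - j) ^ 2 ≤ 2 * (((k : ℝ) - n * p) ^ 2 + 1) := by
        have : (n * p - (j : ℝ)) ^ 2 ≤ 1 := by
          rw [← sq_abs]; nlinarith [abs_nonneg (n * p - (j : ℝ))]
        nlinarith [sq_nonneg (((k : ℝ) - n * p) - (n * p - j))]
      calc (U k - U j) ^ 2 = |U k - U j| ^ 2 := (sq_abs _).symm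
        _ ≤ (2 * L * |(k : ℝ) - j|) ^ 2 := by gcongr
        _ = 4 * L ^ 2 * ((k : ℝ) - j) ^ 2 := by rw [mul_pow, sq_abs]; ring
        _ ≤ 4 * L ^ 2 * (2 * (((k : ℝ) - n * p) ^ 2 + 1)) := by gcongr
        _ = _ := by ring
    rw [bE_mul, bE_add, bE_var hpq, bE_const hpq] at h1
    have h2 : (n : ℝ) * p * q ≤ n := by
      have : p * q ≤ 1 := by nlinarith
      nlinarith
    have h3 := hlog n
    simp only [← hL] at h3
    have h4 : 8 * L ^ 2 * (n * p * q + 1) ≤ 8 * L ^ 2 * (n + 1) := by gcongr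
    linarith
  have hexp : bE p q n (fun k => (U k - U j) ^ 2) =
      bE p q n (fun k => U k ^ 2) - (2 * U j) * bE p q n U + U j ^ 2 := by
    rw [← bE_const (p := p) (q := q) hpq n (U j ^ 2), ← bE_mul, ← bE_sub, ← bE_add]
    exact bE_congr fun k _ => by ring
  rw [hmean] at hexp
  nlinarith [sq_nonneg (U j + tau p q s t s' t' f g n)]

lemma abs_tau_le (hp : 0 < p) (hq : 0 < q) (n : ℕ) :
    |tau p q s t s' t' f g n| ≤ 1 / 2 * (bE p q n (fun k => splitDev s t f n k ^ 2) +
      bE p q n (fun k => splitDev s' t' g n k ^ 2)) := by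
  rw [← bE_add, ← bE_mul]
  refine (bE_abs_le hp hq _ _).trans (bE_mono hp hq fun k _ => ?_)
  rw [abs_mul, ← sq_abs (splitDev s t f n k), ← sq_abs (splitDev s' t' g n k)]
  nlinarith [sq_nonneg (|splitDev s t f n k| - |splitDev s' t' g n k|)]

lemma CovFn.split_sq_le_quadratic (hp : 0 < p) (hq : 0 < q) (hpq : p + q = 1)
    (hf : Aff p q s t f) (hg : Aff p q s' t' g) (hV : CovFn p q s t s' t' f g V) :
    ∃ C, 0 ≤ C ∧ ∀ n : ℕ, 2 ≤ n →
      bE p q n (fun k => (V k + V (n - k) - V n) ^ 2) ≤ C * n ^ 2 + C := by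
  obtain ⟨C₀, hC₀, h0⟩ := hV.split_sq_le hp hq hpq hf hg 1 one_pos
  obtain ⟨C₁, hC₁, h1⟩ := splitDev_moments_le hp hq hpq hf
  obtain ⟨C₂, hC₂, h2⟩ := splitDev_moments_le hp hq hpq hg
  refine ⟨2 * (C₁ + C₂) ^ 2 + 1 + C₀, by positivity, fun n hn => (h0 n hn).trans ?_⟩
  have h3 := abs_tau_le (s := s) (t := t) (s' := s') (t' := t') (f := f) (g := g) hp hq n
  have h4 : |tau p q s t s' t' f g n| ≤ (C₁ + C₂) * (n + 1) := by
    have := (h1 n).1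
    have := (h2 n).1
    have : 0 ≤ (C₁ + C₂) * ((n : ℝ) + 1) := by positivity
    linarith
  have h5 : tau p q s t s' t' f g n ^ 2 ≤ (C₁ + C₂) ^ 2 * (n + 1) ^ 2 := by
    rw [← sq_abs, ← mul_pow]; gcongr
  have h6 : (C₁ + C₂) ^ 2 * ((n : ℝ) + 1) ^ 2 ≤ (C₁ + C₂) ^ 2 * (2 * n ^ 2 + 2) := by
    gcongr; nlinarith [sq_nonneg ((n : ℝ) - 1)]
  have : 0 ≤ C₀ * (n : ℝ) ^ 2 := by positivity
  nlinarith

lemma CovFn.split_sq_small (hp : 0 < p) (hq : 0 < q) (hpq : p + q = 1)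
    (hf : Aff p q s 0 f) (hV : CovFn p q s 0 s 0 f f V) (ε : ℝ) (hε : 0 < ε) :
    ∃ C, 0 ≤ C ∧ ∀ n : ℕ, 2 ≤ n →
      bE p q n (fun k => (V k + V (n - k) - V n) ^ 2) ≤ ε * n ^ 2 + C := by
  obtain ⟨C₀, hC₀, h0⟩ := hV.split_sq_le hp hq hpq hf hf (ε / 2) (by positivity)
  obtain ⟨C₁, hC₁, h1⟩ := (splitDev_moments_small hp hq hpq hf).1 (√(ε / 4)) (by positivity)
  refine ⟨2 * C₁ ^ 2 + C₀, by positivity, fun n hn => (h0 n hn).trans ?_⟩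
  have h3 := abs_tau_le (s := s) (t := 0) (s' := s) (t' := 0) (f := f) (g := f) hp hq n
  have h4 : |tau p q s 0 s 0 f f n| ≤ √(ε / 4) * n + C₁ := by
    have := h1 n
    simp only [pow_one] at this
    linarith
  have h5 : tau p q s 0 s 0 f f n ^ 2 ≤ (√(ε / 4) * n + C₁) ^ 2 := by
    rw [← sq_abs]; gcongr
  have h6 : (√(ε / 4) * n + C₁) ^ 2 ≤ 2 * (√(ε / 4)) ^ 2 * n ^ 2 + 2 * C₁ ^ 2 := by
    nlinarith [sq_nonneg (√(ε / 4) * n - C₁)]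
  rw [Real.sq_sqrt (by positivity)] at h6
  nlinarith

end SplitMoments


section Toll

variable {p q : ℝ}

lemma toll_pointwise_le {a b c x y u v w : ℝ} (hc : 0 < c) (hc1 : c ≤ 1) :
    (a ^ 2 * u + 2 * (a * b) * v + b ^ 2 * w) ^ 2 +
      |(a ^ 2 * u + 2 * (a * b) * v + b ^ 2 * w) * (a * x + b * y)| + 4 * |a * x + b * y| ^ 3 ≤
    6 / c * ((a ^ 2) ^ 2 * u ^ 2 + 4 * (a ^ 2 * b ^ 2) * v ^ 2 + (b ^ 2) ^ 2 * w ^ 2) +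
      6 * c * (a ^ 2 * x ^ 2 + b ^ 2 * y ^ 2) +
      16 / c * ((a ^ 2) ^ 2 * x ^ 4 + (b ^ 2) ^ 2 * y ^ 4) := by
  set W := a ^ 2 * u + 2 * (a * b) * v + b ^ 2 * w with hW
  set D := a * x + b * y with hD
  have hW2 : W ^ 2 ≤ 3 * ((a ^ 2) ^ 2 * u ^ 2 + 4 * (a ^ 2 * b ^ 2) * v ^ 2 + (b ^ 2) ^ 2 * w ^ 2) := by
    nlinarith [sq_nonneg (a ^ 2 * u - 2 * (a * b) * v), sq_nonneg (a ^ 2 * u - b ^ 2 * w),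
      sq_nonneg (2 * (a * b) * v - b ^ 2 * w)]
  have hD2 : D ^ 2 ≤ 2 * (a ^ 2 * x ^ 2 + b ^ 2 * y ^ 2) := by
    nlinarith [sq_nonneg (a * x - b * y)]
  have hD4 : D ^ 4 ≤ 8 * ((a ^ 2) ^ 2 * x ^ 4 + (b ^ 2) ^ 2 * y ^ 4) := by
    have h1 : D ^ 4 ≤ (2 * (a ^ 2 * x ^ 2 + b ^ 2 * y ^ 2)) ^ 2 := by
      have := pow_le_pow_left₀ (sq_nonneg D) hD2 2
      rwa [← pow_mul] at this
    nlinarith [sq_nonneg (a ^ 2 * x ^ 2 - b ^ 2 * y ^ 2)]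
  have e1 : |W * D| ≤ W ^ 2 / c + c * D ^ 2 := by
    rw [abs_mul, ← sq_abs W, ← sq_abs D, ← sub_nonneg]
    have : |W| ^ 2 / c + c * |D| ^ 2 - |W| * |D| =
        1 / c * ((|W| - c * |D|) ^ 2 + c * (|W| * |D|)) := by field_simp; ring
    rw [this]
    positivity
  have e2 : 2 * |D| ^ 3 ≤ c * D ^ 2 + D ^ 4 / c := by
    have e4 : D ^ 4 = |D| ^ 4 := by rw [← abs_pow, abs_of_nonneg (by positivity)]
    rw [e4, ← sq_abs D, ← sub_nonneg]
    have : c * |D| ^ 2 + |D| ^ 4 / c - 2 * |D| ^ 3 = 1 / c * (|D| * (c - |D|)) ^ 2 := by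
      field_simp; ring
    rw [this]
    positivity
  have e3 : W ^ 2 ≤ W ^ 2 / c := by
    rw [le_div_iff₀ hc]; nlinarith [sq_nonneg W]
  calc W ^ 2 + |W * D| + 4 * |D| ^ 3 ≤ 2 / c * W ^ 2 + 3 * c * D ^ 2 + 2 / c * D ^ 4 := by
        have : 2 / c * W ^ 2 + 3 * c * D ^ 2 + 2 / c * D ^ 4 =
          2 * (W ^ 2 / c) + 3 * c * D ^ 2 + 2 * (D ^ 4 / c) := by ring
        linarith
    _ ≤ 2 / c * (3 * ((a ^ 2) ^ 2 * u ^ 2 + 4 * (a ^ 2 * b ^ 2) * v ^ 2 + (b ^ 2) ^ 2 * w ^ 2)) +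
        3 * c * (2 * (a ^ 2 * x ^ 2 + b ^ 2 * y ^ 2)) +
        2 / c * (8 * ((a ^ 2) ^ 2 * x ^ 4 + (b ^ 2) ^ 2 * y ^ 4)) := by gcongr
    _ = _ := by ring

lemma bE_toll_le (hp : 0 < p) (hq : 0 < q) (m : ℕ) {a b c : ℝ} (hc : 0 < c) (hc1 : c ≤ 1)
    (x y u v w : ℕ → ℝ) :
    bE p q m (fun k => (a ^ 2 * u k + 2 * (a * b) * v k + b ^ 2 * w k) ^ 2 +
      |(a ^ 2 * u k + 2 * (a * b) * v k + b ^ 2 * w k) * (a * x k + b * y k)| +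
      4 * |a * x k + b * y k| ^ 3) ≤
    6 / c * ((a ^ 2) ^ 2 * bE p q m (fun k => u k ^ 2) +
        4 * (a ^ 2 * b ^ 2) * bE p q m (fun k => v k ^ 2) +
        (b ^ 2) ^ 2 * bE p q m (fun k => w k ^ 2)) +
      6 * c * (a ^ 2 * bE p q m (fun k => x k ^ 2) + b ^ 2 * bE p q m (fun k => y k ^ 2)) +
      16 / c * ((a ^ 2) ^ 2 * bE p q m (fun k => x k ^ 4) +
        (b ^ 2) ^ 2 * bE p q m (fun k => y k ^ 4)) := by
  refine (bE_mono hp hq fun k _ => toll_pointwise_le hc hc1).trans (le_of_eq ?_)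
  simp only [← bE_mul, ← bE_add]

lemma toll_numeric {A C δ n m α β u v w x₂ y₂ x₄ y₄ C' : ℝ} (hA : 0 ≤ A) (hC : 0 ≤ C)
    (hδ : 0 ≤ δ) (hδ1 : δ ≤ 1) (hC' : 0 ≤ C') (hm : 0 < m) (hmn : m ≤ n) (hα : 0 ≤ α)
    (hβ : 0 ≤ β) (hαn : α * n ≤ A) (hβn : β * n ≤ δ)
    (hu : u ≤ δ * m ^ 2 + C') (hv : v ≤ C * m ^ 2 + C) (hw : w ≤ C * m ^ 2 + C)
    (hx₂ : x₂ ≤ δ * m + C') (hy₂ : y₂ ≤ C * m + C)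
    (hx₄ : x₄ ≤ δ * m ^ 2 + C') (hy₄ : y₄ ≤ C * m ^ 2 + C) :
    6 / √(m / n) * (α ^ 2 * u + 4 * (α * β) * v + β ^ 2 * w) +
      6 * √(m / n) * (α * x₂ + β * y₂) + 16 / √(m / n) * (α ^ 2 * x₄ + β ^ 2 * y₄) ≤
    28 * (δ * (A + A ^ 2 + (4 * A + 2) * C) * (m * √m) +
      (C' * (A + A ^ 2) + (4 * A + 2) * C) * (√m + √m / m)) / (n * √n) := by
  have hn : 0 < n := hm.trans_le hmn
  have hsm : 0 < √m := Real.sqrt_pos.2 hm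
  have hsn : 0 < √n := Real.sqrt_pos.2 hn
  have em := Real.mul_self_sqrt hm.le
  have en := Real.mul_self_sqrt hn.le
  have hα' : α ≤ A / n := by rwa [le_div_iff₀ hn]
  have hβ' : β ≤ δ / n := by rwa [le_div_iff₀ hn]
  set K := A + A ^ 2 + (4 * A + 2) * C with hK
  set J := C' * (A + A ^ 2) + (4 * A + 2) * C with hJ
  have hδ2 : δ ^ 2 ≤ δ := by nlinarith
  have hquad : ∀ z₁ z₂ z₃ : ℝ, z₁ ≤ δ * m ^ 2 + C' → z₂ ≤ C * m ^ 2 + C → z₃ ≤ C * m ^ 2 + C →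
      α ^ 2 * z₁ + 4 * (α * β) * z₂ + β ^ 2 * z₃ ≤ (δ * K * m ^ 2 + J) / n ^ 2 := by
    intro z₁ z₂ z₃ h1 h2 h3
    calc _ ≤ α ^ 2 * (δ * m ^ 2 + C') + 4 * (α * β) * (C * m ^ 2 + C) +
          β ^ 2 * (C * m ^ 2 + C) := by gcongr
      _ ≤ (A / n) ^ 2 * (δ * m ^ 2 + C') + 4 * ((A / n) * (δ / n)) * (C * m ^ 2 + C) +
          (δ / n) ^ 2 * (C * m ^ 2 + C) := by gcongr
      _ = (A ^ 2 * (δ * m ^ 2 + C') + (4 * A * δ + δ ^ 2) * (C * m ^ 2 + C)) / n ^ 2 := by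
        field_simp
        ring
      _ ≤ _ := by
        refine div_le_div_of_nonneg_right ?_ (by positivity)
        have h4 : (4 * A * δ + δ ^ 2) * (C * m ^ 2 + C) ≤
            (δ * (4 * A + 2)) * (C * m ^ 2 + C) := by gcongr; linarith
        have h5 : δ * ((4 * A + 2) * C) ≤ 1 * ((4 * A + 2) * C) := by gcongr
        have h6 : 0 ≤ δ * A * m ^ 2 := by positivity
        have h7 : 0 ≤ C' * A := by positivity
        rw [hK, hJ]
        linarith
  have hlin : α * x₂ + β * y₂ ≤ (δ * K * m + J) / n := by
    calc _ ≤ α * (δ * m + C') + β * (C * m + C) := by gcongr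
      _ ≤ (A / n) * (δ * m + C') + (δ / n) * (C * m + C) := by gcongr
      _ = (A * (δ * m + C') + δ * (C * m + C)) / n := by field_simp
      _ ≤ _ := by
        refine div_le_div_of_nonneg_right ?_ hn.le
        have h5 : δ * C ≤ 1 * C := by gcongr
        have h6 : 0 ≤ δ * (A ^ 2 + (4 * A + 1) * C) * m := by positivity
        have h7 : 0 ≤ C' * A ^ 2 + (4 * A + 1) * C := by positivity
        rw [hK, hJ]
        linarith
  have hq1 := hquad u v w hu hv hw
  have hq2 : α ^ 2 * x₄ + β ^ 2 * y₄ ≤ (δ * K * m ^ 2 + J) / n ^ 2 := by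
    have := hquad x₄ 0 y₄ hx₄ (by positivity) hy₄
    linarith
  have hK0 : 0 ≤ K := by positivity
  have hJ0 : 0 ≤ J := by positivity
  calc _ ≤ 6 / √(m / n) * ((δ * K * m ^ 2 + J) / n ^ 2) + 6 * √(m / n) * ((δ * K * m + J) / n) +
        16 / √(m / n) * ((δ * K * m ^ 2 + J) / n ^ 2) := by gcongr
    _ ≤ _ := by
      rw [Real.sqrt_div hm.le]
      have e (c : ℝ) : c / (√m / √n) * ((δ * K * m ^ 2 + J) / n ^ 2) =
          c * (δ * K * (m * √m) + J * (√m / m)) / (n * √n) := by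
        have h (x z : ℝ) (hx : 0 < x) (hz : 0 < z) :
            c / (x / z) * ((δ * K * (x * x) ^ 2 + J) / (z * z) ^ 2) =
            c * (δ * K * ((x * x) * x) + J * (x / (x * x))) / ((z * z) * z) := by field_simp
        have := h √m √n hsm hsn
        rwa [em, en] at this
      have e3 : 6 * (√m / √n) * ((δ * K * m + J) / n) =
          6 * (δ * K * (m * √m) + J * √m) / (n * √n) := by field_simp
      rw [e, e, e3, ← add_div, ← add_div]
      gcongr
      have : 0 ≤ J * √m := by positivity
      have : 0 ≤ J * (√m / m) := by positivity
      linarith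

end Toll


section GaussianApprox

variable {p q s s' t' : ℝ} {f g V W Z : ℕ → ℝ}

theorem gaussian_approx (hp : 0 < p) (hq : 0 < q) (hpq : p + q = 1) (hf : Aff p q s 0 f)
    (hg : Aff p q s' t' g) (hV : CovFn p q s 0 s 0 f f V) (hW : CovFn p q s 0 s' t' f g W)
    (hZ : CovFn p q s' t' s' t' g g Z) {A ε : ℝ} (hA : 0 ≤ A) (hε : 0 < ε) :
    ∃ δ, 0 < δ ∧ ∃ C, 0 ≤ C ∧ ∀ n : ℕ, 1 ≤ n → ∀ a b : ℝ, a ^ 2 * n ≤ A → b ^ 2 * n ≤ δ →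
      ∀ Φ : ℕ → ℂ, (∀ k, ‖Φ k‖ ≤ 1) → Φ 0 = 1 → Φ 1 = 1 →
      (∀ m, 2 ≤ m → Φ m = ∑ k ∈ Finset.range (m + 1), (bw p q m k : ℂ) * (Φ k * Φ (m - k) *
        Complex.exp (Complex.I * (a * splitDev s 0 f m k + b * splitDev s' t' g m k : ℝ)))) →
      (∀ k, 0 ≤ a ^ 2 * V k + 2 * (a * b) * W k + b ^ 2 * Z k) →
      ‖Φ n - Real.exp (-(a ^ 2 * V n + 2 * (a * b) * W n + b ^ 2 * Z n) / 2)‖ ≤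
        2 / (p * q) * (ε + C / √n) := by
  obtain ⟨Cg, hCg, hg24⟩ := splitDev_moments_le hp hq hpq hg
  obtain ⟨CW, hCW, hW2⟩ := hW.split_sq_le_quadratic hp hq hpq hf hg
  obtain ⟨CZ, hCZ, hZ2⟩ := hZ.split_sq_le_quadratic hp hq hpq hg hg
  set C := Cg + CW + CZ with hCdef
  have hC : 0 ≤ C := by positivity
  set K := A + A ^ 2 + (4 * A + 2) * C with hK
  have hK0 : 0 ≤ K := by positivity
  set δ := min 1 (ε / (28 * K + 1)) with hδdef
  have hδ : 0 < δ := lt_min one_pos (by positivity)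
  have hδ1 : δ ≤ 1 := min_le_left _ _
  have hδK : 28 * (δ * K) ≤ ε := by
    have h1 : δ ≤ ε / (28 * K + 1) := min_le_right _ _
    rw [le_div_iff₀ (by positivity)] at h1
    linarith
  obtain ⟨C₂, hC₂, hf2⟩ := (splitDev_moments_small hp hq hpq hf).1 δ hδ
  obtain ⟨C₄, hC₄, hf4⟩ := (splitDev_moments_small hp hq hpq hf).2 δ hδ
  obtain ⟨CV, hCV, hV2⟩ := hV.split_sq_small hp hq hpq hf δ hδ
  set C' := C₂ + C₄ + CV with hC'def
  have hC' : 0 ≤ C' := by positivity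
  set J := C' * (A + A ^ 2) + (4 * A + 2) * C with hJ
  have hJ0 : 0 ≤ J := by positivity
  refine ⟨δ, hδ, 56 * J, by positivity, fun n hn a b ha hb Φ hΦ hΦ0 hΦ1 hrec hQ0 => ?_⟩
  have hn0 : (0 : ℝ) < n := by exact_mod_cast hn
  have hsn : 0 < √(n : ℝ) := Real.sqrt_pos.2 hn0
  set Q : ℕ → ℝ := fun k => a ^ 2 * V k + 2 * (a * b) * W k + b ^ 2 * Z k with hQ
  set D : ℕ → ℕ → ℝ := fun m k => a * splitDev s 0 f m k + b * splitDev s' t' g m k with hD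
  set d : ℕ → ℝ := fun m => ‖Φ m - Real.exp (-Q m / 2)‖ with hd
  set r : ℕ → ℝ := fun m => bE p q m (fun k => (Q k + Q (m - k) - Q m) ^ 2 +
    |(Q k + Q (m - k) - Q m) * D m k| + 4 * |D m k| ^ 3) with hr
  have hd0 : d 0 ≤ 0 := by simp [hd, hQ, hΦ0, hV.zero, hW.zero, hZ.zero]
  have hd1 : d 1 ≤ 0 := by simp [hd, hQ, hΦ1, hV.one, hW.one, hZ.one]
  have hstep : ∀ m, 2 ≤ m → m ≤ n → d m ≤ bE p q m (fun k => d k + d (m - k)) + r m := by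
    intro m hm _
    refine gaussian_comparison_step hp hq hpq hΦ hQ0 (hrec m hm) ?_ ?_
    · have hD2 : bE p q m (fun k => D m k ^ 2) = a ^ 2 * tau p q s 0 s 0 f f m +
          2 * (a * b) * tau p q s 0 s' t' f g m + b ^ 2 * tau p q s' t' s' t' g g m := by
        unfold tau
        simp only [← bE_mul, ← bE_add]
        exact bE_congr fun k _ => by simp only [hD]; ring
      have hQ2 : bE p q m (fun k => Q k + Q (m - k)) =
          a ^ 2 * bE p q m (fun k => V k + V (m - k)) +
          2 * (a * b) * bE p q m (fun k => W k + W (m - k)) +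
          b ^ 2 * bE p q m (fun k => Z k + Z (m - k)) := by
        simp only [← bE_mul, ← bE_add]
        exact bE_congr fun k _ => by simp only [hQ]; ring
      rw [hD2, hQ2]
      simp only [hQ]
      rw [hV.recur m hm, hW.recur m hm, hZ.recur m hm]
      ring
    · simp only [hD]
      rw [bE_add, bE_mul, bE_mul, splitDev_mean hpq hf hm, splitDev_mean hpq hg hm]
      ring
  have htoll : ∀ m, 2 ≤ m → m ≤ n → r m ≤
      28 * (δ * K) / (n * √n) * (m * √m) + 56 * J / (n * √n) * √m := by
    intro m hm hmn
    have hm2 : (2 : ℝ) ≤ m := by exact_mod_cast hm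
    have hm0 : (0 : ℝ) < m := by linarith
    have hmn' : (m : ℝ) ≤ n := by exact_mod_cast hmn
    have e : r m = bE p q m (fun k => (a ^ 2 * (V k + V (m - k) - V m) +
        2 * (a * b) * (W k + W (m - k) - W m) + b ^ 2 * (Z k + Z (m - k) - Z m)) ^ 2 +
        |(a ^ 2 * (V k + V (m - k) - V m) +
        2 * (a * b) * (W k + W (m - k) - W m) + b ^ 2 * (Z k + Z (m - k) - Z m)) *
          (a * splitDev s 0 f m k + b * splitDev s' t' g m k)| +
        4 * |a * splitDev s 0 f m k + b * splitDev s' t' g m k| ^ 3) := by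
      refine bE_congr fun k _ => ?_
      have : Q k + Q (m - k) - Q m = a ^ 2 * (V k + V (m - k) - V m) +
        2 * (a * b) * (W k + W (m - k) - W m) + b ^ 2 * (Z k + Z (m - k) - Z m) := by
        simp only [hQ]; ring
      rw [this]
    rw [e]
    refine (bE_toll_le hp hq m (c := √(m / n)) (Real.sqrt_pos.2 (by positivity))
      (Real.sqrt_le_one.2 ((div_le_one hn0).2 hmn')) _ _ _ _ _).trans ?_
    have hle : ∀ {c c' x : ℝ}, c ≤ c' → 0 ≤ x → c * x + c ≤ c' * x + c' := fun h hx => by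
      gcongr
    have b1 : bE p q m (fun k => splitDev s 0 f m k ^ 2) ≤ δ * m + C' := by
      have := hf2 m
      simp only [pow_one] at this
      linarith
    have b2 : bE p q m (fun k => splitDev s 0 f m k ^ 4) ≤ δ * m ^ 2 + C' := by
      have := hf4 m
      simp only at this
      linarith
    have b3 := hV2 m hm
    refine (toll_numeric (C := C) hA hC hδ.le hδ1 hC' hm0 hmn' (sq_nonneg a) (sq_nonneg b) ha hb
      (by linarith) ((hW2 m hm).trans (hle (by linarith) (by positivity)))
      ((hZ2 m hm).trans (hle (by linarith) (by positivity))) b1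
      ((hg24 m).1.trans (hle (by linarith) hm0.le)) b2
      ((hg24 m).2.trans (hle (by linarith) (by positivity)))).trans ?_
    rw [div_mul_eq_mul_div, div_mul_eq_mul_div, ← add_div]
    refine div_le_div_of_nonneg_right ?_ (by positivity)
    have h1 : √(m : ℝ) / m ≤ √(m : ℝ) := div_le_self (Real.sqrt_nonneg _) (by linarith)
    have h2 : J * (√m + √m / m) ≤ J * (√m + √m) := by gcongr
    rw [← hK, ← hJ]
    linarith
  refine (sqrt_supersolution hp hq hpq (by positivity) (by positivity) hd0 hd1 hstep htoll).trans ?_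
  have e1 : 28 * (δ * K) / (n * √n) * (n * √n) = 28 * (δ * K) := by field_simp
  have e2 : 56 * J / (n * √n) * n = 56 * J / √n := by field_simp
  rw [e1, e2]
  have := mul_pos hp hq
  gcongr

end GaussianApprox


section Mixture

variable {p : ℝ} {μ : ℕ → Measure (ℕ × ℕ)}

/-- The pair obtained by splitting `n` strings, as a function of the pairs of the two subtries. -/
def joinPair (n : ℕ) (z : (ℕ × ℕ) × (ℕ × ℕ)) : ℕ × ℕ :=
  (z.1.1 + z.2.1 + 1, z.1.2 + z.2.2 + n)

lemma measurable_trieStep (n : ℕ) : Measurable (trieStep n) := by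
  refine measurable_from_prod_countable_right fun k => ?_
  have h1 : Measurable fun x : (ℕ → ℕ × ℕ) × (ℕ → ℕ × ℕ) => (x.1 k, x.2 (n - k)) := by fun_prop
  exact (measurable_of_countable (joinPair n)).comp h1

lemma _root_.IsTriePairFamily.mixture (hμ : IsTriePairFamily p μ) {n : ℕ} (hn : 2 ≤ n) :
    μ n = ∑ k ∈ Finset.range (n + 1), ENNReal.ofReal (bw p (1 - p) n k) •
      ((μ k).prod (μ (n - k))).map (joinPair n) := by
  obtain ⟨P, hP, hfst, h1, h2, hprod, hstep⟩ := hμ.recur n hn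
  have hm1 : Measurable fun ω : ℕ × ((ℕ → ℕ × ℕ) × (ℕ → ℕ × ℕ)) => ω.2.1 := by fun_prop
  have hm2 : Measurable fun ω : ℕ × ((ℕ → ℕ × ℕ) × (ℕ → ℕ × ℕ)) => ω.2.2 := by fun_prop
  set P₁ := P.map (fun ω => ω.2.1) with hP1
  set P₂ := P.map (fun ω => ω.2.2) with hP2
  have : IsProbabilityMeasure P₁ := Measure.isProbabilityMeasure_map hm1.aemeasurable
  have : IsProbabilityMeasure P₂ := Measure.isProbabilityMeasure_map hm2.aemeasurable
  have e1 (j : ℕ) : P₁.map (fun g => g j) = μ j := by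
    rw [hP1, Measure.map_map (measurable_pi_apply j) hm1, ← h1 j]; rfl
  have e2 (j : ℕ) : P₂.map (fun g => g j) = μ j := by
    rw [hP2, Measure.map_map (measurable_pi_apply j) hm2, ← h2 j]; rfl
  rw [hfst] at hprod
  ext s hs
  rw [hstep, Measure.map_apply (measurable_trieStep n) hs, hprod,
    Measure.prod_apply (measurable_trieStep n hs), binomialMeasure,
    lintegral_finsetSum_measure, Measure.finsetSum_apply]
  refine Finset.sum_congr rfl fun k _ => ?_
  have hm (j : ℕ) : Measurable fun g : ℕ → ℕ × ℕ => g j := measurable_pi_apply j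
  rw [lintegral_smul_measure, lintegral_dirac, Measure.smul_apply, ← e1 k, ← e2 (n - k),
    Measure.map_prod_map _ _ (hm _) (hm _),
    Measure.map_map (measurable_of_countable _) ((hm _).prodMap (hm _)),
    Measure.map_apply ((measurable_of_countable _).comp ((hm _).prodMap (hm _))) hs]
  rfl

lemma _root_.IsTriePairFamily.integral_eq {E : Type*} [NormedAddCommGroup E] [NormedSpace ℝ E]
    (hp0 : 0 < p) (hp1 : p < 1) (hμ : IsTriePairFamily p μ) {n : ℕ} (hn : 2 ≤ n)
    {F : ℕ × ℕ → E} (hF : ∀ k ≤ n, Integrable (fun z => F (joinPair n z))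
      ((μ k).prod (μ (n - k)))) :
    ∫ x, F x ∂μ n = ∑ k ∈ Finset.range (n + 1), bw p (1 - p) n k •
      ∫ z, F (joinPair n z) ∂(μ k).prod (μ (n - k)) := by
  have hsm : StronglyMeasurable F := StronglyMeasurable.of_discrete
  have hj : Measurable (joinPair n) := measurable_of_countable _
  rw [hμ.mixture hn, integral_finsetSum_measure]
  · refine Finset.sum_congr rfl fun k _ => ?_
    rw [integral_smul_measure, integral_map hj.aemeasurable hsm.aestronglyMeasurable,
      ENNReal.toReal_ofReal (bw_nonneg hp0 (by linarith) n k)]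
  · intro k hk
    refine Integrable.smul_measure ?_ ENNReal.ofReal_ne_top
    rw [integrable_map_measure hsm.aestronglyMeasurable hj.aemeasurable]
    exact hF k (by simpa [Nat.lt_succ_iff] using hk)

end Mixture


/-- A cost functional that adds up over the two subtries, with a toll `s + t * n`. -/
structure AdditiveCost (s t : ℝ) (φ : ℕ × ℕ → ℝ) : Prop where
  map_zero : φ (0, 0) = 0
  abs_le : ∀ x, |φ x| ≤ (x.1 : ℝ) + x.2
  join : ∀ n z, φ (joinPair n z) = φ z.1 + φ z.2 + (s + t * n)

lemma additiveCost_fst : AdditiveCost 1 0 (fun x => (x.1 : ℝ)) where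
  map_zero := by simp
  abs_le x := by simp
  join n z := by simp [joinPair]

lemma additiveCost_snd : AdditiveCost 0 1 (fun x => (x.2 : ℝ)) where
  map_zero := by simp
  abs_le x := by simp
  join n z := by simp [joinPair]

lemma integral_mul_add_prod {α β : Type*} [MeasurableSpace α] [MeasurableSpace β]
    {μ : Measure α} {ν : Measure β} [IsProbabilityMeasure μ] [IsProbabilityMeasure ν]
    {X Y : α → ℝ} {X' Y' : β → ℝ} (hX : Integrable X μ) (hY : Integrable Y μ)
    (hX' : Integrable X' ν) (hY' : Integrable Y' ν) (hXY : Integrable (fun x => X x * Y x) μ)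
    (hXY' : Integrable (fun x => X' x * Y' x) ν) (mX : ∫ x, X x ∂μ = 0) (mY : ∫ x, Y x ∂μ = 0)
    (mX' : ∫ x, X' x ∂ν = 0) (mY' : ∫ x, Y' x ∂ν = 0) (c d : ℝ) :
    Integrable (fun z : α × β => (X z.1 + X' z.2 + c) * (Y z.1 + Y' z.2 + d)) (μ.prod ν) ∧
    ∫ z, (X z.1 + X' z.2 + c) * (Y z.1 + Y' z.2 + d) ∂μ.prod ν =
      ∫ x, X x * Y x ∂μ + ∫ y, X' y * Y' y ∂ν + c * d := by
  have i1 : Integrable (fun x => (X x + c) * (Y x + d)) μ := by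
    have : Integrable (fun x => X x * Y x + d * X x + (c * Y x + c * d)) μ :=
      (hXY.add (hX.const_mul d)).add ((hY.const_mul c).add (integrable_const _))
    exact this.congr (ae_of_all _ fun x => by ring)
  have hprod : Integrable (fun z : α × β => (X z.1 + X' z.2 + c) * (Y z.1 + Y' z.2 + d))
      (μ.prod ν) := by
    have j1 := i1.comp_fst ν
    have j2 := hXY'.comp_snd μ
    have j3 := (hX.add (integrable_const c)).mul_prod hY'
    have j4 := (hY.add (integrable_const d)).mul_prod hX'
    refine (((j1.add j2).add j3).add j4).congr (ae_of_all _ fun z => ?_)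
    simp only [Pi.add_apply]
    ring
  refine ⟨hprod, ?_⟩
  rw [integral_prod _ hprod]
  have inner (x : α) : ∫ y, (X x + X' y + c) * (Y x + Y' y + d) ∂ν =
      (X x * Y x + d * X x) + (c * Y x + (c * d + ∫ y, X' y * Y' y ∂ν)) := by
    have e : (fun y => (X x + X' y + c) * (Y x + Y' y + d)) = fun y =>
        (X x + c) * (Y x + d) + (X x + c) * Y' y + (Y x + d) * X' y + X' y * Y' y := by
      funext y; ring
    have k1 : Integrable (fun y => (X x + c) * (Y x + d) + (X x + c) * Y' y) ν :=
      (integrable_const _).add (hY'.const_mul _)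
    have k2 : Integrable (fun y => (X x + c) * (Y x + d) + (X x + c) * Y' y +
      (Y x + d) * X' y) ν := k1.add (hX'.const_mul _)
    rw [e, integral_add k2 hXY', integral_add k1 (hX'.const_mul _),
      integral_add (integrable_const _) (hY'.const_mul _), integral_const, integral_const_mul,
      integral_const_mul, mX', mY']
    simp
    ring
  have l1 : Integrable (fun x => X x * Y x + d * X x) μ := hXY.add (hX.const_mul d)
  have l2 : Integrable (fun x => c * Y x + (c * d + ∫ y, X' y * Y' y ∂ν)) μ :=
    (hY.const_mul c).add (integrable_const _)
  simp only [inner]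
  rw [integral_add l1 l2, integral_add hXY (hX.const_mul d),
    integral_add (hY.const_mul c) (integrable_const _), integral_const_mul, integral_const_mul,
    mX, mY, integral_const]
  simp
  ring

section Moments

variable {p s t s' t' : ℝ} {μ : ℕ → Measure (ℕ × ℕ)} {φ ψ : ℕ × ℕ → ℝ}

lemma AdditiveCost.memLp (hφ : AdditiveCost s t φ) (hμ : IsTriePairFamily p μ) (n : ℕ) :
    MemLp φ 2 (μ n) := by
  rw [memLp_two_iff_integrable_sq (StronglyMeasurable.of_discrete.aestronglyMeasurable)]
  refine (hμ.moments n 2).mono StronglyMeasurable.of_discrete.aestronglyMeasurable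
    (ae_of_all _ fun x => ?_)
  rw [Real.norm_eq_abs, Real.norm_eq_abs, abs_pow, abs_pow]
  exact pow_le_pow_left₀ (abs_nonneg _) ((hφ.abs_le x).trans (le_abs_self _)) 2

lemma AdditiveCost.aff (hp0 : 0 < p) (hp1 : p < 1) (hφ : AdditiveCost s t φ)
    (hμ : IsTriePairFamily p μ) : Aff p (1 - p) s t (fun n => ∫ x, φ x ∂μ n) where
  zero := by simp [hμ.init0, hφ.map_zero]
  one := by simp [hμ.init1, hφ.map_zero]
  recur n hn := by
    have := hμ.prob
    have hi (k : ℕ) : Integrable φ (μ k) := (hφ.memLp hμ k).integrable one_le_two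
    have h1 (k : ℕ) : Integrable (fun z : (ℕ × ℕ) × (ℕ × ℕ) => φ z.1 + φ z.2)
        ((μ k).prod (μ (n - k))) := ((hi k).comp_fst _).add ((hi (n - k)).comp_snd _)
    rw [hμ.integral_eq hp0 hp1 hn, ← bE_const (p := p) (q := 1 - p) (by ring) n (s + t * n),
      ← bE_add]
    · refine Finset.sum_congr rfl fun k _ => ?_
      simp only [hφ.join]
      rw [integral_add (h1 k) (integrable_const _), integral_add ((hi k).comp_fst _)
        ((hi (n - k)).comp_snd _), integral_fun_fst, integral_fun_snd, integral_const]
      simp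
    · intro k _
      simp only [hφ.join]
      exact (h1 k).add (integrable_const _)

lemma AdditiveCost.integrable_cov (hφ : AdditiveCost s t φ) (hψ : AdditiveCost s' t' ψ)
    (hμ : IsTriePairFamily p μ) (n : ℕ) (c d : ℝ) :
    Integrable (fun x => (φ x - c) * (ψ x - d)) (μ n) := by
  have := hμ.prob
  exact ((hφ.memLp hμ n).sub (memLp_const c)).integrable_mul
    ((hψ.memLp hμ n).sub (memLp_const d))

lemma AdditiveCost.covFn (hp0 : 0 < p) (hp1 : p < 1) (hφ : AdditiveCost s t φ)
    (hψ : AdditiveCost s' t' ψ) (hμ : IsTriePairFamily p μ) :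
    CovFn p (1 - p) s t s' t' (fun n => ∫ x, φ x ∂μ n) (fun n => ∫ x, ψ x ∂μ n)
      (fun n => ∫ x, (φ x - ∫ y, φ y ∂μ n) * (ψ x - ∫ y, ψ y ∂μ n) ∂μ n) where
  zero := by simp [hμ.init0, hφ.map_zero]
  one := by simp [hμ.init1, hφ.map_zero]
  recur n hn := by
    have := hμ.prob
    have hi {s t : ℝ} {φ : ℕ × ℕ → ℝ} (hφ : AdditiveCost s t φ) (k : ℕ) :
        Integrable φ (μ k) := (hφ.memLp hμ k).integrable one_le_two
    have hi' {s t : ℝ} {φ : ℕ × ℕ → ℝ} (hφ : AdditiveCost s t φ) (k : ℕ) :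
        Integrable (fun x => φ x - ∫ y, φ y ∂μ k) (μ k) := (hi hφ k).sub (integrable_const _)
    have hm {s t : ℝ} {φ : ℕ × ℕ → ℝ} (hφ : AdditiveCost s t φ) (k : ℕ) :
        ∫ x, (φ x - ∫ y, φ y ∂μ k) ∂μ k = 0 := by
      rw [integral_sub (hi hφ k) (integrable_const _)]; simp
    have key (k : ℕ) := integral_mul_add_prod (hi' hφ k) (hi' hψ k) (hi' hφ (n - k))
      (hi' hψ (n - k)) (hφ.integrable_cov hψ hμ k _ _) (hφ.integrable_cov hψ hμ (n - k) _ _)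
      (hm hφ k) (hm hψ k) (hm hφ (n - k)) (hm hψ (n - k))
      (splitDev s t (fun n => ∫ x, φ x ∂μ n) n k) (splitDev s' t' (fun n => ∫ x, ψ x ∂μ n) n k)
    have e (k : ℕ) : (fun z : (ℕ × ℕ) × (ℕ × ℕ) => (φ (joinPair n z) - ∫ y, φ y ∂μ n) *
        (ψ (joinPair n z) - ∫ y, ψ y ∂μ n)) = fun z =>
        (φ z.1 - ∫ y, φ y ∂μ k + (φ z.2 - ∫ y, φ y ∂μ (n - k)) +
          splitDev s t (fun n => ∫ x, φ x ∂μ n) n k) *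
        (ψ z.1 - ∫ y, ψ y ∂μ k + (ψ z.2 - ∫ y, ψ y ∂μ (n - k)) +
          splitDev s' t' (fun n => ∫ x, ψ x ∂μ n) n k) := by
      funext z
      rw [hφ.join, hψ.join]
      simp only [splitDev]
      ring
    rw [hμ.integral_eq hp0 hp1 hn, tau, ← bE_add]
    · refine Finset.sum_congr rfl fun k _ => ?_
      rw [e k, (key k).2, smul_eq_mul]
    · intro k _
      rw [e k]
      exact (key k).1

/-- The characteristic function of the centred pair. -/
noncomputable def centredCharFun (μ : ℕ → Measure (ℕ × ℕ)) (φ ψ : ℕ × ℕ → ℝ) (a b : ℝ)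
    (n : ℕ) : ℂ :=
  ∫ x, Complex.exp (Complex.I *
    (a * (φ x - ∫ y, φ y ∂μ n) + b * (ψ x - ∫ y, ψ y ∂μ n) : ℝ)) ∂μ n

lemma norm_exp_I_mul_ofReal (x : ℝ) : ‖Complex.exp (Complex.I * x)‖ = 1 := by
  rw [mul_comm, Complex.norm_exp_ofReal_mul_I]

lemma norm_centredCharFun_le (hμ : IsTriePairFamily p μ) (a b : ℝ) (n : ℕ) :
    ‖centredCharFun μ φ ψ a b n‖ ≤ 1 := by
  have := hμ.prob n
  refine (norm_integral_le_of_norm_le_const (C := 1)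
    (ae_of_all _ fun x => (norm_exp_I_mul_ofReal _).le)).trans ?_
  simp

lemma AdditiveCost.centredCharFun_recur (hp0 : 0 < p) (hp1 : p < 1) (hφ : AdditiveCost s t φ)
    (hψ : AdditiveCost s' t' ψ) (hμ : IsTriePairFamily p μ) (a b : ℝ) {n : ℕ} (hn : 2 ≤ n) :
    centredCharFun μ φ ψ a b n = ∑ k ∈ Finset.range (n + 1), (bw p (1 - p) n k : ℂ) *
      (centredCharFun μ φ ψ a b k * centredCharFun μ φ ψ a b (n - k) *
        Complex.exp (Complex.I * (a * splitDev s t (fun n => ∫ x, φ x ∂μ n) n k +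
          b * splitDev s' t' (fun n => ∫ x, ψ x ∂μ n) n k : ℝ))) := by
  have := hμ.prob
  rw [centredCharFun, hμ.integral_eq hp0 hp1 hn]
  · refine Finset.sum_congr rfl fun k _ => ?_
    rw [centredCharFun, centredCharFun, ← integral_prod_mul, ← integral_mul_const,
      Complex.real_smul]
    congr 2
    funext z
    rw [← Complex.exp_add, ← Complex.exp_add]
    congr 1
    rw [hφ.join, hψ.join]
    simp only [splitDev]
    push_cast
    ring
  · intro k _
    exact Integrable.of_bound StronglyMeasurable.of_discrete.aestronglyMeasurable 1
      (ae_of_all _ fun z => (norm_exp_I_mul_ofReal _).le)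

lemma AdditiveCost.integral_sq_combination (hφ : AdditiveCost s t φ)
    (hψ : AdditiveCost s' t' ψ) (hμ : IsTriePairFamily p μ) (a b : ℝ) (n : ℕ) :
    0 ≤ a ^ 2 * (∫ x, (φ x - ∫ y, φ y ∂μ n) * (φ x - ∫ y, φ y ∂μ n) ∂μ n) +
      2 * (a * b) * (∫ x, (φ x - ∫ y, φ y ∂μ n) * (ψ x - ∫ y, ψ y ∂μ n) ∂μ n) +
      b ^ 2 * (∫ x, (ψ x - ∫ y, ψ y ∂μ n) * (ψ x - ∫ y, ψ y ∂μ n) ∂μ n) := by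
  rw [← integral_const_mul, ← integral_const_mul, ← integral_const_mul, ← integral_add,
    ← integral_add]
  · refine integral_nonneg fun x => ?_
    have : 0 ≤ (a * (φ x - ∫ y, φ y ∂μ n) + b * (ψ x - ∫ y, ψ y ∂μ n)) ^ 2 := sq_nonneg _
    simp only [Pi.zero_apply]
    linarith
  · exact ((hφ.integrable_cov hφ hμ n _ _).const_mul _).add
      ((hφ.integrable_cov hψ hμ n _ _).const_mul _)
  · exact (hψ.integrable_cov hψ hμ n _ _).const_mul _
  · exact (hφ.integrable_cov hφ hμ n _ _).const_mul _
  · exact (hφ.integrable_cov hψ hμ n _ _).const_mul _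

end Moments


section Limit

lemma tendsto_integral_of_tendsto_charFun {ν : ℕ → Measure (ℝ × ℝ)} {ν₀ : Measure (ℝ × ℝ)}
    [hν : ∀ n, IsProbabilityMeasure (ν n)] [hν₀ : IsProbabilityMeasure ν₀]
    (h : ∀ t : WithLp 2 (ℝ × ℝ), Tendsto (fun n => charFun ((ν n).map (WithLp.toLp 2)) t) atTop
      (𝓝 (charFun (ν₀.map (WithLp.toLp 2)) t)))
    (f : BoundedContinuousFunction (ℝ × ℝ) ℝ) :
    Tendsto (fun n => ∫ x, f x ∂ν n) atTop (𝓝 (∫ x, f x ∂ν₀)) := by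
  have hc := WithLp.prod_continuous_toLp 2 ℝ ℝ
  have hm := hc.measurable
  have hc' := WithLp.prod_continuous_ofLp 2 ℝ ℝ
  let N (n : ℕ) : ProbabilityMeasure (WithLp 2 (ℝ × ℝ)) :=
    ⟨(ν n).map (WithLp.toLp 2), Measure.isProbabilityMeasure_map hm.aemeasurable⟩
  let N₀ : ProbabilityMeasure (WithLp 2 (ℝ × ℝ)) :=
    ⟨ν₀.map (WithLp.toLp 2), Measure.isProbabilityMeasure_map hm.aemeasurable⟩
  have hN : Tendsto N atTop (𝓝 N₀) := ProbabilityMeasure.tendsto_iff_tendsto_charFun.2 h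
  have := ProbabilityMeasure.tendsto_iff_forall_integral_tendsto.1 hN
    (f.compContinuous ⟨WithLp.ofLp, hc'⟩)
  have e (ρ : Measure (ℝ × ℝ)) :
      ∫ x, f.compContinuous ⟨WithLp.ofLp, hc'⟩ x ∂(ρ.map (WithLp.toLp 2)) = ∫ x, f x ∂ρ := by
    rw [integral_map hm.aemeasurable
      (f.compContinuous ⟨WithLp.ofLp, hc'⟩).continuous.aestronglyMeasurable]
    rfl
  simpa only [N, N₀, ProbabilityMeasure.coe_mk, e] using this

variable {p : ℝ} {μ : ℕ → Measure (ℕ × ℕ)}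

lemma tendsto_centredCharFun (hp0 : 0 < p) (hp1 : p < 1) (hp : p ≠ 1 / 2)
    (hμ : IsTriePairFamily p μ) (α β : ℝ) :
    Tendsto (fun n => centredCharFun μ (fun x => (x.1 : ℝ)) (fun x => (x.2 : ℝ))
      (α / √(varS μ n)) (β / √(varK μ n)) n) atTop
      (𝓝 (Real.exp (-(α ^ 2 + β ^ 2) / 2) : ℂ)) := by
  have hq : 0 < 1 - p := by linarith
  have hpq : p + (1 - p) = 1 := by ring
  have hne : p ≠ 1 - p := fun h => hp (by linarith)
  have hf : Aff p (1 - p) 1 0 (eS μ) := additiveCost_fst.aff hp0 hp1 hμ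
  have hg : Aff p (1 - p) 0 1 (eK μ) := additiveCost_snd.aff hp0 hp1 hμ
  have hV : CovFn p (1 - p) 1 0 1 0 (eS μ) (eS μ) (varS μ) := by
    have := additiveCost_fst.covFn hp0 hp1 additiveCost_fst hμ
    simp only [← sq] at this
    exact this
  have hW : CovFn p (1 - p) 1 0 0 1 (eS μ) (eK μ) (covSK μ) :=
    additiveCost_fst.covFn hp0 hp1 additiveCost_snd hμ
  have hZ : CovFn p (1 - p) 0 1 0 1 (eK μ) (eK μ) (varK μ) := by
    have := additiveCost_snd.covFn hp0 hp1 additiveCost_snd hμ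
    simp only [← sq] at this
    exact this
  obtain ⟨c, hc, hVc⟩ := hV.linear_lower hp0 hq hpq hf (by norm_num)
  have hZn := hZ.superlinear hp0 hq hpq hne hg one_ne_zero
  have hcorr := hW.corr_tendsto hp0 hq hpq hf hg hZ hc hVc hZn
  have hVpos {n : ℕ} (hn : 2 ≤ n) : 0 < varS μ n := hV.pos hp0 hq hpq hf (by norm_num) hn
  have hZpos {n : ℕ} (hn : 2 ≤ n) : 0 < varK μ n := hZ.pos hp0 hq hpq hg (by norm_num) hn
  set a : ℕ → ℝ := fun n => α / √(varS μ n) with ha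
  set b : ℕ → ℝ := fun n => β / √(varK μ n) with hb
  set Q : ℕ → ℝ := fun n => a n ^ 2 * varS μ n + 2 * (a n * b n) * covSK μ n +
    b n ^ 2 * varK μ n with hQdef
  have hQ : Tendsto Q atTop (𝓝 (α ^ 2 + β ^ 2)) := by
    have h1 : Tendsto (fun n => α ^ 2 + 2 * (α * β) * (covSK μ n / (√(varS μ n) * √(varK μ n))) +
        β ^ 2) atTop (𝓝 (α ^ 2 + 2 * (α * β) * 0 + β ^ 2)) :=
      (tendsto_const_nhds.add (hcorr.const_mul _)).add tendsto_const_nhds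
    rw [mul_zero, add_zero] at h1
    refine h1.congr' ?_
    filter_upwards [eventually_ge_atTop 2] with n hn
    have hv := Real.sqrt_pos.2 (hVpos hn)
    have hz := Real.sqrt_pos.2 (hZpos hn)
    simp only [hQdef, ha, hb]
    rw [div_pow, div_pow, Real.sq_sqrt (hVpos hn).le, Real.sq_sqrt (hZpos hn).le,
      div_mul_cancel₀ _ (hVpos hn).ne', div_mul_cancel₀ _ (hZpos hn).ne']
    field_simp
  have hgauss : Tendsto (fun n => (Real.exp (-Q n / 2) : ℂ)) atTop
      (𝓝 (Real.exp (-(α ^ 2 + β ^ 2) / 2) : ℂ)) :=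
    (Complex.continuous_ofReal.tendsto _).comp
      ((Real.continuous_exp.tendsto _).comp (hQ.neg.div_const 2))
  have hdiff : Tendsto (fun n => centredCharFun μ (fun x => (x.1 : ℝ)) (fun x => (x.2 : ℝ))
      (a n) (b n) n - (Real.exp (-Q n / 2) : ℂ)) atTop (𝓝 0) := by
    rw [tendsto_zero_iff_norm_tendsto_zero, Metric.tendsto_atTop']
    intro ε hε
    have hpq0 : 0 < p * (1 - p) := mul_pos hp0 hq
    have hA : 0 ≤ α ^ 2 / c := by positivity
    have hε' : 0 < ε * (p * (1 - p)) / 8 := by positivity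
    obtain ⟨δ, hδ, C, hC, happ⟩ := gaussian_approx hp0 hq hpq hf hg hV hW hZ hA hε'
    have hlim : Tendsto (fun n : ℕ => C / √(n : ℝ)) atTop (𝓝 0) :=
      tendsto_const_nhds.div_atTop (Real.tendsto_sqrt_atTop.comp tendsto_natCast_atTop_atTop)
    obtain ⟨N, hN⟩ := eventually_atTop.1 ((hlim.eventually_lt_const hε').and
      (hZn.eventually_ge_atTop (β ^ 2 / δ)))
    refine ⟨max N 2, fun n hn => ?_⟩
    have hn2 : 2 ≤ n := (le_max_right _ _).trans hn.le
    have hn0 : (0 : ℝ) < n := by exact_mod_cast (by omega : 0 < n)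
    obtain ⟨hC1, hZ1⟩ := hN n ((le_max_left _ _).trans hn.le)
    have ha2 : a n ^ 2 * n ≤ α ^ 2 / c := by
      simp only [ha]
      rw [div_pow, Real.sq_sqrt (hVpos hn2).le, div_mul_eq_mul_div,
        div_le_div_iff₀ (hVpos hn2) hc, mul_assoc]
      exact mul_le_mul_of_nonneg_left (by linarith [hVc n hn2]) (sq_nonneg _)
    have hb2 : b n ^ 2 * n ≤ δ := by
      simp only [hb]
      rw [div_le_div_iff₀ hδ hn0] at hZ1
      rw [div_pow, Real.sq_sqrt (hZpos hn2).le, div_mul_eq_mul_div, div_le_iff₀ (hZpos hn2)]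
      linarith
    have key := happ n (by omega) (a n) (b n) ha2 hb2
      (centredCharFun μ (fun x => (x.1 : ℝ)) (fun x => (x.2 : ℝ)) (a n) (b n))
      (norm_centredCharFun_le hμ _ _) (by simp [centredCharFun, hμ.init0])
      (by simp [centredCharFun, hμ.init1])
      (fun m hm => additiveCost_fst.centredCharFun_recur hp0 hp1 additiveCost_snd hμ _ _ hm)
      (fun k => by
        have := additiveCost_fst.integral_sq_combination additiveCost_snd hμ (a n) (b n) k
        simp only [← sq] at this
        exact this)
    rw [dist_zero_right, norm_norm]
    refine key.trans_lt ?_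
    have : 2 / (p * (1 - p)) * (ε * (p * (1 - p)) / 8 + C / √n) <
        2 / (p * (1 - p)) * (ε * (p * (1 - p)) / 8 + ε * (p * (1 - p)) / 8) := by gcongr
    refine this.trans_le ?_
    have e : 2 / (p * (1 - p)) * (ε * (p * (1 - p)) / 8 + ε * (p * (1 - p)) / 8) = ε / 2 := by
      field_simp
      ring
    rw [e]
    linarith
  have := hdiff.add hgauss
  simpa using this

end Limit

end Trie

/-- for `p ≠ 1/2`, the componentwise-standardized pair `(S_n, K_n)` converges
in distribution to a pair of independent standard normals. -/
theorem stmt4 (p : ℝ) (hp0 : 0 < p) (hp1 : p < 1) (hp : p ≠ 1 / 2)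
    (μ : ℕ → Measure (ℕ × ℕ)) (hμ : IsTriePairFamily p μ) :
    ∀ f : BoundedContinuousFunction (ℝ × ℝ) ℝ,
      Tendsto (fun n : ℕ => ∫ x, f x ∂ ((μ n).map (fun x : ℕ × ℕ =>
          (((x.1 : ℝ) - eS μ n) / Real.sqrt (varS μ n),
           ((x.2 : ℝ) - eK μ n) / Real.sqrt (varK μ n)))))
        atTop (𝓝 (∫ x, f x ∂ ((gaussianReal 0 1).prod (gaussianReal 0 1)))) := by
  intro f
  have hprob := hμ.prob
  have hm (n : ℕ) : Measurable (fun x : ℕ × ℕ => (((x.1 : ℝ) - eS μ n) / Real.sqrt (varS μ n),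
      ((x.2 : ℝ) - eK μ n) / Real.sqrt (varK μ n))) := measurable_of_countable _
  have (n : ℕ) : IsProbabilityMeasure ((μ n).map (fun x : ℕ × ℕ =>
      (((x.1 : ℝ) - eS μ n) / Real.sqrt (varS μ n),
        ((x.2 : ℝ) - eK μ n) / Real.sqrt (varK μ n)))) :=
    Measure.isProbabilityMeasure_map (hm n).aemeasurable
  refine Trie.tendsto_integral_of_tendsto_charFun (fun t => ?_) f
  have hL := (WithLp.prod_continuous_toLp 2 ℝ ℝ).measurable
  have hlim := Trie.tendsto_centredCharFun hp0 hp1 hp hμ (WithLp.ofLp t).1 (WithLp.ofLp t).2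
  have e0 : charFun (((gaussianReal 0 1).prod (gaussianReal 0 1)).map (WithLp.toLp 2)) t =
      (Real.exp (-((WithLp.ofLp t).1 ^ 2 + (WithLp.ofLp t).2 ^ 2) / 2) : ℂ) := by
    rw [charFun_prod, charFun_gaussianReal, charFun_gaussianReal, ← Complex.exp_add,
      Complex.ofReal_exp]
    congr 1
    push_cast
    ring
  rw [e0]
  refine hlim.congr fun n => ?_
  rw [charFun_apply, Measure.map_map hL (hm n), integral_map (hL.comp (hm n)).aemeasurable
    (by fun_prop), Trie.centredCharFun]
  refine integral_congr_ae (ae_of_all _ fun x => ?_)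
  simp only [Function.comp_apply, WithLp.prod_inner_apply]
  congr 1
  simp only [eS, eK, RCLike.inner_apply, conj_trivial]
  push_cast
  ring
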